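/- Let d be either d = pq for two primes p ≡ q ≡ 3 (mod 8), or d = p for a prime p ≡ 9 (mod 16) such that 2 is a fourth power residue modulo p, and let r ≥ 0 be the integer with 2^r = h₂(-2d). Then for every integer n ≥ 1, the 2-class group of K_{n,d} is isomorphic to (ℤ/2ℤ) × (ℤ/2^{n+r-1}ℤ). -/

import Mathlib

open IntermediateField NumberField

/-- The quadratic field `ℚ(√m)` realized inside `ℂ` (for `m` of either sign). -/
noncomputable def quadField (m : ℤ) : IntermediateField ℚ ℂ :=
  IntermediateField.adjoin ℚ {z : ℂ | z ^ 2 = (m : ℂ)}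

/-- The 2-class group of a number field `K ⊆ ℂ`: the 2-primary component
(= 2-Sylow subgroup) of the ideal class group of its ring of integers. -/
noncomputable def twoClassGroup (K : IntermediateField ℚ ℂ) :
    Subgroup (ClassGroup (𝓞 K)) :=
  CommGroup.primaryComponent _ 2

/-- `h₂(m)`: the 2-class number of the quadratic field `ℚ(√m)`. -/
noncomputable def h2 (m : ℤ) : ℕ := Nat.card (twoClassGroup (quadField m))

/-- `L_{n,d} = ℚ(ζ_{2^{n+2}}, √d)`, the `n`-th layer of the cyclotomic
`ℤ₂`-extension of `ℚ(√d, √-1)`. -/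
noncomputable def Lfield (n : ℕ) (d : ℤ) : IntermediateField ℚ ℂ :=
  IntermediateField.adjoin ℚ
    ({z : ℂ | z ^ 2 ^ (n + 2) = 1} ∪ {z : ℂ | z ^ 2 = (d : ℂ)})

/-- `ℚ(ζ_{2^{n+2}} + ζ_{2^{n+2}}⁻¹, √d) = ℚ(2cos(2π/2^{n+2}), √d)`.
For `d > 0` this is the maximal real subfield `L_{n,d}⁺` of `L_{n,d}`;
for `d < 0` it is the `n`-th layer `K_{n,|d|}` of the cyclotomic
`ℤ₂`-extension of the imaginary quadratic field `ℚ(√d)`. -/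
noncomputable def LplusField (n : ℕ) (d : ℤ) : IntermediateField ℚ ℂ :=
  IntermediateField.adjoin ℚ
    ({((2 * Real.cos (2 * Real.pi / 2 ^ (n + 2)) : ℝ) : ℂ)} ∪ {z : ℂ | z ^ 2 = (d : ℂ)})

set_option linter.style.haveILetI false


theorem grp_gen {A : Type*} [CommGroup A] [Finite A] (hA : IsPGroup 2 A) (l : A) (hl2 : l ^ 2 = 1)
    (hl : ∀ x : A, x ^ 2 ≠ l) (h4 : Nat.card (powMonoidHom 2 : A →* A).ker ≤ 4)
    (g : A) (hg : ∀ (x : A) (e : ℤ), g ≠ x ^ 2 * l ^ e) :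
    (∀ a : A, ∃ e k : ℤ, a = l ^ e * g ^ k) ∧ l ∉ Subgroup.zpowers g ∧
    ((powMonoidHom 2 : A →* A).range ⊔ Subgroup.zpowers l).index = 2 := by
  classical
  set R := (powMonoidHom 2 : A →* A).range with hR
  set H := R ⊔ Subgroup.zpowers l with hH
  have hgH : g ∉ H := by
    intro h
    rw [hH, Subgroup.mem_sup] at h
    obtain ⟨y, ⟨x, rfl⟩, z, ⟨e, rfl⟩, h⟩ := h
    exact hg x e (by simpa using h.symm)
  have hlR : l ∉ R := by
    rintro ⟨x, hx⟩
    exact hl x (by simpa using hx)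
  have hRi : R.index = Nat.card (powMonoidHom 2 : A →* A).ker := by
    have h1 := Subgroup.card_mul_index R
    have h2 := Subgroup.card_mul_index (powMonoidHom 2 : A →* A).ker
    rw [Subgroup.index_ker, ← h1, mul_comm] at h2
    exact (Nat.eq_of_mul_eq_mul_left Nat.card_pos h2).symm
  have hRH : R ≤ H := le_sup_left
  have hmul := Subgroup.relIndex_mul_index hRH
  have h1 : R.relIndex H ≠ 1 := by
    intro h
    rw [Subgroup.relIndex_eq_one] at h
    exact hlR (h (Subgroup.mem_sup_right (Subgroup.mem_zpowers l)))
  have h2 : H.index ≠ 1 := by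
    intro h
    rw [Subgroup.index_eq_one] at h
    exact hgH (by simp [h])
  have h3 : H.index ≠ 0 := Subgroup.index_ne_zero_of_finite
  have h5 : R.index ≠ 0 := Subgroup.index_ne_zero_of_finite
  have hHi : H.index = 2 := by
    have : R.relIndex H ≠ 0 := by intro h; rw [h] at hmul; omega
    have : 2 ≤ R.relIndex H := by omega
    have : 2 ≤ H.index := by omega
    have : R.index ≤ 4 := by omega
    nlinarith
  set M := Subgroup.zpowers l ⊔ Subgroup.zpowers g with hM
  have hMR : ∀ a : A, ∃ m ∈ M, ∃ x : A, a = m * x ^ 2 := by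
    intro a
    by_cases ha : a ∈ H
    · rw [hH, Subgroup.mem_sup] at ha
      obtain ⟨y, ⟨x, rfl⟩, z, hz, h⟩ := ha
      exact ⟨z, Subgroup.mem_sup_left hz, x, by rw [← h]; simp [mul_comm]⟩
    · have := (Subgroup.mul_mem_iff_of_index_two hHi (a := a) (b := g⁻¹)).2 (by simp [ha, hgH])
      rw [hH, Subgroup.mem_sup] at this
      obtain ⟨y, ⟨x, rfl⟩, z, hz, h⟩ := this
      refine ⟨z * g, mul_mem (Subgroup.mem_sup_left hz) (Subgroup.mem_sup_right (Subgroup.mem_zpowers g)), x, ?_⟩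
      rw [eq_mul_inv_iff_mul_eq] at h
      rw [← h]; simp [mul_comm, mul_assoc, mul_left_comm]
  have hiter : ∀ n : ℕ, ∀ a : A, ∃ m ∈ M, ∃ x : A, a = m * x ^ 2 ^ n := by
    intro n
    induction n with
    | zero => intro a; exact ⟨1, one_mem _, a, by simp⟩
    | succ n ih =>
      intro a
      obtain ⟨m, hm, x, rfl⟩ := ih a
      obtain ⟨m', hm', y, rfl⟩ := hMR x
      refine ⟨m * m' ^ 2 ^ n, mul_mem hm (pow_mem hm' _), y, ?_⟩
      rw [mul_pow, ← pow_mul, mul_assoc, pow_succ, mul_comm (2 ^ n) 2]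
  obtain ⟨N, hN⟩ := IsPGroup.iff_card.1 hA
  have hMtop : ∀ a : A, a ∈ M := by
    intro a
    obtain ⟨m, hm, x, rfl⟩ := hiter N a
    rw [← hN, pow_card_eq_one', mul_one]
    exact hm
  refine ⟨?_, ?_, hHi⟩
  · intro a
    have := hMtop a
    rw [hM, Subgroup.mem_sup] at this
    obtain ⟨y, ⟨e, rfl⟩, z, ⟨k, rfl⟩, h⟩ := this
    exact ⟨e, k, h.symm⟩
  · rintro ⟨k, hk⟩
    simp only at hk
    rcases Int.even_or_odd k with ⟨j, hj⟩ | ⟨j, hj⟩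
    · exact hl (g ^ j) (by rw [← hk, hj, zpow_add, sq])
    · refine hg (g ^ (-j)) 1 ?_
      rw [← hk, hj, ← zpow_natCast, ← zpow_mul, zpow_one, ← zpow_add]
      nth_rw 1 [← zpow_one g]
      congr 1
      push_cast; ring

theorem grp_iso {A : Type*} [CommGroup A] [Finite A] (hA : IsPGroup 2 A) (l : A) (hl2 : l ^ 2 = 1)
    (hl : ∀ x : A, x ^ 2 ≠ l) (h4 : Nat.card (powMonoidHom 2 : A →* A).ker ≤ 4)
    (hg : ∃ g : A, ∀ (x : A) (e : ℤ), g ≠ x ^ 2 * l ^ e) (m : ℕ) (hm : Nat.card A = 2 ^ (m + 1)) :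
    Nonempty (A ≃* Multiplicative (ZMod 2 × ZMod (2 ^ m))) := by
  obtain ⟨g, hg⟩ := hg
  obtain ⟨hgen, hlg, -⟩ := grp_gen hA l hl2 hl h4 g hg
  have hl1 : l ≠ 1 := fun h => hl 1 (by simp [h])
  have hol : orderOf l = 2 := orderOf_eq_prime hl2 hl1
  let f : Subgroup.zpowers l × Subgroup.zpowers g →* A :=
    MonoidHom.coprod (Subgroup.subtype _) (Subgroup.subtype _)
  have hf : Function.Bijective f := by
    constructor
    · rw [injective_iff_map_eq_one]
      rintro ⟨⟨a, ⟨e, rfl⟩⟩, ⟨b, hb⟩⟩ h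
      simp only [f, MonoidHom.coprod_apply, Subgroup.coe_subtype] at h
      have hin : l ^ e ∈ Subgroup.zpowers g := by
        rw [eq_inv_of_mul_eq_one_left h]; exact inv_mem hb
      rcases Int.even_or_odd e with ⟨j, hj⟩ | ⟨j, hj⟩
      · have : l ^ e = 1 := by
          rw [hj, ← two_mul, zpow_mul]; norm_cast; rw [hl2]; simp
        rw [this, one_mul] at h
        ext <;> simp [this, h]
      · exfalso
        apply hlg
        have : l ^ e = l := by
          rw [hj, zpow_add, zpow_mul]; norm_cast; rw [hl2]; simp
        rwa [this] at hin
    · intro a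
      obtain ⟨e, k, rfl⟩ := hgen a
      exact ⟨⟨⟨l ^ e, ⟨e, rfl⟩⟩, ⟨g ^ k, ⟨k, rfl⟩⟩⟩, rfl⟩
  let E := MulEquiv.ofBijective f hf
  have hc := Nat.card_congr E.toEquiv
  rw [Nat.card_prod, Nat.card_zpowers, hol, hm, pow_succ'] at hc
  have hc' : Nat.card (Subgroup.zpowers g) = 2 ^ m := by omega
  have e1 : Subgroup.zpowers l ≃* Multiplicative (ZMod 2) :=
    mulEquivOfCyclicCardEq (by simp [Nat.card_zpowers, hol])
  have e2 : Subgroup.zpowers g ≃* Multiplicative (ZMod (2 ^ m)) :=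
    mulEquivOfCyclicCardEq (by rw [hc']; simp)
  exact ⟨E.symm.trans ((MulEquiv.prodCongr e1 e2).trans (MulEquiv.prodMultiplicative _ _).symm)⟩

theorem grp_step {A : Type*} [CommGroup A] [Finite A] (hA : IsPGroup 2 A) (l : A) (hl2 : l ^ 2 = 1)
    (hl : ∀ x : A, x ^ 2 ≠ l) (h4 : Nat.card (powMonoidHom 2 : A →* A).ker ≤ 4)
    (B : Subgroup A)
    (hg : ∃ g : A, ∀ (x : A) (e : ℤ), ∀ b ∈ B, g ≠ x ^ 2 * l ^ e * b)
    (σ : A →* A) (hσ : ∀ a, a * σ a ∈ B) (hσB : ∀ b ∈ B, σ b = b) (hσl : σ l = l)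
    (hlB : l ∉ B) (hB : 4 ≤ Nat.card B) :
    Nat.card A = 4 * Nat.card B := by
  classical
  obtain ⟨g, hg⟩ := hg
  have hg' : ∀ (x : A) (e : ℤ), g ≠ x ^ 2 * l ^ e := fun x e => by
    have := hg x e 1 (one_mem _); simpa using this
  obtain ⟨hgen, hlg, hHi⟩ := grp_gen hA l hl2 hl h4 g hg'
  have hl1 : l ≠ 1 := fun h => hl 1 (by simp [h])
  have hol : orderOf l = 2 := orderOf_eq_prime hl2 hl1
  have hle : ∀ e : ℤ, l ^ e = 1 ∨ l ^ e = l := by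
    intro e
    rcases Int.even_or_odd e with ⟨j, hj⟩ | ⟨j, hj⟩
    · left; rw [hj, ← two_mul, zpow_mul]; norm_cast; rw [hl2]; simp
    · right; rw [hj, zpow_add, zpow_mul]; norm_cast; rw [hl2]; simp
  set R := (powMonoidHom 2 : A →* A).range with hR
  set H := R ⊔ Subgroup.zpowers l with hH
  set D := Subgroup.zpowers l ⊔ B with hD
  have hgHD : g ∉ H ⊔ D := by
    intro h
    rw [hH, hD, sup_assoc, Subgroup.mem_sup] at h
    obtain ⟨y, ⟨x, rfl⟩, z, hz, h⟩ := h
    rw [← sup_assoc, sup_idem, Subgroup.mem_sup] at hz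
    obtain ⟨w, ⟨e, rfl⟩, b, hb, hz⟩ := hz
    exact hg x e b hb (by rw [← h, ← hz]; simp [mul_assoc])
  have hgH : g ∉ H := fun h => hgHD (Subgroup.mem_sup_left h)
  have hDH : D ≤ H := by
    intro x hx
    by_contra hxH
    have := (Subgroup.mul_mem_iff_of_index_two hHi (a := g) (b := x⁻¹)).2 (by simp [hxH, hgH])
    apply hgHD
    have h2 := mul_mem (Subgroup.mem_sup_left (T := D) this) (Subgroup.mem_sup_right (S := H) hx)
    simpa using h2
  have hgD : g ∉ D := fun h => hgH (hDH h)
  have hlD : l ∈ D := Subgroup.mem_sup_left (Subgroup.mem_zpowers l)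
  have hBD : B ≤ D := le_sup_right
  have hDc : Nat.card D = 2 * Nat.card B := by
    have h1 := Subgroup.card_mul_index (B.subgroupOf D)
    have h2 : B.relIndex D = B.relIndex (Subgroup.zpowers l) := by
      rw [hD, Subgroup.relIndex_sup_right]
    have h3 := Subgroup.card_mul_index (B.subgroupOf (Subgroup.zpowers l))
    have h4 : B.subgroupOf (Subgroup.zpowers l) = ⊥ := by
      rw [Subgroup.subgroupOf_eq_bot, disjoint_iff_inf_le]
      rintro x ⟨hx1, ⟨e, rfl⟩⟩
      rcases hle e with h | h
      · simp [h]
      · simp only [h] at hx1; exact absurd hx1 hlB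
    rw [h4, Nat.card_zpowers, hol] at h3
    have h5 : Nat.card (B.subgroupOf D) = Nat.card B :=
      Nat.card_congr (Subgroup.subgroupOfEquivOfLe hBD).toEquiv
    have h6 : (B.subgroupOf D).index = 2 := by
      change B.relIndex D = 2
      rw [h2, Subgroup.relIndex, h4, ← h3]
      simp
    rw [← h1, h5, h6, mul_comm]
  -- σ is trivial on D
  have hσD : ∀ x ∈ D, σ x = x := by
    intro x hx
    rw [hD, Subgroup.mem_sup] at hx
    obtain ⟨y, ⟨e, rfl⟩, b, hb, rfl⟩ := hx
    simp [hσl, hσB b hb]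
  by_cases hg2 : g ^ 2 ∈ D
  · have : H ≤ D := by
      rw [hH]
      refine sup_le ?_ (by rw [Subgroup.zpowers_le]; exact hlD)
      rintro _ ⟨a, rfl⟩
      obtain ⟨e, k, rfl⟩ := hgen a
      simp only [powMonoidHom_apply, mul_pow]
      refine mul_mem (pow_mem (zpow_mem hlD _) _) ?_
      rw [← zpow_natCast, ← zpow_mul, mul_comm, zpow_mul]
      exact zpow_mem (by simpa using hg2) _
    have hDH' : D = H := le_antisymm hDH this
    have := Subgroup.card_mul_index D
    rw [hDc, hDH', hHi] at this
    omega
  · exfalso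
    have hex : ∃ k : ℕ, g ^ 2 ^ k ∈ D := by
      obtain ⟨N, hN⟩ := IsPGroup.iff_card.1 hA
      exact ⟨N, by rw [← hN, pow_card_eq_one']; exact one_mem _⟩
    let k := Nat.find hex
    have hk : g ^ 2 ^ k ∈ D := Nat.find_spec hex
    have hk' : ∀ j < k, g ^ 2 ^ j ∉ D := fun j hj => Nat.find_min hex hj
    have hk2 : 2 ≤ k := by
      by_contra h
      interval_cases hkk : k
      · simp at hk; exact hgD hk
      · simp at hk; exact hg2 hk
    obtain ⟨j, hj⟩ : ∃ j, k = j + 2 := ⟨k - 2, by omega⟩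
    set y := g ^ 2 ^ j with hy
    set x := y ^ 2 with hx
    have hxD : x ∉ D := by
      have := hk' (j + 1) (by omega)
      rwa [pow_succ, pow_mul] at this
    have hx2D : x ^ 2 ∈ D := by
      rw [hj] at hk
      rwa [hx, hy, ← pow_mul, ← pow_mul, show 2 ^ j * (2 * 2) = 2 ^ (j + 2) by ring]
    -- D is generated by l and x^2
    have hDgen : ∀ a ∈ D, ∃ e i : ℤ, a = l ^ e * (x ^ 2) ^ i := by
      intro a ha
      obtain ⟨e, i, rfl⟩ := hgen a
      have hgi : g ^ i ∈ D := by
        have := mul_mem (inv_mem (zpow_mem hlD e)) ha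
        simpa using this
      have hdvd : ((2 ^ k : ℕ) : ℤ) ∣ i := by
        by_contra hnd
        -- gcd argument
        have hgcd : g ^ (Int.gcd i ((2 ^ k : ℕ) : ℤ)) ∈ D := by
          rw [← zpow_natCast, Int.gcd_eq_gcd_ab, zpow_add, zpow_mul, zpow_mul]
          exact mul_mem (zpow_mem hgi _) (zpow_mem (by rw [zpow_natCast]; exact hk) _)
        have hd : Int.gcd i ((2 ^ k : ℕ) : ℤ) ∣ 2 ^ k := by
          have := Int.gcd_dvd_right (a := i) (b := ((2 ^ k : ℕ) : ℤ))
          exact_mod_cast this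
        obtain ⟨t, ht, hte⟩ := (Nat.dvd_prime_pow Nat.prime_two).1 hd
        rcases lt_or_eq_of_le ht with h | h
        · exact hk' t h (by rw [← hte]; exact hgcd)
        · apply hnd
          rw [← h, ← hte]
          exact Int.gcd_dvd_left i _
      obtain ⟨i', rfl⟩ := hdvd
      refine ⟨e, i', ?_⟩
      congr 1
      rw [zpow_mul, zpow_natCast, hj, hx, hy, ← pow_mul, ← pow_mul, show 2 ^ j * (2 * 2) = 2 ^ (j + 2) by ring]
    obtain ⟨e, i, hyi⟩ := hDgen _ (hBD (hσ y))
    have hxi : x * σ x = x ^ (4 * i) := by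
      have : x * σ x = (y * σ y) ^ 2 := by rw [hx, map_pow, mul_pow]
      rw [this, hyi, mul_pow]
      rw [← zpow_natCast (l ^ e), ← zpow_mul, mul_comm e, zpow_mul]
      rw [zpow_natCast, hl2, one_zpow, one_mul, ← zpow_natCast, ← zpow_natCast, ← zpow_mul, ← zpow_mul]
      congr 1; push_cast; ring
    have hx4 : x ^ 4 = 1 := by
      have h1 : x ^ 4 = x ^ (8 * i) := by
        have h2 : σ x ^ 2 = x ^ 2 := by rw [← map_pow]; exact hσD _ hx2D
        calc x ^ 4 = x ^ 2 * σ x ^ 2 := by rw [h2]; group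
          _ = (x * σ x) ^ 2 := by rw [mul_pow]
          _ = x ^ (8 * i) := by
            rw [hxi, ← zpow_natCast, ← zpow_mul]; congr 1; push_cast; ring
      have h3 : x ^ (4 * (1 - 2 * i)) = 1 := by
        rw [show 4 * (1 - 2 * i) = ((4 : ℕ) : ℤ) - 8 * i by push_cast; ring, zpow_sub, zpow_natCast, h1, mul_inv_cancel]
      obtain ⟨N, hN⟩ := hA x
      have h5 : (orderOf x : ℤ) ∣ 4 * (1 - 2 * i) := orderOf_dvd_iff_zpow_eq_one.2 h3
      have h6 : orderOf x ∣ 2 ^ N := orderOf_dvd_of_pow_eq_one hN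
      have h7 : IsCoprime ((orderOf x : ℤ)) (1 - 2 * i) := by
        have : IsCoprime ((2 : ℤ) ^ N) (1 - 2 * i) := by
          apply IsCoprime.pow_left
          exact ⟨i, 1, by ring⟩
        exact IsCoprime.of_isCoprime_of_dvd_left this (by exact_mod_cast h6)
      have h8 : (orderOf x : ℤ) ∣ 4 := h7.dvd_of_dvd_mul_right h5
      exact orderOf_dvd_iff_pow_eq_one.1 (by exact_mod_cast h8)
    -- card D ≤ 4
    have : Nat.card D ≤ 4 := by
      have hsub : ∀ a ∈ D, a ∈ (({1, l, x ^ 2, l * x ^ 2} : Finset A) : Set A) := by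
        intro a ha
        obtain ⟨e, i, rfl⟩ := hDgen a ha
        have hxx : (x ^ 2) ^ i = 1 ∨ (x ^ 2) ^ i = x ^ 2 := by
          have hx22 : (x ^ 2) ^ 2 = 1 := by rw [← pow_mul]; exact hx4
          rcases Int.even_or_odd i with ⟨j, hj⟩ | ⟨j, hj⟩
          · left; rw [hj, ← two_mul, zpow_mul]; rw [show (x ^ 2) ^ (2:ℤ) = (x^2)^2 from zpow_natCast _ 2, hx22]; simp
          · right; rw [hj, zpow_add, zpow_mul]; rw [show (x ^ 2) ^ (2:ℤ) = (x^2)^2 from zpow_natCast _ 2, hx22]; simp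
        rcases hle e with h | h <;> rcases hxx with h' | h' <;> simp [h, h']
      have h1 : Nat.card D ≤ ({1, l, x ^ 2, l * x ^ 2} : Finset A).card := by
        have := Nat.card_mono (Finset.finite_toSet _) hsub
        rwa [Nat.card_eq_fintype_card (α := ((({1, l, x ^ 2, l * x ^ 2} : Finset A) : Set A))), ← Set.toFinset_card, Finset.toFinset_coe] at this
      exact h1.trans (Finset.card_le_four)
    omega

open NumberField
open scoped nonZeroDivisors

section cl
variable {R S T : Type*} [CommRing R] [IsDedekindDomain R] [CommRing S] [IsDedekindDomain S]
  [CommRing T] [IsDedekindDomain T]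

open Classical in
/-- ideal class of an ideal, with the class of the zero ideal being trivial -/
noncomputable def cl (I : Ideal R) : ClassGroup R :=
  if h : I ≠ 0 then ClassGroup.mk0 ⟨I, mem_nonZeroDivisors_of_ne_zero h⟩ else 1

theorem cl_of_ne {I : Ideal R} (h : I ≠ 0) :
    cl I = ClassGroup.mk0 ⟨I, mem_nonZeroDivisors_of_ne_zero h⟩ := by
  exact dif_pos h

theorem cl_mul {I J : Ideal R} (hI : I ≠ 0) (hJ : J ≠ 0) : cl (I * J) = cl I * cl J := by
  rw [cl_of_ne hI, cl_of_ne hJ, cl_of_ne (mul_ne_zero hI hJ), ← map_mul]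
  rfl

theorem cl_zero : cl (0 : Ideal R) = 1 := by simp [cl]

theorem cl_eq_one_iff {I : Ideal R} (hI : I ≠ 0) : cl I = 1 ↔ ∃ x : R, x ≠ 0 ∧ I = Ideal.span {x} := by
  rw [cl_of_ne hI, ClassGroup.mk0_eq_one_iff]
  constructor
  · rintro ⟨x, hx⟩
    refine ⟨x, ?_, hx⟩
    rintro rfl
    apply hI
    simp [hx]
  · rintro ⟨x, -, hx⟩
    exact ⟨x, hx⟩

theorem cl_span (x : R) : cl (Ideal.span {x}) = 1 := by
  by_cases hx : x = 0
  · subst hx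
    rw [show Ideal.span {(0 : R)} = 0 by simp, cl_zero]
  · exact (cl_eq_one_iff (by simpa using hx)).2 ⟨x, hx, rfl⟩

theorem cl_one : cl (1 : Ideal R) = 1 := by
  rw [Ideal.one_eq_top, ← Ideal.span_singleton_one, cl_span]

theorem cl_pow {I : Ideal R} (hI : I ≠ 0) (n : ℕ) : cl (I ^ n) = cl I ^ n := by
  induction n with
  | zero => rw [pow_zero, pow_zero, cl_one]
  | succ n ih => rw [pow_succ, pow_succ, cl_mul (pow_ne_zero n hI) hI, ih]

theorem cl_eq_iff {I J : Ideal R} (hI : I ≠ 0) (hJ : J ≠ 0) :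
    cl I = cl J ↔ ∃ x y : R, x ≠ 0 ∧ y ≠ 0 ∧ Ideal.span {x} * I = Ideal.span {y} * J := by
  rw [cl_of_ne hI, cl_of_ne hJ, ClassGroup.mk0_eq_mk0_iff]
  constructor
  · rintro ⟨x, y, hx, hy, h⟩
    exact ⟨x, y, hx, hy, h⟩
  · rintro ⟨x, y, hx, hy, h⟩
    exact ⟨x, y, hx, hy, h⟩

theorem cl_surj (c : ClassGroup R) : ∃ I : Ideal R, I ≠ 0 ∧ cl I = c := by
  obtain ⟨I, rfl⟩ := ClassGroup.mk0_surjective c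
  exact ⟨I.1, nonZeroDivisors.ne_zero I.2, cl_of_ne (nonZeroDivisors.ne_zero I.2)⟩

theorem map_ne_zero_of_inj (f : R →+* S) (hf : Function.Injective f) {I : Ideal R} (hI : I ≠ 0) :
    I.map f ≠ 0 := by
  intro h
  apply hI
  exact (Ideal.map_eq_bot_iff_of_injective hf).1 h

/-- extension of ideal classes along an injective ring hom -/
noncomputable def clMap (f : R →+* S) (hf : Function.Injective f) : ClassGroup R →* ClassGroup S :=
  letI := f.toAlgebra
  haveI : Module.IsTorsionFree R S := by
    rw [Module.isTorsionFree_iff_algebraMap_injective]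
    exact hf
  ClassGroup.extendedHom R S

theorem clMap_cl (f : R →+* S) (hf : Function.Injective f) (I : Ideal R) :
    clMap f hf (cl I) = cl (I.map f) := by
  by_cases hI : I = 0
  · subst hI
    rw [cl_zero, map_one, show Ideal.map f 0 = 0 from Ideal.map_bot, cl_zero]
  · letI := f.toAlgebra
    haveI : Module.IsTorsionFree R S := by
      rw [Module.isTorsionFree_iff_algebraMap_injective]
      exact hf
    rw [cl_of_ne hI, cl_of_ne (map_ne_zero_of_inj f hf hI)]
    exact ClassGroup.extendedHom_mk0 R S _

theorem clMap_comp (f : R →+* S) (hf : Function.Injective f) (g : S →+* T)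
    (hg : Function.Injective g) (h : R →+* T) (hh : Function.Injective h) (e : g.comp f = h)
    (c : ClassGroup R) : clMap g hg (clMap f hf c) = clMap h hh c := by
  obtain ⟨I, -, rfl⟩ := cl_surj c
  rw [clMap_cl, clMap_cl, clMap_cl, Ideal.map_map, e]

end cl

structure IsQuad (k : Type*) {L : Type*} [Field k] [Field L] [Algebra k L] (σ : L →+* L) (θ : L) :
    Prop where
  ne : θ ≠ 0
  conj : σ θ = -θ
  sq : ∃ a : k, θ ^ 2 = algebraMap k L a
  fix : ∀ u : k, σ (algebraMap k L u) = algebraMap k L u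
  span : ∀ x : L, ∃ u v : k, x = algebraMap k L u + algebraMap k L v * θ

/-- the induced map on rings of integers -/
noncomputable def sg {K L : Type*} [Field K] [Field L] (σ : K →+* L) : 𝓞 K →+* 𝓞 L :=
  RingOfIntegers.mapRingHom σ

@[simp] theorem coe_sg {K L : Type*} [Field K] [Field L] (σ : K →+* L) (x : 𝓞 K) :
    ((sg σ x : 𝓞 L) : L) = σ (x : K) := rfl

theorem sg_inj {K L : Type*} [Field K] [Field L] (σ : K →+* L) : Function.Injective (sg σ) := by
  intro x y h
  apply RingOfIntegers.ext
  apply σ.injective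
  rw [← coe_sg, ← coe_sg, h]

theorem algInj (k L : Type*) [Field k] [NumberField k] [Field L] [NumberField L] [Algebra k L] :
    Function.Injective (algebraMap (𝓞 k) (𝓞 L)) :=
  FaithfulSMul.algebraMap_injective _ _

theorem coe_alg {k L : Type*} [Field k] [Field L] [Algebra k L] (x : 𝓞 k) :
    ((algebraMap (𝓞 k) (𝓞 L) x : 𝓞 L) : L) = algebraMap k L (x : k) := rfl

namespace IsQuad

variable {k L : Type*} [Field k] [NumberField k] [Field L] [NumberField L] [Algebra k L]
  {σ : L →+* L} {θ : L} (q : IsQuad k σ θ)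
include q

theorem invol (x : L) : σ (σ x) = x := by
  obtain ⟨u, v, rfl⟩ := q.span x
  simp [q.fix, q.conj]

theorem sg_sg (x : 𝓞 L) : sg σ (sg σ x) = x := by
  apply RingOfIntegers.ext
  simp [q.invol]

theorem map_sg_sg (I : Ideal (𝓞 L)) : (I.map (sg σ)).map (sg σ) = I := by
  rw [Ideal.map_map]
  convert Ideal.map_id I
  ext x
  simp [q.invol]

theorem mem_map_sg (I : Ideal (𝓞 L)) (x : 𝓞 L) : x ∈ I.map (sg σ) ↔ sg σ x ∈ I := by
  constructor
  · intro h
    have := Ideal.mem_map_of_mem (sg σ) h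
    rwa [q.map_sg_sg] at this
  · intro h
    have := Ideal.mem_map_of_mem (sg σ) h
    rwa [q.sg_sg] at this

theorem of_fixed (x : L) (h : σ x = x) : ∃ u : k, algebraMap k L u = x := by
  obtain ⟨u, v, rfl⟩ := q.span x
  refine ⟨u, ?_⟩
  simp only [map_add, map_mul, q.fix, q.conj] at h
  have : algebraMap k L v * θ = 0 := by linear_combination (-1/2 : L) * h
  rw [this, add_zero]

theorem of_fixed_int (x : 𝓞 L) (h : sg σ x = x) : ∃ u : 𝓞 k, algebraMap (𝓞 k) (𝓞 L) u = x := by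
  have h' : σ (x : L) = x := by rw [← coe_sg, h]
  obtain ⟨u, hu⟩ := q.of_fixed _ h'
  have hui : IsIntegral ℤ u := by
    have : IsIntegral ℤ (x : L) := x.isIntegral_coe
    rw [← hu] at this
    exact (isIntegral_algebraMap_iff (algebraMap k L).injective).1 this
  exact ⟨⟨u, hui⟩, RingOfIntegers.ext hu⟩

theorem norm_mem (x : L) : ∃ u : k, algebraMap k L u = x * σ x :=
  q.of_fixed _ (by rw [map_mul, q.invol, mul_comm])

theorem norm_mem_int (x : 𝓞 L) : ∃ u : 𝓞 k, algebraMap (𝓞 k) (𝓞 L) u = x * sg σ x :=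
  q.of_fixed_int _ (by rw [map_mul, q.sg_sg, mul_comm])

theorem sg_alg (u : 𝓞 k) : sg σ (algebraMap (𝓞 k) (𝓞 L) u) = algebraMap (𝓞 k) (𝓞 L) u := by
  apply RingOfIntegers.ext
  rw [coe_sg]
  exact q.fix _

theorem map_sg_map (I : Ideal (𝓞 k)) :
    (I.map (algebraMap (𝓞 k) (𝓞 L))).map (sg σ) = I.map (algebraMap (𝓞 k) (𝓞 L)) := by
  rw [Ideal.map_map]
  congr 1
  ext x
  exact congrArg _ (q.sg_alg x)

theorem not_mem_base : ∀ u : k, algebraMap k L u ≠ θ := by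
  intro u hu
  have := q.fix u
  rw [hu, q.conj] at this
  have h2 : (2 : L) * θ = 0 := by linear_combination -this
  exact q.ne (by simpa using h2)

theorem finrank_eq : Module.finrank k L = 2 := by
  have hli : LinearIndependent k ![(1 : L), θ] := by
    rw [LinearIndependent.pair_iff]
    intro s t h
    simp only [Algebra.smul_def, mul_one] at h
    have ht : t = 0 := by
      by_contra ht
      apply q.not_mem_base (-s / t)
      have : algebraMap k L t ≠ 0 := by simpa using ht
      rw [map_div₀, map_neg, div_eq_iff this]
      linear_combination -h
    subst ht
    simpa using h
  have hsp : ⊤ ≤ Submodule.span k (Set.range ![(1 : L), θ]) := by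
    intro x _
    obtain ⟨u, v, rfl⟩ := q.span x
    refine Submodule.add_mem _ ?_ ?_
    · rw [← mul_one (algebraMap k L u), ← Algebra.smul_def]
      exact Submodule.smul_mem _ _ (Submodule.subset_span ⟨0, rfl⟩)
    · rw [← Algebra.smul_def]
      exact Submodule.smul_mem _ _ (Submodule.subset_span ⟨1, rfl⟩)
  have := Module.finrank_eq_card_basis (Module.Basis.mk hli hsp)
  simpa using this

theorem finrank_int : Module.finrank (𝓞 k) (𝓞 L) = 2 := by
  rw [← q.finrank_eq]
  exact (IsFractionRing.finrank_eq (𝓞 k) k (𝓞 L) L).symm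

theorem absNorm_map (I : Ideal (𝓞 k)) :
    Ideal.absNorm (I.map (algebraMap (𝓞 k) (𝓞 L))) = Ideal.absNorm I ^ 2 := by
  rw [Ideal.absNorm_algebraMap, q.finrank_int]

theorem map_inj {I J : Ideal (𝓞 k)}
    (h : I.map (algebraMap (𝓞 k) (𝓞 L)) = J.map (algebraMap (𝓞 k) (𝓞 L))) : I = J := by
  have h1 := congrArg (Ideal.relNorm (𝓞 k)) h
  rw [Ideal.relNorm_algebraMap, Ideal.relNorm_algebraMap, q.finrank_int] at h1
  exact pow_left_injective two_ne_zero h1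

omit q in
theorem absNorm_le (Q : Ideal (𝓞 L)) (hQ : Q ≠ 0) :
    Ideal.absNorm (Q.comap (algebraMap (𝓞 k) (𝓞 L))) ≤ Ideal.absNorm Q := by
  rw [Ideal.absNorm_apply, Ideal.absNorm_apply, Submodule.cardQuot_apply, Submodule.cardQuot_apply]
  haveI := Ideal.finiteQuotientOfFreeOfNeBot Q hQ
  exact Nat.card_le_card_of_injective _ (Ideal.quotientMap_injective (I := Q) (f := algebraMap (𝓞 k) (𝓞 L)))

omit [NumberField k] [Algebra k L] q in
theorem eq_of_dvd_of_absNorm_le {I J : Ideal (𝓞 L)} (h : I ∣ J) (hJ : J ≠ 0)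
    (hn : Ideal.absNorm J ≤ Ideal.absNorm I) : I = J := by
  obtain ⟨C, rfl⟩ := h
  rw [map_mul] at hn
  have hI : I ≠ 0 := left_ne_zero_of_mul hJ
  have hC : C ≠ 0 := right_ne_zero_of_mul hJ
  have h1 : 0 < Ideal.absNorm I := Nat.pos_of_ne_zero (by rwa [Ne, Ideal.absNorm_eq_zero_iff])
  have h2 : 0 < Ideal.absNorm C := Nat.pos_of_ne_zero (by rwa [Ne, Ideal.absNorm_eq_zero_iff])
  have h3 : Ideal.absNorm C = 1 := by nlinarith
  rw [Ideal.absNorm_eq_one_iff] at h3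
  rw [h3, ← Ideal.one_eq_top, mul_one]

end IsQuad

open NumberField
open scoped nonZeroDivisors

namespace IsQuad

variable {k L : Type*} [Field k] [NumberField k] [Field L] [NumberField L] [Algebra k L]
  {σ : L →+* L} {θ : L}

/-- ramified primes -/
structure Ram (k : Type*) {L : Type*} [Field k] [NumberField k] [Field L] [NumberField L]
    [Algebra k L] (σ : L →+* L) (Q : Ideal (𝓞 L)) : Prop where
  prime : Q.IsPrime
  ne : Q ≠ 0
  fixed : Q.map (sg σ) = Q
  sq : (Q.comap (algebraMap (𝓞 k) (𝓞 L))).map (algebraMap (𝓞 k) (𝓞 L)) = Q ^ 2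
  diff : ∀ x : 𝓞 L, x - sg σ x ∈ Q

variable (q : IsQuad k σ θ)
include q

theorem comap_map_sg (Q : Ideal (𝓞 L)) :
    (Q.map (sg σ)).comap (algebraMap (𝓞 k) (𝓞 L)) = Q.comap (algebraMap (𝓞 k) (𝓞 L)) := by
  ext u
  rw [Ideal.mem_comap, Ideal.mem_comap, q.mem_map_sg, q.sg_alg]

theorem isPrime_map_sg {Q : Ideal (𝓞 L)} (hQ : Q.IsPrime) : (Q.map (sg σ)).IsPrime := by
  have : Q.map (sg σ) = Q.comap (sg σ) := by
    ext x; rw [q.mem_map_sg, Ideal.mem_comap]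
  rw [this]
  exact Ideal.IsPrime.comap _

theorem comap_ne {Q : Ideal (𝓞 L)} (h0 : Q ≠ 0) :
    Q.comap (algebraMap (𝓞 k) (𝓞 L)) ≠ 0 := by
  obtain ⟨x, hx, hx0⟩ := Submodule.exists_mem_ne_zero_of_ne_bot h0
  obtain ⟨u, hu⟩ := q.norm_mem_int x
  intro h
  have : u ∈ Q.comap (algebraMap (𝓞 k) (𝓞 L)) := by
    rw [Ideal.mem_comap, hu]; exact Q.mul_mem_right _ hx
  rw [h] at this
  have hu0 : u = 0 := this
  rw [hu0, map_zero] at hu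
  rcases mul_eq_zero.1 hu.symm with h | h
  · exact hx0 h
  · exact hx0 (sg_inj σ (by rw [h, map_zero]))

theorem trich {Q : Ideal (𝓞 L)} (hQ : Q.IsPrime) (h0 : Q ≠ 0) :
    (Q.map (sg σ) ≠ Q ∧ (Q.comap (algebraMap (𝓞 k) (𝓞 L))).map (algebraMap (𝓞 k) (𝓞 L))
      = Q * Q.map (sg σ)) ∨
    (Q.map (sg σ) = Q ∧ (Q.comap (algebraMap (𝓞 k) (𝓞 L))).map (algebraMap (𝓞 k) (𝓞 L)) = Q) ∨
    Ram k σ Q := by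
  classical
  set p := Q.comap (algebraMap (𝓞 k) (𝓞 L)) with hp
  have hp0 : p ≠ 0 := q.comap_ne h0
  have hpp : p.IsPrime := Ideal.IsPrime.comap _
  have hpm : p.IsMaximal := hpp.isMaximal hp0
  have hmap0 : p.map (algebraMap (𝓞 k) (𝓞 L)) ≠ 0 := map_ne_zero_of_inj _ (algInj k L) hp0
  have hle : p.map (algebraMap (𝓞 k) (𝓞 L)) ≤ Q := Ideal.map_comap_le
  have hn := q.absNorm_map p
  have hNQ : Ideal.absNorm p ≤ Ideal.absNorm Q := absNorm_le Q h0
  have hpn0 : 0 < Ideal.absNorm p :=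
    Nat.pos_of_ne_zero (by rw [Ne, Ideal.absNorm_eq_zero_iff]; exact hp0)
  have hQ' := q.isPrime_map_sg hQ
  have hQ0' : Q.map (sg σ) ≠ 0 := map_ne_zero_of_inj _ (sg_inj σ) h0
  have hprime : Prime Q := Ideal.prime_of_isPrime h0 hQ
  have hprime' : Prime (Q.map (sg σ)) := Ideal.prime_of_isPrime hQ0' hQ'
  have hdvd : Q ∣ p.map (algebraMap (𝓞 k) (𝓞 L)) := Ideal.dvd_iff_le.2 hle
  by_cases hs : Q.map (sg σ) = Q
  · right
    obtain ⟨C, hC⟩ := hdvd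
    by_cases hC1 : C = ⊤
    · left
      refine ⟨hs, ?_⟩
      rw [hC, hC1, ← Ideal.one_eq_top, mul_one]
    · right
      obtain ⟨M, hM, hCM⟩ := Ideal.exists_le_maximal C hC1
      have hpM : p.map (algebraMap (𝓞 k) (𝓞 L)) ≤ M := by
        rw [hC]; exact (Ideal.le_of_dvd (dvd_mul_left C Q)).trans hCM
      have hpM' : p ≤ M.comap (algebraMap (𝓞 k) (𝓞 L)) := Ideal.map_le_iff_le_comap.1 hpM
      have hpM2 : M.comap (algebraMap (𝓞 k) (𝓞 L)) = p :=
        (hpm.eq_of_le (Ideal.IsPrime.comap (hK := hM.isPrime) _).ne_top hpM').symm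
      have hMQ : M ≤ Q := by
        intro x hx
        obtain ⟨u, hu⟩ := q.norm_mem_int x
        have : u ∈ p := by
          rw [← hpM2, Ideal.mem_comap, hu]; exact M.mul_mem_right _ hx
        have h2 : x * sg σ x ∈ Q := by rw [← hu]; exact this
        rcases hQ.mem_or_mem h2 with h | h
        · exact h
        · rw [← hs, q.mem_map_sg]; exact h
      have hMQ' : M = Q := hM.eq_of_le hQ.ne_top hMQ
      subst hMQ'
      have hd2 : M ^ 2 ∣ p.map (algebraMap (𝓞 k) (𝓞 L)) := by
        rw [hC, pow_two]
        exact mul_dvd_mul_left _ (Ideal.dvd_iff_le.2 hCM)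
      have heq : M ^ 2 = p.map (algebraMap (𝓞 k) (𝓞 L)) := by
        apply eq_of_dvd_of_absNorm_le hd2 hmap0
        rw [hn, map_pow]
        exact Nat.pow_le_pow_left hNQ 2
      have hNeq : Ideal.absNorm p = Ideal.absNorm M := by
        rw [← heq, map_pow] at hn
        exact (Nat.pow_left_injective two_ne_zero hn).symm
      refine ⟨hQ, h0, hs, heq.symm, ?_⟩
      have hsurj : Function.Surjective (Ideal.quotientMap M (algebraMap (𝓞 k) (𝓞 L)) le_rfl :
          𝓞 k ⧸ p →+* 𝓞 L ⧸ M) := by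
        haveI := Ideal.finiteQuotientOfFreeOfNeBot M h0
        haveI := Ideal.finiteQuotientOfFreeOfNeBot p hp0
        have hc : Nat.card (𝓞 k ⧸ p) = Nat.card (𝓞 L ⧸ M) := by
          rw [Ideal.absNorm_apply, Ideal.absNorm_apply, Submodule.cardQuot_apply,
            Submodule.cardQuot_apply] at hNeq
          exact hNeq
        exact ((Nat.bijective_iff_injective_and_card _).2
          ⟨Ideal.quotientMap_injective (I := M) (f := algebraMap (𝓞 k) (𝓞 L)), hc⟩).2
      intro x
      obtain ⟨y, hy⟩ := hsurj (Ideal.Quotient.mk M x)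
      obtain ⟨u, rfl⟩ := Ideal.Quotient.mk_surjective y
      rw [Ideal.quotientMap_mk, Ideal.Quotient.eq] at hy
      have h2 : sg σ (algebraMap (𝓞 k) (𝓞 L) u - x) ∈ M := by
        rw [← hs]; exact Ideal.mem_map_of_mem _ hy
      rw [map_sub, q.sg_alg] at h2
      have := sub_mem h2 hy
      convert this using 1
      ring
  · left
    refine ⟨hs, ?_⟩
    have hdvd' : Q.map (sg σ) ∣ p.map (algebraMap (𝓞 k) (𝓞 L)) := by
      rw [Ideal.dvd_iff_le, hp, ← q.comap_map_sg Q]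
      exact Ideal.map_comap_le
    have hNQ' : Ideal.absNorm p ≤ Ideal.absNorm (Q.map (sg σ)) := by
      rw [hp, ← q.comap_map_sg Q]
      exact absNorm_le _ hQ0'
    have hd2 : Q * Q.map (sg σ) ∣ p.map (algebraMap (𝓞 k) (𝓞 L)) := by
      obtain ⟨C, hC⟩ := hdvd
      rw [hC] at hdvd' ⊢
      apply mul_dvd_mul_left
      rcases hprime'.dvd_or_dvd hdvd' with h | h
      · exfalso
        apply hs
        have := (hprime'.dvd_prime_iff_associated hprime).1 h
        exact associated_iff_eq.1 this
      · exact h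
    refine (eq_of_dvd_of_absNorm_le hd2 hmap0 ?_).symm
    rw [hn, map_mul, pow_two]
    exact Nat.mul_le_mul hNQ hNQ'

/-- Q2 -/
theorem norm_ideal (I : Ideal (𝓞 L)) :
    ∃ a : Ideal (𝓞 k), I * I.map (sg σ) = a.map (algebraMap (𝓞 k) (𝓞 L)) := by
  classical
  induction I using UniqueFactorizationMonoid.induction_on_prime with
  | h₁ => exact ⟨0, by simp⟩
  | h₂ I hI =>
    rw [Ideal.isUnit_iff] at hI
    subst hI
    exact ⟨⊤, by simp [Ideal.map_top]⟩
  | h₃ J Q hJ hQ ih =>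
    obtain ⟨a, ha⟩ := ih
    have key : ∃ b : Ideal (𝓞 k), Q * Q.map (sg σ) = b.map (algebraMap (𝓞 k) (𝓞 L)) := by
      rcases q.trich (Ideal.isPrime_of_prime hQ) hQ.ne_zero with ⟨_, h⟩ | ⟨h1, h⟩ | h
      · exact ⟨_, h.symm⟩
      · exact ⟨Q.comap (algebraMap (𝓞 k) (𝓞 L)) * Q.comap (algebraMap (𝓞 k) (𝓞 L)),
          by rw [Ideal.map_mul, h, h1]⟩
      · exact ⟨Q.comap (algebraMap (𝓞 k) (𝓞 L)), by rw [h.sq, h.fixed, pow_two]⟩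
    obtain ⟨b, hb⟩ := key
    refine ⟨b * a, ?_⟩
    rw [Ideal.map_mul, Ideal.map_mul, ← ha, ← hb, mul_mul_mul_comm]

/-- Q3 -/
theorem invariant_mem (S : Submonoid (Ideal (𝓞 L)))
    (hS : ∀ a : Ideal (𝓞 k), a ≠ 0 → a.map (algebraMap (𝓞 k) (𝓞 L)) ∈ S)
    (hR : ∀ Q, Ram k σ Q → Q ∈ S) (J : Ideal (𝓞 L)) (hJ : J ≠ 0) (hf : J.map (sg σ) = J) :
    J ∈ S := by
  classical
  revert hJ hf
  induction J using WellFoundedGT.induction with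
  | ind J ih =>
  intro hJ hf
  by_cases h1 : J = ⊤
  · rw [h1, ← Ideal.one_eq_top]; exact one_mem _
  obtain ⟨Q, hQm, hJQ⟩ := Ideal.exists_le_maximal J h1
  have hQ := hQm.isPrime
  have hQ0 : Q ≠ 0 := by rintro rfl; exact hJ (le_bot_iff.1 hJQ)
  have step : ∀ P J' : Ideal (𝓞 L), J = P * J' → P.map (sg σ) = P → P ≠ 1 → P ∈ S → J ∈ S := by
    intro P J' hPJ hPf hP1 hPS
    have hP0 : P ≠ 0 := by rintro rfl; exact hJ (by rw [hPJ, zero_mul])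
    have hJ0 : J' ≠ 0 := by rintro rfl; exact hJ (by rw [hPJ, mul_zero])
    have hf' : J'.map (sg σ) = J' := by
      rw [hPJ, Ideal.map_mul, hPf] at hf
      exact mul_left_cancel₀ hP0 hf
    have hlt : J < J' := by
      refine lt_of_le_of_ne (by rw [hPJ]; exact Ideal.le_of_dvd (dvd_mul_left _ _)) ?_
      intro h
      rw [h] at hPJ
      nth_rw 1 [← one_mul J'] at hPJ
      exact hP1 (mul_right_cancel₀ hJ0 hPJ).symm
    rw [hPJ]
    exact S.mul_mem hPS (ih J' hlt hJ0 hf')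
  obtain ⟨J', hJ'⟩ := Ideal.dvd_iff_le.2 hJQ
  have hQ1 : Q ≠ 1 := by rw [Ideal.one_eq_top]; exact hQ.ne_top
  rcases q.trich hQ hQ0 with ⟨h1, h⟩ | ⟨h1, h⟩ | h
  · have hQ' := q.isPrime_map_sg hQ
    have hQ0' : Q.map (sg σ) ≠ 0 := map_ne_zero_of_inj _ (sg_inj σ) hQ0
    have hprime : Prime Q := Ideal.prime_of_isPrime hQ0 hQ
    have hprime' : Prime (Q.map (sg σ)) := Ideal.prime_of_isPrime hQ0' hQ'
    have hd : Q.map (sg σ) ∣ J := by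
      rw [← hf]; exact Ideal.dvd_iff_le.2 (Ideal.map_mono hJQ)
    rw [hJ'] at hd
    rcases hprime'.dvd_or_dvd hd with h' | ⟨J'', hJ''⟩
    · exfalso
      apply h1
      exact associated_iff_eq.1 ((hprime'.dvd_prime_iff_associated hprime).1 h')
    · refine step (Q * Q.map (sg σ)) J'' (by rw [hJ', hJ'', mul_assoc]) ?_ ?_ ?_
      · rw [Ideal.map_mul, q.map_sg_sg, mul_comm]
      · intro h2
        exact hQ1 (by simpa using (IsUnit.of_mul_eq_one _ h2))
      · rw [← h]; exact hS _ (q.comap_ne hQ0)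
  · exact step Q J' hJ' h1 hQ1 (by rw [← h]; exact hS _ (q.comap_ne hQ0))
  · exact step Q J' hJ' h.fixed hQ1 (hR Q h)

/-- Hilbert 90 -/
theorem hilbert90 (β : L) (hβ : β * σ β = 1) : ∃ γ : L, γ ≠ 0 ∧ β * σ γ = γ := by
  by_cases h : 1 + β = 0
  · refine ⟨θ, q.ne, ?_⟩
    rw [q.conj]; linear_combination (-θ) * h
  · refine ⟨1 + β, h, ?_⟩
    rw [map_add, map_one]; linear_combination hβ

omit q in
theorem exists_int_mul (x : L) : ∃ N : ℕ, N ≠ 0 ∧ ∃ y : 𝓞 L, (y : L) = N * x := by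
  obtain ⟨y, z, hz, h⟩ := IsFractionRing.div_surjective (A := 𝓞 L) x
  have hz0 : z ≠ 0 := nonZeroDivisors.ne_zero hz
  obtain ⟨N, hN⟩ : ∃ N : ℕ, N ≠ 0 ∧ z ∣ (N : 𝓞 L) := by
    refine ⟨Ideal.absNorm (Ideal.span {z}), ?_, ?_⟩
    · rw [Ne, Ideal.absNorm_eq_zero_iff]; simpa using hz0
    · rw [← Ideal.mem_span_singleton]; exact Ideal.absNorm_mem _
  obtain ⟨w, hw⟩ := hN.2
  refine ⟨N, hN.1, w * y, ?_⟩
  have hzL : (z : L) ≠ 0 := by simpa using hz0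
  have hw' : (N : L) = (z : L) * w := by
    have := congrArg (fun t : 𝓞 L => (t : L)) hw
    simpa using this
  rw [← h, hw']
  change (w : L) * y = z * w * ((y : L) / z)
  field_simp

theorem hilbert90_int (β : L) (hβ : β * σ β = 1) : ∃ γ : 𝓞 L, γ ≠ 0 ∧ β * σ γ = γ := by
  obtain ⟨γ, h0, h⟩ := q.hilbert90 β hβ
  obtain ⟨N, hN, y, hy⟩ := exists_int_mul γ
  refine ⟨y, ?_, ?_⟩
  · intro h1
    rw [h1] at hy
    have : (N : L) * γ = 0 := by rw [← hy]; simp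
    simp [hN, h0] at this
  · rw [hy, map_mul, map_natCast]; linear_combination (N : L) * h

end IsQuad

open NumberField
open scoped nonZeroDivisors

namespace IsQuad

variable {k L : Type*} [Field k] [NumberField k] [Field L] [NumberField L] [Algebra k L]
  {σ : L →+* L} {θ : L} (q : IsQuad k σ θ)
include q

theorem unit_of_fixed (u : (𝓞 L)ˣ) (h : sg σ u = u) :
    ∃ ε : (𝓞 k)ˣ, algebraMap (𝓞 k) (𝓞 L) ε = u := by
  obtain ⟨a, ha⟩ := q.of_fixed_int _ h
  have h' : sg σ (↑u⁻¹ : 𝓞 L) = (↑u⁻¹ : 𝓞 L) := by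
    have h1 : sg σ (u : 𝓞 L) * sg σ (↑u⁻¹ : 𝓞 L) = 1 := by rw [← map_mul]; simp
    rw [h] at h1
    rw [← Units.inv_mul_cancel_left u (sg σ (↑u⁻¹ : 𝓞 L)), h1, mul_one]
  obtain ⟨b, hb⟩ := q.of_fixed_int _ h'
  have hab : a * b = 1 := algInj k L (by rw [map_mul, ha, hb]; simp)
  exact ⟨⟨a, b, hab, by rw [mul_comm, hab]⟩, ha⟩

/-- Q4 -/
theorem fixed_class
    (hU : ∀ ε : (𝓞 k)ˣ, (∃ z : L, z * σ z = algebraMap k L ((ε : 𝓞 k) : k)) →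
      ∃ v : (𝓞 L)ˣ, (v : 𝓞 L) * sg σ v = algebraMap (𝓞 k) (𝓞 L) ε)
    {I : Ideal (𝓞 L)} (hI : I ≠ 0) (hc : cl (I.map (sg σ)) = cl I) :
    ∃ J : Ideal (𝓞 L), J ≠ 0 ∧ J.map (sg σ) = J ∧ cl I = cl J := by
  have hI' : I.map (sg σ) ≠ 0 := map_ne_zero_of_inj _ (sg_inj σ) hI
  obtain ⟨y, x, hy, hx, h⟩ := (cl_eq_iff hI' hI).1 hc
  -- (y) σI = (x) I
  have h2 := congrArg (Ideal.map (sg σ)) h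
  rw [Ideal.map_mul, Ideal.map_mul, q.map_sg_sg, Ideal.map_span, Ideal.map_span,
    Set.image_singleton, Set.image_singleton] at h2
  have h3 : Ideal.span {x * sg σ x} = Ideal.span {y * sg σ y} := by
    have hII : I * I.map (sg σ) ≠ 0 := mul_ne_zero hI hI'
    apply mul_right_cancel₀ hII
    rw [← Ideal.span_singleton_mul_span_singleton, ← Ideal.span_singleton_mul_span_singleton]
    calc _ = (Ideal.span {x} * I) * (Ideal.span {sg σ x} * I.map (sg σ)) := by ring
      _ = (Ideal.span {y} * I.map (sg σ)) * (Ideal.span {sg σ y} * I) := by rw [h, h2]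
      _ = _ := by ring
  rw [Ideal.span_singleton_eq_span_singleton] at h3
  obtain ⟨u, hu⟩ := h3
  have hsx : sg σ x ≠ 0 := fun h => hx (sg_inj σ (by rw [h, map_zero]))
  have hu' : sg σ u = u := by
    have h4 := congrArg (sg σ) hu
    rw [map_mul, map_mul, map_mul, q.sg_sg, q.sg_sg, mul_comm (sg σ x), mul_comm (sg σ y), ← hu] at h4
    exact mul_left_cancel₀ (mul_ne_zero hx hsx) h4
  obtain ⟨ε, hε⟩ := q.unit_of_fixed u hu'
  have hxL : (x : L) ≠ 0 := by simpa using hx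
  have hyL : (y : L) ≠ 0 := by simpa using hy
  have huL : ((x : L) * σ x) * (u : 𝓞 L) = y * σ y := by
    have := congrArg (fun t : 𝓞 L => (t : L)) hu
    simpa using this
  have hsxL : σ (x : L) ≠ 0 := by simpa using hxL
  obtain ⟨v, hv⟩ := hU ε ⟨(y : L) / x, by
    rw [← coe_alg, hε, map_div₀, div_mul_div_comm, ← huL]
    field_simp⟩
  rw [hε] at hv
  have hvL : ((v : 𝓞 L) : L) * σ ((v : 𝓞 L) : L) = (u : 𝓞 L) := by
    have := congrArg (fun t : 𝓞 L => (t : L)) hv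
    simpa using this
  have hv0 : ((v : 𝓞 L) : L) ≠ 0 := by simp
  have hsv0 : σ ((v : 𝓞 L) : L) ≠ 0 := by simp
  obtain ⟨γ, hγ0, hγ⟩ := q.hilbert90_int ((y : L) / (x * (v : 𝓞 L))) (by
    rw [map_div₀, map_mul, div_mul_div_comm, ← huL, ← hvL]
    field_simp)
  have hγ2 : y * sg σ γ = γ * x * v := by
    apply RingOfIntegers.ext
    rw [div_mul_eq_mul_div, div_eq_iff (mul_ne_zero hxL hv0)] at hγ
    simp only [map_mul, coe_sg]
    exact hγ.trans (mul_assoc _ _ _).symm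
  have hsγ : sg σ γ ≠ 0 := fun h => hγ0 (sg_inj σ (by rw [h, map_zero]))
  have hspanv : Ideal.span {((v : 𝓞 L))} = 1 := by
    rw [Ideal.one_eq_top, Ideal.span_singleton_eq_top]; exact v.isUnit
  -- J = γ σI
  refine ⟨Ideal.span {γ} * I.map (sg σ), mul_ne_zero (by simpa using hγ0) hI', ?_, ?_⟩
  · rw [Ideal.map_mul, q.map_sg_sg, Ideal.map_span, Set.image_singleton]
    have hx0 : (Ideal.span {x} : Ideal (𝓞 L)) ≠ 0 := by simpa using hx
    apply mul_left_cancel₀ hx0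
    calc Ideal.span {x} * (Ideal.span {sg σ γ} * I) = Ideal.span {sg σ γ} * (Ideal.span {x} * I) := by ring
      _ = Ideal.span {y * sg σ γ} * I.map (sg σ) := by
        rw [← h, ← Ideal.span_singleton_mul_span_singleton]; ring
      _ = _ := by
        rw [hγ2, ← Ideal.span_singleton_mul_span_singleton, ← Ideal.span_singleton_mul_span_singleton,
          hspanv]; ring
  · rw [cl_mul (by simpa using hγ0) hI', cl_span, one_mul, hc]

theorem invariant_class_mem (S : Subgroup (ClassGroup (𝓞 L)))
    (hS : ∀ c, clMap (algebraMap (𝓞 k) (𝓞 L)) (algInj k L) c ∈ S)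
    (hR : ∀ Q, Ram k σ Q → cl Q ∈ S) (J : Ideal (𝓞 L)) (hJ : J ≠ 0) (hf : J.map (sg σ) = J) :
    cl J ∈ S := by
  let S' : Submonoid (Ideal (𝓞 L)) :=
    { carrier := {I | I ≠ 0 ∧ cl I ∈ S}
      one_mem' := ⟨one_ne_zero, by rw [cl_one]; exact one_mem _⟩
      mul_mem' := by
        rintro a b ⟨ha, ha'⟩ ⟨hb, hb'⟩
        exact ⟨mul_ne_zero ha hb, by rw [cl_mul ha hb]; exact mul_mem ha' hb'⟩ }
  have := q.invariant_mem S' (fun a ha => ⟨map_ne_zero_of_inj _ (algInj k L) ha, by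
    rw [← clMap_cl _ (algInj k L)]; exact hS _⟩) (fun Q hQ => ⟨hQ.ne, hR Q hQ⟩) J hJ hf
  exact this.2

/-- Q5 -/
theorem two_tors_mem (hodd : Odd (Nat.card (ClassGroup (𝓞 k))))
    (hU : ∀ ε : (𝓞 k)ˣ, (∃ z : L, z * σ z = algebraMap k L ((ε : 𝓞 k) : k)) →
      ∃ v : (𝓞 L)ˣ, (v : 𝓞 L) * sg σ v = algebraMap (𝓞 k) (𝓞 L) ε)
    (S : Subgroup (ClassGroup (𝓞 L)))
    (hS : ∀ c, clMap (algebraMap (𝓞 k) (𝓞 L)) (algInj k L) c ∈ S)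
    (hR : ∀ Q, Ram k σ Q → cl Q ∈ S) (c : ClassGroup (𝓞 L)) (hc : c ^ 2 = 1) : c ∈ S := by
  obtain ⟨I, hI, rfl⟩ := cl_surj c
  have hI' : I.map (sg σ) ≠ 0 := map_ne_zero_of_inj _ (sg_inj σ) hI
  obtain ⟨a, ha⟩ := q.norm_ideal I
  have h1 : cl I * cl (I.map (sg σ)) = clMap (algebraMap (𝓞 k) (𝓞 L)) (algInj k L) (cl a) := by
    rw [clMap_cl, ← ha, cl_mul hI hI']
  have h2 : cl (I.map (sg σ)) ^ 2 = 1 := by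
    rw [← clMap_cl _ (sg_inj σ), ← map_pow, hc, map_one]
  have h3 : (cl I * cl (I.map (sg σ))) ^ 2 = 1 := by rw [mul_pow, hc, h2, one_mul]
  have h4 : (cl I * cl (I.map (sg σ))) ^ Nat.card (ClassGroup (𝓞 k)) = 1 := by
    rw [h1, ← map_pow, pow_card_eq_one', map_one]
  obtain ⟨m, hm⟩ := hodd
  rw [hm, pow_succ, pow_mul, h3, one_pow, one_mul] at h4
  have h5 : cl (I.map (sg σ)) = cl I := by
    have : cl I * cl I = 1 := by rw [← pow_two]; exact hc
    exact mul_left_cancel (h4.trans this.symm)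
  obtain ⟨J, hJ, hJf, hJc⟩ := q.fixed_class hU hI h5
  rw [hJc]
  exact q.invariant_class_mem S hS hR J hJ hJf

end IsQuad

open NumberField
open scoped nonZeroDivisors

/-- totally positive element -/
def TotPos {F : Type*} [Field F] (x : F) : Prop := ∀ φ : F →+* ℂ, ∃ r : ℝ, 0 < r ∧ φ x = r

/-- totally real field, by embeddings -/
def TotRe (F : Type*) [Field F] : Prop := ∀ (φ : F →+* ℂ) (x : F), ∃ r : ℝ, φ x = r

theorem TotPos.mul {F : Type*} [Field F] {x y : F} (hx : TotPos x) (hy : TotPos y) :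
    TotPos (x * y) := by
  intro φ
  obtain ⟨r, hr, h⟩ := hx φ
  obtain ⟨s, hs, h'⟩ := hy φ
  exact ⟨r * s, mul_pos hr hs, by rw [map_mul, h, h']; push_cast; rfl⟩

theorem TotPos.pow {F : Type*} [Field F] {x : F} (hx : TotPos x) (n : ℕ) : TotPos (x ^ n) := by
  induction n with
  | zero => exact fun φ => ⟨1, one_pos, by simp⟩
  | succ n ih => rw [pow_succ]; exact ih.mul hx

theorem TotRe.sq_pos {F : Type*} [Field F] (h : TotRe F) {x : F} (hx : x ≠ 0) : TotPos (x ^ 2) := by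
  intro φ
  obtain ⟨r, hr⟩ := h φ x
  have : r ≠ 0 := by
    rintro rfl
    apply hx
    apply φ.injective
    simpa using hr
  exact ⟨r ^ 2, by positivity, by rw [map_pow, hr]; push_cast; rfl⟩

theorem IsQuad.ext_emb {k L : Type*} [Field k] [NumberField k] [Field L] [NumberField L] [Algebra k L]
    {σ : L →+* L} {θ : L} (q : IsQuad k σ θ) (φ : k →+* ℂ) :
    ∃ ψ : L →+* ℂ, ∀ x, ψ (algebraMap k L x) = φ x := by
  letI := φ.toAlgebra
  haveI : FiniteDimensional k L := FiniteDimensional.of_finrank_pos (by rw [q.finrank_eq]; norm_num)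
  exact ⟨(IsAlgClosed.lift : L →ₐ[k] ℂ).toRingHom, fun x => AlgHom.commutes _ x⟩

theorem IsQuad.totPos_down {k L : Type*} [Field k] [NumberField k] [Field L] [NumberField L]
    [Algebra k L] {σ : L →+* L} {θ : L} (q : IsQuad k σ θ) {x : k}
    (h : TotPos (algebraMap k L x)) : TotPos x := by
  intro φ
  obtain ⟨ψ, hψ⟩ := q.ext_emb φ
  obtain ⟨r, hr, e⟩ := h ψ
  exact ⟨r, hr, by rw [← hψ, e]⟩

theorem TotPos.up {k L : Type*} [Field k] [Field L] [Algebra k L] {x : k} (h : TotPos x) :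
    TotPos (algebraMap k L x) := fun φ => h (φ.comp (algebraMap k L))

/-- data of the real field `F_n` -/
structure FD (F : Type*) [Field F] [NumberField F] (c : 𝓞 F) : Prop where
  tr : TotRe F
  pos : TotPos (2 + (c : F))
  neg : TotPos (2 - (c : F))
  n2p : Ideal.absNorm (Ideal.span {2 + c}) = 2
  n2m : Ideal.absNorm (Ideal.span {2 - c}) = 2
  p2 : ∀ Q : Ideal (𝓞 F), Q.IsPrime → (2 : 𝓞 F) ∈ Q → c ∈ Q
  hodd : Odd (Nat.card (ClassGroup (𝓞 F)))
  T : ∀ u : (𝓞 F)ˣ, TotPos ((u : 𝓞 F) : F) → ∃ v : (𝓞 F)ˣ, u = v ^ 2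

/-- the step data -/
structure FStep (F : Type*) {F' : Type*} [Field F] [Field F'] [NumberField F]
    [NumberField F'] [Algebra F F'] (σ : F' →+* F') (c : 𝓞 F) (c' : 𝓞 F') : Prop where
  fd : FD F c
  q : IsQuad F σ (c' : F')
  hc : c' ^ 2 = algebraMap (𝓞 F) (𝓞 F') (2 + c)

namespace FStep
variable {F F' : Type*} [Field F] [Field F'] [NumberField F] [NumberField F'] [Algebra F F']
  {σ : F' →+* F'} {c : 𝓞 F} {c' : 𝓞 F'} (s : FStep F σ c c')
include s

theorem sgc : sg σ c' = -c' := by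
  apply RingOfIntegers.ext
  simpa using s.q.conj

theorem c_ne : c' ≠ 0 := fun h => s.q.ne (by rw [h]; simp)

theorem norm_c : Ideal.absNorm (Ideal.span {c'}) = 2 := by
  have h : Ideal.absNorm (Ideal.span {c'}) ^ 2 = 2 ^ 2 := by
    rw [← map_pow, Ideal.span_singleton_pow, s.hc, ← Set.image_singleton, ← Ideal.map_span,
      s.q.absNorm_map, s.fd.n2p]
  exact Nat.pow_left_injective (n := 2) (by norm_num) h

theorem prime_c : (Ideal.span {c'}).IsPrime := by
  apply Ideal.isPrime_of_irreducible_absNorm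
  rw [s.norm_c]
  exact Nat.prime_two

theorem two_mem : (2 : 𝓞 F') ∈ Ideal.span {c'} := by
  have := Ideal.absNorm_mem (Ideal.span {c'})
  rw [s.norm_c] at this
  exact_mod_cast this

theorem span_ne : (Ideal.span {c'} : Ideal (𝓞 F')) ≠ 0 := by simpa using s.c_ne

theorem p2' (Q : Ideal (𝓞 F')) (hQ : Q.IsPrime) (h : (2 : 𝓞 F') ∈ Q) : c' ∈ Q := by
  have h1 : c ∈ Q.comap (algebraMap (𝓞 F) (𝓞 F')) :=
    s.fd.p2 _ (Ideal.IsPrime.comap _) (by rw [Ideal.mem_comap, map_ofNat]; exact h)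
  apply hQ.mem_of_pow_mem 2
  rw [s.hc, map_add]
  exact Q.add_mem (by rw [map_ofNat]; exact h) h1

theorem ram (Q : Ideal (𝓞 F')) (h : IsQuad.Ram F σ Q) : Q = Ideal.span {c'} := by
  have h1 := h.diff c'
  rw [s.sgc, sub_neg_eq_add, ← two_mul] at h1
  have hc : c' ∈ Q := by
    rcases h.prime.mem_or_mem h1 with h2 | h2
    · exact s.p2' Q h.prime h2
    · exact h2
  have hm : (Ideal.span {c'}).IsMaximal := s.prime_c.isMaximal s.span_ne
  exact (hm.eq_of_le h.prime.ne_top ((Ideal.span_singleton_le_iff_mem _).2 hc)).symm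

theorem tr' : TotRe F' := by
  intro φ x
  have key : ∀ u : F, ∃ r : ℝ, φ (algebraMap F F' u) = r := fun u =>
    s.fd.tr (φ.comp (algebraMap F F')) u
  have hcr : ∃ r : ℝ, φ c' = r := by
    obtain ⟨r, hr, h⟩ := s.fd.pos (φ.comp (algebraMap F F'))
    have h2 : (φ c') ^ 2 = ((Real.sqrt r : ℝ) : ℂ) ^ 2 := by
      rw [← Complex.ofReal_pow, Real.sq_sqrt hr.le, ← h, ← map_pow]
      have := congrArg (fun t : 𝓞 F' => (t : F')) s.hc
      simp only [map_pow] at this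
      rw [this, coe_alg]
      simp [map_ofNat]
    rcases sq_eq_sq_iff_eq_or_eq_neg.1 h2 with h3 | h3
    · exact ⟨_, h3⟩
    · exact ⟨-Real.sqrt r, by rw [h3]; push_cast; rfl⟩
  obtain ⟨u, v, rfl⟩ := s.q.span x
  obtain ⟨a, ha⟩ := key u
  obtain ⟨b, hb⟩ := key v
  obtain ⟨e, he⟩ := hcr
  exact ⟨a + b * e, by rw [map_add, map_mul, ha, hb, he]; push_cast; rfl⟩

theorem mul_eq : (2 + c') * (2 - c') = algebraMap (𝓞 F) (𝓞 F') (2 - c) := by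
  have := s.hc
  simp only [map_add, map_sub, map_ofNat] at *
  linear_combination -this

theorem norms : Ideal.absNorm (Ideal.span {2 + c'}) = 2 ∧ Ideal.absNorm (Ideal.span {2 - c'}) = 2 := by
  have h : Ideal.absNorm (Ideal.span {2 + c'}) * Ideal.absNorm (Ideal.span {2 - c'}) = 2 ^ 2 := by
    rw [← map_mul, Ideal.span_singleton_mul_span_singleton, s.mul_eq, ← Set.image_singleton,
      ← Ideal.map_span, s.q.absNorm_map, s.fd.n2m]
  have hd : ∀ x ∈ Ideal.span {c'}, 2 ∣ Ideal.absNorm (Ideal.span {x}) := by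
    intro x hx
    rw [← s.norm_c]
    exact Ideal.absNorm_dvd_absNorm_of_le ((Ideal.span_singleton_le_iff_mem _).2 hx)
  have hm : c' ∈ Ideal.span {c'} := Ideal.mem_span_singleton_self _
  obtain ⟨a, ha⟩ := hd _ (Ideal.add_mem _ s.two_mem hm)
  obtain ⟨b, hb⟩ := hd _ (Ideal.sub_mem _ s.two_mem hm)
  rw [ha, hb] at h
  have hab : a * b = 1 := by nlinarith
  rw [ha, hb, Nat.eq_one_of_mul_eq_one_right hab, Nat.eq_one_of_mul_eq_one_left hab]
  simp

theorem poss : TotPos (2 + (c' : F')) ∧ TotPos (2 - (c' : F')) := by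
  have key : ∀ φ : F' →+* ℂ, ∃ r : ℝ, φ c' = r ∧ 0 < 2 + r ∧ 0 < 2 - r := by
    intro φ
    obtain ⟨r, hr⟩ := s.tr' φ c'
    obtain ⟨e, he, h⟩ := s.fd.neg (φ.comp (algebraMap F F'))
    have h1 := congrArg (fun t : 𝓞 F' => φ (t : F')) s.mul_eq
    have h2 : (2 + r) * (2 - r) = e := by
      have : ((2 + r : ℂ)) * (2 - r) = e := by
        rw [← h, ← hr]
        simpa [coe_alg, map_ofNat] using h1
      exact_mod_cast this
    refine ⟨r, hr, ?_, ?_⟩ <;> by_contra h3 <;> nlinarith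
  constructor <;> intro φ <;> obtain ⟨r, hr, h1, h2⟩ := key φ
  · exact ⟨2 + r, h1, by simp [hr, map_ofNat]⟩
  · exact ⟨2 - r, h2, by simp [hr, map_ofNat]⟩

end FStep

open NumberField
open scoped nonZeroDivisors

theorem cl_pow_card_span {R : Type*} [CommRing R] [IsDomain R] [IsDedekindDomain R]
    [Finite (ClassGroup R)]
    {I : Ideal R} (hI : I ≠ 0) : ∃ x : R, x ≠ 0 ∧ I ^ Nat.card (ClassGroup R) = Ideal.span {x} := by
  apply (cl_eq_one_iff (pow_ne_zero _ hI)).1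
  rw [cl_pow hI, pow_card_eq_one']

theorem IsQuad.norm_unit {k L : Type*} [Field k] [NumberField k] [Field L] [NumberField L]
    [Algebra k L] {σ : L →+* L} {θ : L} (q : IsQuad k σ θ) (u : (𝓞 L)ˣ) :
    ∃ η : (𝓞 k)ˣ, algebraMap (𝓞 k) (𝓞 L) η = u * sg σ u := by
  obtain ⟨η, h⟩ := q.unit_of_fixed (u * Units.map (sg σ).toMonoidHom u) (by
    simp [q.sg_sg, mul_comm])
  exact ⟨η, by simpa using h⟩

theorem TotPos.conj {L : Type*} [Field L] {x : L} (h : TotPos x) (σ : L →+* L) : TotPos (σ x) :=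
  fun φ => h (φ.comp σ)

namespace FStep
variable {F F' : Type*} [Field F] [Field F'] [NumberField F] [NumberField F'] [Algebra F F']
  {σ : F' →+* F'} {c : 𝓞 F} {c' : 𝓞 F'} (s : FStep F σ c c')
include s

/-- invariant ideals of `F'` -/
theorem inv_span (J : Ideal (𝓞 F')) (hJ : J ≠ 0) (hf : J.map (sg σ) = J) :
    ∃ α : 𝓞 F, α ≠ 0 ∧ ∃ i : ℕ, J ^ Nat.card (ClassGroup (𝓞 F)) =
      Ideal.span {algebraMap (𝓞 F) (𝓞 F') α * c' ^ i} := by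
  let S : Submonoid (Ideal (𝓞 F')) :=
    { carrier := {J | ∃ α : 𝓞 F, α ≠ 0 ∧ ∃ i : ℕ, J ^ Nat.card (ClassGroup (𝓞 F)) =
        Ideal.span {algebraMap (𝓞 F) (𝓞 F') α * c' ^ i}}
      one_mem' := ⟨1, one_ne_zero, 0, by simp⟩
      mul_mem' := by
        rintro a b ⟨α, hα, i, ha⟩ ⟨β, hβ, j, hb⟩
        refine ⟨α * β, mul_ne_zero hα hβ, i + j, ?_⟩
        rw [mul_pow, ha, hb, Ideal.span_singleton_mul_span_singleton, map_mul]
        congr 2; ring }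
  refine s.q.invariant_mem S ?_ ?_ J hJ hf
  · intro a ha
    obtain ⟨x, hx, h⟩ := cl_pow_card_span ha
    exact ⟨x, hx, 0, by rw [← Ideal.map_pow, h, Ideal.map_span, Set.image_singleton]; simp⟩
  · intro Q hQ
    refine ⟨1, one_ne_zero, Nat.card (ClassGroup (𝓞 F)), ?_⟩
    rw [s.ram Q hQ, Ideal.span_singleton_pow]; simp

theorem T' (u : (𝓞 F')ˣ) (hu : TotPos ((u : 𝓞 F') : F')) : ∃ v : (𝓞 F')ˣ, u = v ^ 2 := by
  obtain ⟨η, hη⟩ := s.q.norm_unit u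
  have hηL : algebraMap F F' ((η : 𝓞 F) : F) = (u : 𝓞 F') * σ (u : 𝓞 F') := by
    rw [← coe_alg, hη]; simp
  obtain ⟨v, rfl⟩ := s.fd.T η (s.q.totPos_down (by rw [hηL]; exact hu.mul (hu.conj σ)))
  set V : F' := algebraMap F F' ((v : 𝓞 F) : F) with hV
  have hV0 : V ≠ 0 := by rw [hV]; simp
  have hσV : σ V = V := s.q.fix _
  obtain ⟨γ, hγ0, hγ⟩ := s.q.hilbert90_int (((u : 𝓞 F') : F') / V) (by
    rw [map_div₀, hσV, div_mul_div_comm, ← hηL]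
    have : algebraMap F F' (((v ^ 2 : (𝓞 F)ˣ) : 𝓞 F) : F) = V ^ 2 := by
      rw [Units.val_pow_eq_pow_val, hV, ← map_pow]; congr 1
    rw [this]; field_simp)
  have hγ2 : (u : 𝓞 F') * sg σ γ = algebraMap (𝓞 F) (𝓞 F') v * γ := by
    apply RingOfIntegers.ext
    rw [div_mul_eq_mul_div, div_eq_iff hV0] at hγ
    simp only [map_mul, coe_sg]
    exact hγ.trans (mul_comm _ _)
  have hspan : (Ideal.span {γ}).map (sg σ) = Ideal.span {γ} := by
    rw [Ideal.map_span, Set.image_singleton]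
    rw [Ideal.span_singleton_eq_span_singleton]
    refine ⟨u * (Units.map (algebraMap (𝓞 F) (𝓞 F')).toMonoidHom v)⁻¹, ?_⟩
    rw [Units.val_mul, ← mul_assoc, mul_comm _ (u : 𝓞 F'), hγ2, Units.mul_inv_eq_iff_eq_mul]
    simp [mul_comm]
  obtain ⟨α, hα, i, h⟩ := s.inv_span _ (by simpa using hγ0) hspan
  set m := Nat.card (ClassGroup (𝓞 F)) with hm
  rw [Ideal.span_singleton_pow, Ideal.span_singleton_eq_span_singleton] at h
  obtain ⟨ε, hε⟩ := h.symm
  set a := algebraMap (𝓞 F) (𝓞 F')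
  have ha0 : a α ≠ 0 := fun h => hα (algInj F F' (by rw [h, map_zero]))
  have h1 : (u : 𝓞 F') ^ m * (a α * (-1) ^ i * c' ^ i * sg σ ε) = a v ^ m * (a α * c' ^ i * ε) := by
    have h2 := congrArg (· ^ m) hγ2
    simp only [mul_pow] at h2
    rw [← map_pow, ← hε] at h2
    have h5 : sg σ (a α) = a α := s.q.sg_alg α
    simp only [map_mul, map_pow, s.sgc, h5] at h2
    rw [← h2, neg_pow c' i]; ring
  have h3 : (u : 𝓞 F') ^ m * ((-1) ^ i * sg σ ε) = a v ^ m * ε := by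
    apply mul_left_cancel₀ (mul_ne_zero ha0 (pow_ne_zero i s.c_ne))
    linear_combination h1
  obtain ⟨δ, hδ⟩ := s.q.norm_unit ε
  have h4 : a (((-1) ^ i * v ^ m * δ : (𝓞 F)ˣ) : 𝓞 F) = (u : 𝓞 F') ^ m * (sg σ ε) ^ 2 := by
    push_cast
    rw [map_mul, map_mul, map_pow, map_pow, map_neg, map_one, hδ]
    have h5 : ((-1 : 𝓞 F') ^ i) * (-1) ^ i = 1 := by rw [← mul_pow]; simp
    linear_combination (-1 : 𝓞 F') ^ i * sg σ ε * (-h3) + (u : 𝓞 F') ^ m * (sg σ ε) ^ 2 * h5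
  have hnz : σ ((ε : 𝓞 F') : F') ≠ 0 := by simp
  obtain ⟨t, ht⟩ := s.fd.T ((-1) ^ i * v ^ m * δ) (s.q.totPos_down (by
    rw [← coe_alg, h4]
    simp only [map_mul, map_pow, coe_sg]
    exact (hu.pow m).mul (s.tr'.sq_pos hnz)))
  rw [ht] at h4
  obtain ⟨j, hj⟩ := s.fd.hodd
  rw [← hm] at hj
  have hU : (Units.map (algebraMap (𝓞 F) (𝓞 F')).toMonoidHom t) ^ 2 =
      u ^ m * (Units.map (sg σ).toMonoidHom ε) ^ 2 := by
    ext1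
    simpa using h4
  refine ⟨Units.map (algebraMap (𝓞 F) (𝓞 F')).toMonoidHom t * (Units.map (sg σ).toMonoidHom ε)⁻¹
    * (u ^ j)⁻¹, ?_⟩
  rw [mul_pow, mul_pow, hU, hj]
  rw [inv_pow, inv_pow, mul_inv_cancel_right, ← pow_mul, mul_comm 2 j, pow_succ, mul_comm]
  simp

end FStep

open NumberField
open scoped nonZeroDivisors

section coes
variable {F : Type*} [Field F]
theorem ic_mul (x y : 𝓞 F) : ((x * y : 𝓞 F) : F) = x * y := rfl
theorem ic_add (x y : 𝓞 F) : ((x + y : 𝓞 F) : F) = x + y := rfl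
theorem ic_sub (x y : 𝓞 F) : ((x - y : 𝓞 F) : F) = x - y := rfl
theorem ic_neg (x : 𝓞 F) : ((-x : 𝓞 F) : F) = -x := rfl
theorem ic_pow (x : 𝓞 F) (n : ℕ) : ((x ^ n : 𝓞 F) : F) = x ^ n := map_pow (algebraMap (𝓞 F) F) x n
theorem ic_ofNat (n : ℕ) [n.AtLeastTwo] : ((OfNat.ofNat n : 𝓞 F) : F) = OfNat.ofNat n :=
  map_ofNat (algebraMap (𝓞 F) F) n
theorem ic_two : ((2 : 𝓞 F) : F) = 2 := map_ofNat (algebraMap (𝓞 F) F) 2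
theorem ic_nat (n : ℕ) : ((n : 𝓞 F) : F) = n := map_natCast (algebraMap (𝓞 F) F) n
theorem ic_int (n : ℤ) : ((n : 𝓞 F) : F) = n := map_intCast (algebraMap (𝓞 F) F) n
theorem ic_one : ((1 : 𝓞 F) : F) = 1 := rfl
theorem ic_zero : ((0 : 𝓞 F) : F) = 0 := rfl
end coes

theorem TotRe.isTotallyReal {F : Type*} [Field F] [NumberField F] (h : TotRe F) :
    IsTotallyReal F := by
  refine ⟨fun v => ?_⟩
  rw [← InfinitePlace.mk_embedding v, InfinitePlace.isReal_mk_iff]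
  ext x
  obtain ⟨r, hr⟩ := h v.embedding x
  rw [ComplexEmbedding.conjugate_coe_eq, hr, Complex.conj_ofReal]

section signs
variable {F : Type*} [Field F] [NumberField F] (htr : TotRe F)
  (hT : ∀ u : (𝓞 F)ˣ, TotPos ((u : 𝓞 F) : F) → ∃ v : (𝓞 F)ˣ, u = v ^ 2)

/-- sign of a field element at an embedding -/
def posAt (φ : F →+* ℂ) (x : F) : Prop := 0 < (φ x).re

include htr in
theorem posAt_mul {φ : F →+* ℂ} {x y : F} (hx : x ≠ 0) (hy : y ≠ 0) :
    posAt φ (x * y) ↔ (posAt φ x ↔ posAt φ y) := by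
  obtain ⟨r, hr⟩ := htr φ x
  obtain ⟨t, ht⟩ := htr φ y
  have hr0 : r ≠ 0 := by
    rintro rfl; exact hx (φ.injective (by simpa using hr))
  have ht0 : t ≠ 0 := by
    rintro rfl; exact hy (φ.injective (by simpa using ht))
  unfold posAt
  rw [map_mul, hr, ht, ← Complex.ofReal_mul, Complex.ofReal_re, Complex.ofReal_re, Complex.ofReal_re]
  rcases lt_or_gt_of_ne hr0 with h1 | h1 <;> rcases lt_or_gt_of_ne ht0 with h2 | h2
  · simp [mul_pos_of_neg_of_neg h1 h2, h1.not_gt, h2.not_gt]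
  · simp [(mul_neg_of_neg_of_pos h1 h2).not_gt, h1.not_gt, h2]
  · simp [(mul_neg_of_pos_of_neg h1 h2).not_gt, h1, h2.not_gt]
  · simp [mul_pos h1 h2, h1, h2]

include htr in
theorem totPos_of_posAt {x : F} (h : ∀ φ, posAt φ x) : TotPos x := by
  intro φ
  obtain ⟨r, hr⟩ := htr φ x
  have := h φ
  unfold posAt at this
  rw [hr, Complex.ofReal_re] at this
  exact ⟨r, this, hr⟩

include htr hT in
theorem sign_surj (P : (F →+* ℂ) → Prop) : ∃ u : (𝓞 F)ˣ, ∀ φ, posAt φ ((u : 𝓞 F) : F) ↔ P φ := by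
  classical
  haveI := htr.isTotallyReal
  let g : Bool × (Fin (Units.rank F) → Bool) → (𝓞 F)ˣ := fun x =>
    (-1) ^ (x.1.toNat) * ∏ i, Units.fundSystem F i ^ ((x.2 i).toNat)
  let S : Bool × (Fin (Units.rank F) → Bool) → ((F →+* ℂ) → Prop) := fun x φ =>
    posAt φ ((g x : 𝓞 F) : F)
  have hinj : Function.Injective S := by
    rintro ⟨b, e⟩ ⟨b', e'⟩ h
    have hpos : TotPos (((g (b, e) * g (b', e') : (𝓞 F)ˣ) : 𝓞 F) : F) := by
      apply totPos_of_posAt htr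
      intro φ
      have := congrFun h φ
      rw [Units.val_mul, ic_mul, posAt_mul htr (by simp) (by simp)]
      exact iff_of_eq this
    obtain ⟨v, hv⟩ := hT _ hpos
    obtain ⟨⟨ζ, f⟩, hf, -⟩ := Units.exist_unique_eq_mul_prod F v
    have hneg : (-1 : (𝓞 F)ˣ) ∈ Units.torsion F := by
      rw [Units.torsion, CommGroup.mem_torsion, isOfFinOrder_iff_pow_eq_one]
      exact ⟨2, by norm_num, by simp⟩
    have h1 : g (b, e) * g (b', e') = (((⟨-1, hneg⟩ : Units.torsion F) ^ (b.toNat + b'.toNat) :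
        Units.torsion F) : (𝓞 F)ˣ) *
        ∏ i, Units.fundSystem F i ^ (((e i).toNat + (e' i).toNat : ℕ) : ℤ) := by
      simp only [g, zpow_natCast, pow_add, Finset.prod_mul_distrib]
      push_cast
      rw [mul_mul_mul_comm]
    have h2 : v ^ 2 = ((ζ ^ 2 : Units.torsion F) : (𝓞 F)ˣ) *
        ∏ i, Units.fundSystem F i ^ (2 * f i) := by
      rw [hf]
      simp only [mul_pow, ← Finset.prod_pow, mul_comm (2 : ℤ), zpow_mul]
      push_cast
      norm_cast
    obtain ⟨w, -, hw⟩ := Units.exist_unique_eq_mul_prod F (v ^ 2)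
    have h3 := hw (_, _) (by rw [← hv]; exact h1)
    have h4 := hw (_, _) h2
    have h5 := congrArg Prod.snd (h3.trans h4.symm)
    have he : e = e' := by
      ext i
      have := congrFun h5 i
      simp only at this
      cases h7 : e i <;> cases h8 : e' i <;> simp [h7, h8] at this ⊢ <;> omega
    subst he
    have hb : b = b' := by
      by_contra hb
      obtain ⟨φ⟩ : Nonempty (F →+* ℂ) := inferInstance
      have h6 : g (b, e) * g (b', e) = -(∏ i, Units.fundSystem F i ^ ((e i).toNat)) ^ 2 := by
        cases b <;> cases b' <;> simp [g, pow_two] at hb ⊢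
      rw [h6] at hpos
      obtain ⟨r, hr, h7⟩ := hpos φ
      obtain ⟨t, ht⟩ := htr φ (((∏ i, Units.fundSystem F i ^ ((e i).toNat) : (𝓞 F)ˣ) : 𝓞 F) : F)
      rw [Units.val_neg, Units.val_pow_eq_pow_val, ic_neg, ic_pow, map_neg, map_pow, ht] at h7
      have : -t ^ 2 = r := by exact_mod_cast h7
      nlinarith [sq_nonneg t]
    rw [hb]
  have nrc : Fintype.card (InfinitePlace F) = InfinitePlace.nrRealPlaces F := by
    rw [InfinitePlace.card_eq_nrRealPlaces_add_nrComplexPlaces,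
      IsTotallyReal.nrComplexPlaces_eq_zero, add_zero]
  have hcard : Fintype.card (Bool × (Fin (Units.rank F) → Bool)) =
      Fintype.card ((F →+* ℂ) → Prop) := by
    rw [Fintype.card_prod, Fintype.card_fun, Fintype.card_fun, Fintype.card_bool, Fintype.card_prop,
      Embeddings.card, IsTotallyReal.finrank, ← nrc, Fintype.card_fin, ← pow_succ']
    congr 1
    unfold Units.rank
    have : 0 < Fintype.card (InfinitePlace F) := Fintype.card_pos
    omega
  obtain ⟨x, hx⟩ := ((Fintype.bijective_iff_injective_and_card S).2 ⟨hinj, hcard⟩).2 P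
  exact ⟨g x, fun φ => iff_of_eq (congrFun hx φ)⟩

end signs

namespace FStep
variable {F F' : Type*} [Field F] [Field F'] [NumberField F] [NumberField F'] [Algebra F F']
  {σ : F' →+* F'} {c : 𝓞 F} {c' : 𝓞 F'} (s : FStep F σ c c')
include s

theorem NS (ε : (𝓞 F)ˣ) : ∃ v : (𝓞 F')ˣ, (v : 𝓞 F') * sg σ v = algebraMap (𝓞 F) (𝓞 F') ε := by
  obtain ⟨u, hu⟩ := sign_surj s.tr' s.T' (fun ψ => posAt ψ (c' : F') →
    posAt ψ (algebraMap F F' ((ε : 𝓞 F) : F)))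
  obtain ⟨η, hη⟩ := s.q.norm_unit u
  have hηL : algebraMap F F' ((η : 𝓞 F) : F) = (u : 𝓞 F') * σ (u : 𝓞 F') := by
    rw [← coe_alg, hη]; simp
  have hpos : TotPos ((((η * ε : (𝓞 F)ˣ) : 𝓞 F) : F)) := by
    apply s.q.totPos_down
    apply totPos_of_posAt s.tr'
    intro ψ
    have hε0 : algebraMap F F' ((ε : 𝓞 F) : F) ≠ 0 := by simp
    have hu0 : ((u : 𝓞 F') : F') ≠ 0 := by simp
    have hu1 : σ ((u : 𝓞 F') : F') ≠ 0 := by simp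
    have e1 : algebraMap F F' ((((η * ε : (𝓞 F)ˣ) : 𝓞 F) : F)) =
        ((u : 𝓞 F') * σ (u : 𝓞 F')) * algebraMap F F' ((ε : 𝓞 F) : F) := by
      rw [Units.val_mul, ← hηL, ← map_mul]; rfl
    rw [e1, posAt_mul s.tr' (mul_ne_zero hu0 hu1) hε0, posAt_mul s.tr' hu0 hu1, hu]
    have h2 : posAt ψ (σ ((u : 𝓞 F') : F')) ↔ (¬ posAt ψ (c' : F') →
        posAt ψ (algebraMap F F' ((ε : 𝓞 F) : F))) := by
      have h3 := hu (ψ.comp σ)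
      unfold posAt at h3 ⊢
      rw [RingHom.comp_apply] at h3
      rw [h3, RingHom.comp_apply, RingHom.comp_apply, s.q.fix, s.q.conj, map_neg, Complex.neg_re]
      have hne : (ψ (c' : F')).re ≠ 0 := by
        intro h0
        obtain ⟨r, hr⟩ := s.tr' ψ c'
        rw [hr, Complex.ofReal_re] at h0
        rw [h0] at hr
        exact s.q.ne (ψ.injective (by simpa using hr))
      have : 0 < -(ψ (c' : F')).re ↔ ¬ 0 < (ψ (c' : F')).re := by
        rw [not_lt, le_iff_lt_or_eq]
        simp [hne]
      rw [this]
    rw [h2]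
    tauto
  obtain ⟨v, hv⟩ := s.fd.T _ hpos
  refine ⟨Units.map (algebraMap (𝓞 F) (𝓞 F')).toMonoidHom v * u⁻¹, ?_⟩
  have hsu : sg σ (u : 𝓞 F') * sg σ (↑u⁻¹ : 𝓞 F') = 1 := by rw [← map_mul]; simp
  have huu : (u : 𝓞 F') * (↑u⁻¹ : 𝓞 F') = 1 := by simp
  have h3 : (u : 𝓞 F') * sg σ u * algebraMap (𝓞 F) (𝓞 F') ε =
      algebraMap (𝓞 F) (𝓞 F') v * algebraMap (𝓞 F) (𝓞 F') v := by
    rw [← hη, ← map_mul, ← map_mul, ← Units.val_mul, hv, pow_two, Units.val_mul]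
  push_cast
  simp only [RingHom.toMonoidHom_eq_coe, Units.coe_map, MonoidHom.coe_coe, map_mul, s.q.sg_alg]
  linear_combination (-(↑u⁻¹ : 𝓞 F') * sg σ (↑u⁻¹ : 𝓞 F')) * h3 +
    algebraMap (𝓞 F) (𝓞 F') ε * hsu + algebraMap (𝓞 F) (𝓞 F') ε *
      (sg σ (u : 𝓞 F') * sg σ (↑u⁻¹ : 𝓞 F')) * huu

theorem hodd' : Odd (Nat.card (ClassGroup (𝓞 F'))) := by
  by_contra h
  rw [Nat.not_odd_iff_even, even_iff_two_dvd] at h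
  haveI : Fact (Nat.Prime 2) := ⟨Nat.prime_two⟩
  obtain ⟨x, hx⟩ := exists_prime_orderOf_dvd_card' 2 h
  have hx2 : x ^ 2 = 1 := by rw [← hx]; exact pow_orderOf_eq_one x
  have h1 := s.q.two_tors_mem s.fd.hodd (fun ε _ => s.NS ε)
    (powMonoidHom (Nat.card (ClassGroup (𝓞 F)))).ker (fun c => by
      rw [MonoidHom.mem_ker, powMonoidHom_apply, ← map_pow, pow_card_eq_one', map_one])
    (fun Q hQ => by
      rw [s.ram Q hQ, cl_span]; exact one_mem _) x hx2
  rw [MonoidHom.mem_ker, powMonoidHom_apply] at h1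
  have : orderOf x ∣ Nat.card (ClassGroup (𝓞 F)) := orderOf_dvd_of_pow_eq_one h1
  rw [hx] at this
  exact (Nat.not_even_iff_odd.2 s.fd.hodd) (even_iff_two_dvd.2 this)

theorem fd' : FD F' c' :=
  ⟨s.tr', s.poss.1, s.poss.2, s.norms.1, s.norms.2, s.p2', s.hodd', s.T'⟩

end FStep

open NumberField
open scoped nonZeroDivisors

/-- a non square modulo `Q` is not represented by `X^2 + D Y^2` when `Q` exactly divides `D` -/
theorem not_repr {R K : Type*} [CommRing R] [IsDomain R] [IsDedekindDomain R] [Field K] [Algebra R K]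
    [IsFractionRing R K] (Q : Ideal R) (hQ : Q.IsPrime) (D a : R) (hD : D ∈ Q) (hD2 : D ∉ Q ^ 2)
    (ha : ∀ x : R, x ^ 2 - a ∉ Q) (X Y : K) :
    algebraMap R K a ≠ X ^ 2 + algebraMap R K D * Y ^ 2 := by
  have hQ0 : Q ≠ ⊥ := by
    rintro rfl
    apply hD2
    rw [Ideal.mem_bot] at hD
    rw [hD]; exact zero_mem _
  have hmax : Q.IsMaximal := hQ.isMaximal hQ0
  -- the uniformizer
  obtain ⟨β, hβ, hβQ⟩ : ∃ β : R, β ∉ Q ∧ ∀ x ∈ Q, D ∣ β * x := by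
    obtain ⟨J, hJ⟩ := Ideal.dvd_span_singleton.2 hD
    have hJQ : ¬ J ≤ Q := by
      intro h
      apply hD2
      have : Ideal.span {D} ≤ Q ^ 2 := by
        rw [hJ, pow_two]; exact Ideal.mul_mono_right h
      exact this (Ideal.mem_span_singleton_self _)
    obtain ⟨β, hβJ, hβ⟩ := SetLike.not_le_iff_exists.1 hJQ
    refine ⟨β, hβ, fun x hx => ?_⟩
    rw [← Ideal.mem_span_singleton, hJ, mul_comm Q J]
    exact Ideal.mul_mem_mul hβJ hx
  have hD0 : D ≠ 0 := by rintro rfl; exact hD2 (zero_mem _)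
  have key : ∀ n : ℕ, ∀ X Y Z : R, a * Z ^ 2 = X ^ 2 + D * Y ^ 2 → Z ∈ Q ^ n := by
    intro n
    induction n with
    | zero => intro X Y Z _; simp
    | succ n ih =>
      intro X Y Z h
      have hZ : Z ∈ Q := by
        by_contra hZ
        obtain ⟨y, i, hi, hy⟩ := hmax.exists_inv hZ
        apply ha (y * X)
        have : (y * X) ^ 2 - a = (y * y) * (X ^ 2 - a * Z ^ 2) + (y * Z - 1) * (a * (y * Z + 1)) := by ring
        rw [this]
        refine Q.add_mem (Q.mul_mem_left _ ?_) (Q.mul_mem_right _ ?_)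
        · rw [h]
          have : X ^ 2 - (X ^ 2 + D * Y ^ 2) = D * (-Y ^ 2) := by ring
          rw [this]; exact Q.mul_mem_right _ hD
        · have : y * Z - 1 = -i := by linear_combination hy
          rw [this]; exact Q.neg_mem hi
      have hX : X ∈ Q := by
        apply hQ.mem_of_pow_mem 2
        have : X ^ 2 = a * Z * Z - D * Y ^ 2 := by linear_combination -h
        rw [this]
        exact Q.sub_mem (Q.mul_mem_left _ hZ) (Q.mul_mem_right _ hD)
      have hY : Y ∈ Q := by
        have h1 : Y ^ 2 * D ∈ Q ^ 2 := by
          have : Y ^ 2 * D = a * Z ^ 2 - X ^ 2 := by linear_combination -h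
          rw [this]
          exact (Q ^ 2).sub_mem ((Q ^ 2).mul_mem_left _ (Ideal.pow_mem_pow hZ 2)) (Ideal.pow_mem_pow hX 2)
        rcases Ideal.IsPrime.mul_mem_pow Q h1 with h2 | h2
        · exact hQ.mem_of_pow_mem 2 h2
        · exact absurd h2 hD2
      obtain ⟨X', hX'⟩ := hβQ X hX
      obtain ⟨Y', hY'⟩ := hβQ Y hY
      obtain ⟨Z', hZ'⟩ := hβQ Z hZ
      have h2 : a * Z' ^ 2 = X' ^ 2 + D * Y' ^ 2 := by
        apply mul_left_cancel₀ (pow_ne_zero 2 hD0)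
        have : D ^ 2 * (a * Z' ^ 2) = a * (D * Z') ^ 2 := by ring
        rw [this, ← hZ']
        have : D ^ 2 * (X' ^ 2 + D * Y' ^ 2) = (D * X') ^ 2 + D * (D * Y') ^ 2 := by ring
        rw [this, ← hX', ← hY']
        linear_combination β ^ 2 * h
      have h3 : β * Z ∈ Q ^ (n + 1) := by
        rw [hZ', pow_succ']
        exact Ideal.mul_mem_mul hD (ih _ _ _ h2)
      rcases Ideal.IsPrime.mul_mem_pow Q h3 with h4 | h4
      · exact absurd h4 hβ
      · exact h4
  intro h
  obtain ⟨⟨x, z⟩, hx⟩ := IsLocalization.surj R⁰ X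
  obtain ⟨⟨y, w⟩, hy⟩ := IsLocalization.surj R⁰ Y
  simp only at hx hy
  have hz0 : (z : R) ≠ 0 := nonZeroDivisors.ne_zero z.2
  have hw0 : (w : R) ≠ 0 := nonZeroDivisors.ne_zero w.2
  have h5 : a * (z * w) ^ 2 = (x * w) ^ 2 + D * (y * z) ^ 2 := by
    apply IsFractionRing.injective R K
    simp only [map_mul, map_pow, map_add]
    rw [← hx, ← hy, h]; ring
  have h6 : ∀ n, (z * w : R) ∈ Q ^ n := fun n => key n _ _ _ h5
  have h7 : (z * w : R) ∈ (⨅ i : ℕ, Q ^ i : Ideal R) := by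
    rw [Ideal.mem_iInf]; exact h6
  rw [Ideal.iInf_pow_eq_bot_of_isDomain _ hmax.ne_top, Ideal.mem_bot] at h7
  exact mul_ne_zero hz0 hw0 h7

/-- inertness condition for a prime of `F_n` -/
structure PP {F : Type*} [Field F] [NumberField F] (c : 𝓞 F) (p : Ideal (𝓞 F)) : Prop where
  prime : p.IsPrime
  ne : p ≠ 0
  two : (2 : 𝓞 F) ∉ p
  nsp : ∀ x, x ^ 2 - (2 + c) ∉ p
  nsm : ∀ x, x ^ 2 - (2 - c) ∉ p

namespace FStep
variable {F F' : Type*} [Field F] [Field F'] [NumberField F] [NumberField F'] [Algebra F F']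
  {σ : F' →+* F'} {c : 𝓞 F} {c' : 𝓞 F'} (s : FStep F σ c c')
include s

theorem pp_prime {p : Ideal (𝓞 F)} (h : PP c p) :
    (p.map (algebraMap (𝓞 F) (𝓞 F'))).IsPrime ∧
    (p.map (algebraMap (𝓞 F) (𝓞 F'))).comap (algebraMap (𝓞 F) (𝓞 F')) = p := by
  have hpm : p.IsMaximal := h.prime.isMaximal h.ne
  haveI := h.prime
  obtain ⟨Q, hQ, hQp⟩ : ∃ Q : Ideal (𝓞 F'), Q.IsPrime ∧ Q.comap (algebraMap (𝓞 F) (𝓞 F')) = p := by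
    have hle : (RingHom.ker (algebraMap (𝓞 F) (𝓞 F'))) ≤ p := by
      rw [(RingHom.injective_iff_ker_eq_bot _).1 (algInj F F')]; exact bot_le
    obtain ⟨Q, h1, h2⟩ := Ideal.exists_ideal_over_prime_of_isIntegral_of_isDomain (S := 𝓞 F') p hle
    exact ⟨Q, h1, h2⟩
  have hQ0 : Q ≠ 0 := by
    rintro rfl
    apply h.ne
    refine hQp.symm.trans (le_antisymm ?_ bot_le)
    intro x hx
    rw [Ideal.mem_comap] at hx
    exact algInj F F' (by simpa using hx)
  have h2Q : (2 : 𝓞 F') ∉ Q := by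
    intro h2
    apply h.two
    rw [← hQp, Ideal.mem_comap, map_ofNat]; exact h2
  rcases s.q.trich hQ hQ0 with ⟨hne, hpo⟩ | ⟨-, hpo⟩ | hR
  · exfalso
    have hQm := hQ.isMaximal hQ0
    have hQm' := (s.q.isPrime_map_sg hQ).isMaximal (map_ne_zero_of_inj _ (sg_inj σ) hQ0)
    have hcop : IsCoprime Q (Q.map (sg σ)) :=
      Ideal.isCoprime_iff_sup_eq.2 (hQm.coprime_of_ne hQm' hne.symm)
    obtain ⟨a, ha, b, hb, hab⟩ := Ideal.isCoprime_iff_exists.1 hcop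
    -- y = c' mod Q, -c' mod σ Q
    set y : 𝓞 F' := c' * b - c' * a with hy
    have h1 : y - c' ∈ Q := by
      have : y - c' = a * (-2 * c') := by rw [hy]; linear_combination c' * hab
      rw [this]; exact Q.mul_mem_right _ ha
    have h2 : sg σ y - c' ∈ Q := by
      have : sg σ y - c' = sg σ b * (-2 * c') := by
        have h3 : sg σ a + sg σ b = 1 := by rw [← map_add, hab, map_one]
        rw [hy, map_sub, map_mul, map_mul, s.sgc]; linear_combination c' * h3
      rw [this]; exact Q.mul_mem_right _ ((s.q.mem_map_sg Q b).1 hb)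
    obtain ⟨t, ht⟩ := s.q.of_fixed_int (y + sg σ y) (by rw [map_add, s.q.sg_sg, add_comm])
    have h3 : algebraMap (𝓞 F) (𝓞 F') t - 2 * c' ∈ Q := by
      have : algebraMap (𝓞 F) (𝓞 F') t - 2 * c' = (y - c') + (sg σ y - c') := by rw [ht]; ring
      rw [this]; exact Q.add_mem h1 h2
    have h4 : t ^ 2 - 4 * (2 + c) ∈ p := by
      rw [← hQp, Ideal.mem_comap]
      have : algebraMap (𝓞 F) (𝓞 F') (t ^ 2 - 4 * (2 + c)) =
          (algebraMap (𝓞 F) (𝓞 F') t - 2 * c') * (algebraMap (𝓞 F) (𝓞 F') t + 2 * c') := by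
        rw [map_sub, map_mul, ← s.hc, map_ofNat, map_pow]; ring
      rw [this]; exact Q.mul_mem_right _ h3
    obtain ⟨z, i, hi, hz⟩ := hpm.exists_inv h.two
    apply h.nsp (z * t)
    have : (z * t) ^ 2 - (2 + c) = z ^ 2 * (t ^ 2 - 4 * (2 + c)) + (z * 2 - 1) * ((z * 2 + 1) * (2 + c)) := by
      ring
    rw [this]
    refine p.add_mem (p.mul_mem_left _ h4) (p.mul_mem_right _ ?_)
    have : z * 2 - 1 = -i := by linear_combination hz
    rw [this]; exact p.neg_mem hi
  · rw [← hQp, hpo]; exact ⟨hQ, rfl⟩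
  · exfalso
    apply h2Q
    rw [s.ram Q hR]; exact s.two_mem

theorem pp {p : Ideal (𝓞 F)} (h : PP c p) : PP c' (p.map (algebraMap (𝓞 F) (𝓞 F'))) := by
  obtain ⟨h1, h2⟩ := s.pp_prime h
  set Q := p.map (algebraMap (𝓞 F) (𝓞 F')) with hQ
  have hfix : Q.map (sg σ) = Q := s.q.map_sg_map p
  have key : ∀ (e : 𝓞 F') (_ : e * sg σ e = algebraMap (𝓞 F) (𝓞 F') (2 - c)) (x : 𝓞 F'),
      x ^ 2 - e ∉ Q := by
    intro e he x hx
    have hx' : sg σ x ^ 2 - sg σ e ∈ Q := by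
      rw [← map_pow, ← map_sub]
      rw [← hfix, s.q.mem_map_sg, s.q.sg_sg]; exact hx
    obtain ⟨w, hw⟩ := s.q.norm_mem_int x
    apply h.nsm w
    rw [← h2, Ideal.mem_comap, map_sub, map_pow, hw, ← he]
    have : (x * sg σ x) ^ 2 - e * sg σ e = (x ^ 2 - e) * sg σ x ^ 2 + (sg σ x ^ 2 - sg σ e) * e := by
      ring
    rw [this]
    exact Q.add_mem (Q.mul_mem_right _ hx) (Q.mul_mem_right _ hx')
  refine ⟨h1, map_ne_zero_of_inj _ (algInj F F') h.ne, ?_, key _ ?_, key _ ?_⟩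
  · intro h3
    apply h.two
    rw [← h2, Ideal.mem_comap, map_ofNat]; exact h3
  · rw [map_add, s.sgc, map_ofNat, ← s.mul_eq]; ring
  · rw [map_sub, s.sgc, map_ofNat, ← s.mul_eq]; ring

/-- norm argument -/
theorem nn (d : ℕ) (h : ∀ X Y : F, 2 - (c : F) ≠ X ^ 2 + d * Y ^ 2) (X Y : F') :
    2 + (c' : F') ≠ X ^ 2 + d * Y ^ 2 ∧ 2 - (c' : F') ≠ X ^ 2 + d * Y ^ 2 := by
  have key : ∀ e : F', e * σ e = algebraMap F F' (2 - c) → e ≠ X ^ 2 + d * Y ^ 2 := by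
    intro e he hXY
    obtain ⟨U, hU⟩ := s.q.of_fixed (X * σ X - d * Y * σ Y) (by
      simp only [map_sub, map_mul, s.q.invol, map_natCast]; ring)
    obtain ⟨V, hV⟩ := s.q.of_fixed (X * σ Y + Y * σ X) (by
      simp only [map_add, map_mul, s.q.invol]; ring)
    apply h U V
    apply (algebraMap F F').injective
    rw [← he, map_add, map_mul, map_pow, map_pow, hU, hV, hXY, map_natCast]
    simp only [map_add, map_mul, map_pow, map_natCast]
    ring
  have hm := congrArg (fun t : 𝓞 F' => (t : F')) s.mul_eq
  simp only [coe_alg, ic_mul, ic_add, ic_sub, ic_two] at hm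
  exact ⟨key _ (by rw [map_add, s.q.conj, map_ofNat, ← hm]; ring),
    key _ (by rw [map_sub, s.q.conj, map_ofNat, ← hm]; ring)⟩

end FStep

open NumberField
open scoped nonZeroDivisors

namespace IsQuad
variable {k L : Type*} [Field k] [NumberField k] [Field L] [NumberField L] [Algebra k L]
  {σ : L →+* L} {θ : L} (q : IsQuad k σ θ)
include q

theorem mem_of_alg_mem (a : Ideal (𝓞 k)) (x : 𝓞 k)
    (h : algebraMap (𝓞 k) (𝓞 L) x ∈ a.map (algebraMap (𝓞 k) (𝓞 L))) : x ∈ a := by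
  have h1 : (Ideal.span {x} ⊔ a).map (algebraMap (𝓞 k) (𝓞 L)) = a.map (algebraMap (𝓞 k) (𝓞 L)) := by
    rw [Ideal.map_sup, Ideal.map_span, Set.image_singleton, sup_eq_right]
    exact (Ideal.span_singleton_le_iff_mem _).2 h
  rw [← q.map_inj h1]
  exact Ideal.mem_sup_left (Ideal.mem_span_singleton_self x)

/-- In the unramified situation an element of both conjugates is in the extension of the prime -/
theorem trich' {Q : Ideal (𝓞 L)} (hQ : Q.IsPrime) (h0 : Q ≠ 0) (x : 𝓞 L) (hx : x ∈ Q)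
    (hx' : sg σ x ∈ Q)
    (hn : x ∉ (Q.comap (algebraMap (𝓞 k) (𝓞 L))).map (algebraMap (𝓞 k) (𝓞 L))) : Ram k σ Q := by
  rcases q.trich hQ h0 with ⟨hne, hpo⟩ | ⟨-, hpo⟩ | hR
  · exfalso
    apply hn
    have hQm := hQ.isMaximal h0
    have hQm' := (q.isPrime_map_sg hQ).isMaximal (map_ne_zero_of_inj _ (sg_inj σ) h0)
    have hcop : IsCoprime Q (Q.map (sg σ)) :=
      Ideal.isCoprime_iff_sup_eq.2 (hQm.coprime_of_ne hQm' hne.symm)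
    rw [hpo, ← Ideal.inf_eq_mul_of_isCoprime hcop]
    exact ⟨hx, (q.mem_map_sg Q x).2 hx'⟩
  · exfalso; apply hn; rw [hpo]; exact hx
  · exact hR

theorem ram_of_mem {Q : Ideal (𝓞 L)} (hQ : Q.IsPrime) (h0 : Q ≠ 0) (x : 𝓞 L) (hx : x ∈ Q)
    (hx' : sg σ x ∈ Q) (y : 𝓞 k) (hy : algebraMap (𝓞 k) (𝓞 L) y = x * sg σ x)
    (hn : y ∉ (Q.comap (algebraMap (𝓞 k) (𝓞 L))) ^ 2) : Ram k σ Q := by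
  apply q.trich' hQ h0 x hx hx'
  intro h
  apply hn
  apply q.mem_of_alg_mem
  rw [hy, Ideal.map_pow, pow_two]
  apply Ideal.mul_mem_mul h
  rw [← q.map_sg_map, q.mem_map_sg, q.sg_sg]
  exact h

end IsQuad

theorem exists_prime_mem {R S : Type*} [Field R] [NumberField R] [Field S] [NumberField S] [Algebra R S]
    (p : Ideal (𝓞 R)) (hp : p.IsPrime) (h0 : p ≠ 0) : ∃ Q : Ideal (𝓞 S), Q.IsPrime ∧ Q ≠ 0 ∧
      Q.comap (algebraMap (𝓞 R) (𝓞 S)) = p := by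
  have hle : (RingHom.ker (algebraMap (𝓞 R) (𝓞 S))) ≤ p := by
    rw [(RingHom.injective_iff_ker_eq_bot _).1 (algInj R S)]; exact bot_le
  obtain ⟨Q, h1, h2⟩ := Ideal.exists_ideal_over_prime_of_isIntegral_of_isDomain (S := 𝓞 S) p hle
  refine ⟨Q, h1, ?_, h2⟩
  rintro rfl
  apply h0
  refine h2.symm.trans (le_antisymm ?_ bot_le)
  intro x hx
  rw [Ideal.mem_comap] at hx
  exact algInj R S (by simpa using hx)

/-- A CM layer `K = F(√-D)` over a real field. -/
structure Layer (F : Type*) {K : Type*} [Field F] [Field K] [NumberField F]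
    [NumberField K] [Algebra F K] (τ : K →+* K) (c : 𝓞 F) (θ : 𝓞 K) (D : ℕ) : Prop where
  fd : FD F c
  q : IsQuad F τ (θ : K)
  hθ : θ ^ 2 = -(D : 𝓞 K)

namespace Layer
variable {F K : Type*} [Field F] [Field K] [NumberField F] [NumberField K] [Algebra F K]
  {τ : K →+* K} {c : 𝓞 F} {θ : 𝓞 K} {D : ℕ} (s : Layer F τ c θ D)
include s

theorem sgt : sg τ θ = -θ := by
  apply RingOfIntegers.ext
  simpa using s.q.conj

theorem hθK : (θ : K) ^ 2 = -(D : K) := by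
  have := congrArg (fun t : 𝓞 K => (t : K)) s.hθ
  simpa only [ic_pow, ic_neg, ic_nat] using this

theorem D_ne : D ≠ 0 := by
  intro h
  have := s.hθK
  rw [h] at this
  exact s.q.ne (by simpa using this)

theorem cm (φ : K →+* ℂ) (x : K) : φ (τ x) = starRingEnd ℂ (φ x) := by
  obtain ⟨u, v, rfl⟩ := s.q.span x
  obtain ⟨a, ha⟩ := s.fd.tr (φ.comp (algebraMap F K)) u
  obtain ⟨b, hb⟩ := s.fd.tr (φ.comp (algebraMap F K)) v
  rw [RingHom.comp_apply] at ha hb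
  have h1 : (φ θ) ^ 2 = (Complex.I * (Real.sqrt D : ℝ)) ^ 2 := by
    rw [mul_pow, Complex.I_sq, ← Complex.ofReal_pow, Real.sq_sqrt (Nat.cast_nonneg _), ← map_pow,
      s.hθK]
    simp
  have h2 : starRingEnd ℂ (φ θ) = -φ θ := by
    rcases sq_eq_sq_iff_eq_or_eq_neg.1 h1 with h | h <;> rw [h] <;> simp
  simp only [map_add, map_mul, s.q.fix, s.q.conj, ha, hb, Complex.conj_ofReal, h2, map_neg]

theorem norm_pos (z : K) (hz : z ≠ 0) : TotPos (z * τ z) := by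
  intro φ
  refine ⟨Complex.normSq (φ z), ?_, ?_⟩
  · rw [Complex.normSq_pos]; simpa using hz
  · rw [map_mul, s.cm, Complex.mul_conj]

/-- no unit is anti-invariant if some odd prime ramifies -/
theorem no_anti (Q : Ideal (𝓞 K)) (hR : IsQuad.Ram F τ Q) (h2 : (2 : 𝓞 K) ∉ Q) (v : (𝓞 K)ˣ) :
    sg τ v ≠ -(v : 𝓞 K) := by
  intro h
  have h1 := hR.diff v
  rw [h, sub_neg_eq_add, ← two_mul] at h1
  rcases hR.prime.mem_or_mem h1 with h3 | h3
  · exact h2 h3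
  · exact hR.prime.ne_top (Ideal.eq_top_of_isUnit_mem _ h3 v.isUnit)

theorem unit_odd (Q : Ideal (𝓞 K)) (hR : IsQuad.Ram F τ Q) (h2 : (2 : 𝓞 K) ∉ Q) (u : (𝓞 K)ˣ) :
    ∃ m : ℕ, Odd m ∧ ∃ ε : (𝓞 F)ˣ, algebraMap (𝓞 F) (𝓞 K) ε = (u : 𝓞 K) ^ m := by
  have hno := s.no_anti Q hR h2
  set T : (𝓞 K)ˣ →* (𝓞 K)ˣ := Units.map (sg τ).toMonoidHom with hT
  have hTv : ∀ v : (𝓞 K)ˣ, ((T v : (𝓞 K)ˣ) : 𝓞 K) = sg τ v := fun v => rfl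
  have hno' : ∀ v : (𝓞 K)ˣ, T v ≠ -v := fun v h => hno v (by
    rw [← hTv, h, Units.val_neg])
  set ζ : (𝓞 K)ˣ := u * (T u)⁻¹ with hζ
  have hTT : ∀ v, T (T v) = v := fun v => Units.ext (by rw [hTv, hTv, s.q.sg_sg])
  have hTζ : T ζ = ζ⁻¹ := by rw [hζ, map_mul, map_inv, hTT, mul_inv_rev, inv_inv]
  have hfin : ∃ n, 0 < n ∧ ζ ^ n = 1 := by
    have hintg : IsIntegral ℤ (((ζ : (𝓞 K)ˣ) : 𝓞 K) : K) := (ζ : 𝓞 K).isIntegral_coe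
    obtain ⟨n, hn, h⟩ := Embeddings.pow_eq_one_of_norm_eq_one K ℂ hintg (fun φ => by
      have hz : ((ζ : 𝓞 K) : K) * τ ((ζ : 𝓞 K) : K) = 1 := by
        have : (ζ : 𝓞 K) * sg τ (ζ : 𝓞 K) = 1 := by
          rw [← hTv, hTζ]; simp
        have h3 := congrArg (fun t : 𝓞 K => (t : K)) this
        simpa using h3
      have h4 : Complex.normSq (φ ((ζ : 𝓞 K) : K)) = 1 := by
        have := congrArg φ hz
        rw [map_mul, s.cm, Complex.mul_conj, map_one] at this
        exact_mod_cast this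
      have h5 : ‖φ ((ζ : 𝓞 K) : K)‖ ^ 2 = 1 := by rw [← Complex.normSq_eq_norm_sq, h4]
      have h6 := norm_nonneg (φ ((ζ : 𝓞 K) : K))
      nlinarith)
    refine ⟨n, hn, ?_⟩
    ext1
    apply RingOfIntegers.ext
    rw [Units.val_pow_eq_pow_val]
    exact (ic_pow _ _).trans h
  have key : ∀ v : (𝓞 K)ˣ, v ^ 2 = 1 → v = 1 ∨ v = -1 := by
    intro v hv
    have : (v : 𝓞 K) ^ 2 = 1 := by rw [← Units.val_pow_eq_pow_val, hv]; rfl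
    rcases (sq_eq_sq_iff_eq_or_eq_neg (a := (v : 𝓞 K)) (b := (1 : 𝓞 K))).1 (this.trans (one_pow 2).symm) with h | h
    · left; ext1; exact h
    · right; ext1; rw [h]; simp
  -- reduce the order
  have hred : ∃ m : ℕ, Odd m ∧ (ζ ^ m) ^ 2 = 1 := by
    obtain ⟨n, hn, h⟩ := hfin
    obtain ⟨a, m, hm, rfl⟩ := Nat.exists_eq_two_pow_mul_odd hn.ne'
    refine ⟨m, hm, ?_⟩
    have hTm : T (ζ ^ m) = (ζ ^ m)⁻¹ := by rw [map_pow, hTζ, inv_pow]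
    rw [mul_comm, pow_mul] at h
    generalize ζ ^ m = w at h hTm
    clear hm hn
    induction a with
    | zero => rw [pow_zero, pow_one] at h; rw [h, one_pow]
    | succ a ih =>
      rcases Nat.eq_zero_or_pos a with rfl | ha
      · simpa using h
      · rw [pow_succ, pow_mul] at h
        rcases key _ h with h1 | h1
        · exact ih h1
        · exfalso
          obtain ⟨b, rfl⟩ := Nat.exists_eq_succ_of_ne_zero ha.ne'
          rw [Nat.succ_eq_add_one, pow_succ, pow_mul] at h1
          apply hno' (w ^ 2 ^ b)
          rw [map_pow, hTm, inv_pow]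
          rw [inv_eq_iff_mul_eq_one, mul_neg, ← pow_two, h1, neg_neg]
  obtain ⟨m, hm, h⟩ := hred
  refine ⟨m, hm, ?_⟩
  rw [← Units.val_pow_eq_pow_val]
  apply s.q.unit_of_fixed
  rcases key _ h with h1 | h1
  · rw [← hTv]
    congr 1
    rw [hζ, mul_pow, inv_pow, mul_inv_eq_one] at h1
    rw [map_pow]; exact h1.symm
  · exfalso
    apply hno' (u ^ m)
    rw [hζ, mul_pow, inv_pow, mul_inv_eq_iff_eq_mul] at h1
    rw [map_pow, h1]; simp

theorem hU (ε : (𝓞 F)ˣ) (h : ∃ z : K, z * τ z = algebraMap F K ((ε : 𝓞 F) : F)) :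
    ∃ v : (𝓞 K)ˣ, (v : 𝓞 K) * sg τ v = algebraMap (𝓞 F) (𝓞 K) ε := by
  obtain ⟨z, hz⟩ := h
  have hz0 : z ≠ 0 := by
    rintro rfl
    rw [zero_mul] at hz
    have := hz.symm
    simp at this
  obtain ⟨v, rfl⟩ := s.fd.T ε (s.q.totPos_down (by rw [← hz]; exact s.norm_pos z hz0))
  refine ⟨Units.map (algebraMap (𝓞 F) (𝓞 K)).toMonoidHom v, ?_⟩
  simp only [RingHom.toMonoidHom_eq_coe, Units.coe_map, MonoidHom.coe_coe, s.q.sg_alg]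
  rw [Units.val_pow_eq_pow_val, map_pow, pow_two]

end Layer

open NumberField
open scoped nonZeroDivisors

namespace FD
variable {F : Type*} [Field F] [NumberField F] {c : 𝓞 F} (s : FD F c)
include s

theorem prime2 : (Ideal.span {2 + c}).IsPrime := by
  apply Ideal.isPrime_of_irreducible_absNorm
  rw [s.n2p]; exact Nat.prime_two

theorem two_mem : (2 : 𝓞 F) ∈ Ideal.span {2 + c} := by
  have := Ideal.absNorm_mem (Ideal.span {2 + c})
  rw [s.n2p] at this
  exact_mod_cast this

theorem ne2 : (2 + c : 𝓞 F) ≠ 0 := by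
  intro h
  have := s.n2p
  rw [h] at this
  simp at this

theorem span2_ne : (Ideal.span {2 + c} : Ideal (𝓞 F)) ≠ 0 := by simpa using s.ne2

theorem eq_span2 (Q : Ideal (𝓞 F)) (hQ : Q.IsPrime) (h : (2 : 𝓞 F) ∈ Q) : Q = Ideal.span {2 + c} := by
  have h1 : Ideal.span {2 + c} ≤ Q :=
    (Ideal.span_singleton_le_iff_mem _).2 (Q.add_mem h (s.p2 Q hQ h))
  exact ((s.prime2.isMaximal s.span2_ne).eq_of_le hQ.ne_top h1).symm

end FD

theorem prime_eq_of_sq {R : Type*} [CommRing R] {P Q : Ideal R} (hP : P.IsPrime) (hQ : Q.IsPrime)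
    (h : P ^ 2 = Q ^ 2) : P = Q := by
  apply le_antisymm
  · have : P ^ 2 ≤ Q := by rw [h]; exact Ideal.pow_le_self two_ne_zero
    exact hQ.le_of_pow_le this
  · have : Q ^ 2 ≤ P := by rw [← h]; exact Ideal.pow_le_self two_ne_zero
    exact hP.le_of_pow_le this

/-- the prime above two -/
structure Two (F : Type*) {K : Type*} [Field F] [Field K] [NumberField F]
    [NumberField K] [Algebra F K] (τ : K →+* K) (c : 𝓞 F) (l : Ideal (𝓞 K)) : Prop where
  ram : IsQuad.Ram F τ l
  sq2 : l ^ 2 = Ideal.span {algebraMap (𝓞 F) (𝓞 K) (2 + c)}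
  uniq : ∀ Q : Ideal (𝓞 K), Q.IsPrime → (2 : 𝓞 K) ∈ Q → Q = l

namespace Layer
variable {F K : Type*} [Field F] [Field K] [NumberField F] [NumberField K] [Algebra F K]
  {τ : K →+* K} {c : 𝓞 F} {θ : 𝓞 K} {D : ℕ} (s : Layer F τ c θ D)
include s

theorem exists_two (x : 𝓞 K) (t m : 𝓞 F)
    (hn : algebraMap (𝓞 F) (𝓞 K) ((2 + c) * m) = x * sg τ x)
    (ht : algebraMap (𝓞 F) (𝓞 K) ((2 + c) * t) = x + sg τ x)
    (hm : m ∉ Ideal.span {2 + c}) : ∃ l, Two F τ c l := by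
  have key : ∀ Q : Ideal (𝓞 K), Q.IsPrime → (2 : 𝓞 K) ∈ Q → IsQuad.Ram F τ Q ∧
      Q ^ 2 = Ideal.span {algebraMap (𝓞 F) (𝓞 K) (2 + c)} := by
    intro Q hQ h2
    have hQ0 : Q ≠ 0 := by
      rintro rfl
      exact two_ne_zero (Ideal.mem_bot.1 h2)
    have hcm : Q.comap (algebraMap (𝓞 F) (𝓞 K)) = Ideal.span {2 + c} := by
      apply s.fd.eq_span2
      · exact Ideal.IsPrime.comap _
      · rw [Ideal.mem_comap, map_ofNat]; exact h2
    have hc : algebraMap (𝓞 F) (𝓞 K) (2 + c) ∈ Q := by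
      rw [← Ideal.mem_comap, hcm]; exact Ideal.mem_span_singleton_self _
    have h3 : x * sg τ x ∈ Q := by rw [← hn, map_mul]; exact Q.mul_mem_right _ hc
    have h4 : x + sg τ x ∈ Q := by rw [← ht, map_mul]; exact Q.mul_mem_right _ hc
    have h5 : x ∈ Q ∧ sg τ x ∈ Q := by
      rcases hQ.mem_or_mem h3 with h | h
      · exact ⟨h, (Q.add_mem_iff_right h).1 h4⟩
      · exact ⟨(Q.add_mem_iff_left h).1 h4, h⟩
    have hR := s.q.ram_of_mem hQ hQ0 x h5.1 h5.2 _ hn (by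
      rw [hcm, Ideal.span_singleton_pow, Ideal.mem_span_singleton, pow_two]
      intro h
      exact hm (Ideal.mem_span_singleton.2 ((mul_dvd_mul_iff_left s.fd.ne2).1 h)))
    refine ⟨hR, ?_⟩
    rw [← hR.sq, hcm, Ideal.map_span, Set.image_singleton]
  obtain ⟨Q, hQ, hQ0, hQc⟩ := exists_prime_mem (S := K) _ s.fd.prime2 s.fd.span2_ne
  have h2 : (2 : 𝓞 K) ∈ Q := by
    have := s.fd.two_mem
    rw [← hQc, Ideal.mem_comap, map_ofNat] at this
    exact this
  refine ⟨Q, (key Q hQ h2).1, (key Q hQ h2).2, fun P hP hP2 => ?_⟩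
  exact prime_eq_of_sq hP hQ ((key P hP hP2).2.trans (key Q hQ h2).2.symm)

theorem norm_form (X Y : F) : (algebraMap F K X + algebraMap F K Y * θ) *
    τ (algebraMap F K X + algebraMap F K Y * θ) = algebraMap F K (X ^ 2 + D * Y ^ 2) := by
  have h := s.hθK
  simp only [map_add, map_mul, s.q.fix, s.q.conj, map_pow, map_natCast]
  linear_combination -(algebraMap F K Y) ^ 2 * h

/-- the class of the prime over two is not a square -/
theorem l_nsq {l : Ideal (𝓞 K)} (hl : Two F τ c l)
    (hn : ∀ X Y : F, 2 + (c : F) ≠ X ^ 2 + D * Y ^ 2) (g : ClassGroup (𝓞 K)) : cl l ≠ g ^ 2 := by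
  intro h
  obtain ⟨I, hI, rfl⟩ := cl_surj g
  rw [← cl_pow hI] at h
  obtain ⟨x, y, hx, hy, hxy⟩ := (cl_eq_iff hl.ram.ne (pow_ne_zero 2 hI)).1 h
  obtain ⟨a, ha⟩ := s.q.norm_ideal I
  obtain ⟨nx, hnx⟩ := s.q.norm_mem_int x
  obtain ⟨ny, hny⟩ := s.q.norm_mem_int y
  have hsg : ∀ z : 𝓞 K, z ≠ 0 → sg τ z ≠ 0 := fun z hz h => hz (sg_inj τ (by rw [h, map_zero]))
  have hnx0 : nx ≠ 0 := by
    rintro rfl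
    rw [map_zero] at hnx
    rcases mul_eq_zero.1 hnx.symm with h | h
    · exact hx h
    · exact hsg x hx h
  have hny0 : ny ≠ 0 := by
    rintro rfl
    rw [map_zero] at hny
    rcases mul_eq_zero.1 hny.symm with h | h
    · exact hy h
    · exact hsg y hy h
  have e1 : Ideal.span {nx * (2 + c)} = Ideal.span {ny} * a ^ 2 := by
    apply s.q.map_inj
    rw [Ideal.map_mul, Ideal.map_pow, ← ha, Ideal.map_span, Ideal.map_span, Set.image_singleton,
      Set.image_singleton, map_mul, hnx, hny, ← Ideal.span_singleton_mul_span_singleton,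
      ← Ideal.span_singleton_mul_span_singleton, ← Ideal.span_singleton_mul_span_singleton, ← hl.sq2]
    have e2 := congrArg (Ideal.map (sg τ)) hxy
    rw [Ideal.map_mul, Ideal.map_mul, Ideal.map_span, Ideal.map_span, Set.image_singleton,
      Set.image_singleton, hl.ram.fixed, Ideal.map_pow] at e2
    calc _ = (Ideal.span {x} * l) * (Ideal.span {sg τ x} * l) := by ring
      _ = _ := by rw [hxy, e2]; ring
  have ha0 : a ≠ 0 := by
    rintro rfl
    rw [zero_pow two_ne_zero, mul_zero] at e1
    have : nx * (2 + c) = 0 := Ideal.span_singleton_eq_bot.1 e1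
    rcases mul_eq_zero.1 this with h | h
    · exact hnx0 h
    · exact s.fd.ne2 h
  obtain ⟨b, hb0, hb⟩ := cl_pow_card_span ha0
  obtain ⟨m, hm⟩ := s.fd.hodd
  set N := Nat.card (ClassGroup (𝓞 F)) with hN
  have e3 : Ideal.span {(nx * (2 + c)) ^ N} = Ideal.span {ny ^ N * b ^ 2} := by
    rw [← Ideal.span_singleton_pow, e1, mul_pow, ← pow_mul, mul_comm 2 N, pow_mul, hb,
      Ideal.span_singleton_pow, Ideal.span_singleton_pow, Ideal.span_singleton_mul_span_singleton]
  obtain ⟨u, hu⟩ := Ideal.span_singleton_eq_span_singleton.1 e3.symm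
  -- positivity
  have hnxp : TotPos (nx : F) := s.q.totPos_down (by
    rw [← coe_alg, hnx, ic_mul, coe_sg]
    exact s.norm_pos _ (by simpa using hx))
  have hnyp : TotPos (ny : F) := s.q.totPos_down (by
    rw [← coe_alg, hny, ic_mul, coe_sg]
    exact s.norm_pos _ (by simpa using hy))
  have huF : ((ny : F) ^ N * (b : F) ^ 2) * ((u : 𝓞 F) : F) = ((nx : F) * (2 + (c : F))) ^ N := by
    have := congrArg (fun t : 𝓞 F => (t : F)) hu
    simpa only [ic_mul, ic_pow, ic_add, ic_two] using this
  have hnxF : (nx : F) ≠ 0 := by simpa using hnx0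
  have hnyF : (ny : F) ≠ 0 := by simpa using hny0
  have hbF : (b : F) ≠ 0 := by simpa using hb0
  have hup : TotPos ((u : 𝓞 F) : F) := by
    have h1 : TotPos (((nx : F) * (2 + (c : F))) ^ N) := (hnxp.mul s.fd.pos).pow N
    have h2 : TotPos ((ny : F) ^ N * (b : F) ^ 2) := (hnyp.pow N).mul (s.fd.tr.sq_pos hbF)
    intro φ
    obtain ⟨r1, h1', h1''⟩ := h1 φ
    obtain ⟨r2, h2', h2''⟩ := h2 φ
    refine ⟨r1 / r2, div_pos h1' h2', ?_⟩
    rw [← huF, map_mul, h2''] at h1''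
    have : (r2 : ℂ) ≠ 0 := by exact_mod_cast h2'.ne'
    push_cast
    rw [← h1'']; field_simp
  obtain ⟨v, rfl⟩ := s.fd.T u hup
  have hc2 : 2 + (c : F) ≠ 0 := by
    intro h
    apply s.fd.ne2
    apply RingOfIntegers.ext
    rw [ic_add, ic_two, h, ic_zero]
  -- the rational multiplier
  set M : F := (ny : F) ^ m * (b : F) * ((v : 𝓞 F) : F) / ((nx : F) ^ m * (2 + (c : F)) ^ m * nx) with hM
  have e4 : 2 + (c : F) = M ^ 2 * ny * nx := by
    rw [hM, div_pow]
    field_simp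
    rw [Units.val_pow_eq_pow_val, ic_pow, hm] at huF
    have : ((nx : F) ^ m) ^ 2 * ((2 + (c : F)) ^ m) ^ 2 * nx * (2 + (c : F)) =
        ((ny : F) ^ m) ^ 2 * (b : F) ^ 2 * ((v : 𝓞 F) : F) ^ 2 * ny := by
      calc _ = ((nx : F) * (2 + (c : F))) ^ (2 * m + 1) := by rw [mul_pow]; ring
        _ = _ := by rw [← huF]; ring
    linear_combination this
  obtain ⟨X, Y, hXY⟩ := s.q.span (algebraMap F K M * (y : K) * (x : K))
  apply hn X Y
  apply (algebraMap F K).injective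
  rw [← s.norm_form, ← hXY, map_mul, map_mul, s.q.fix, e4]
  have h1 := congrArg (fun t : 𝓞 K => (t : K)) hnx
  have h2 := congrArg (fun t : 𝓞 K => (t : K)) hny
  simp only [coe_alg, ic_mul, coe_sg] at h1 h2
  simp only [map_mul, map_pow, h1, h2]
  ring

/-- two torsion of the class group -/
theorem tors (l a : ClassGroup (𝓞 K)) (hl : l ^ 2 = 1)
    (ha : (a ^ Nat.card (ClassGroup (𝓞 F))) ^ 2 = 1)
    (hR : ∀ Q, IsQuad.Ram F τ Q → cl Q = l ∨ cl Q = a ∨ cl Q = a⁻¹) (x : ClassGroup (𝓞 K))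
    (hx : x ^ 2 = 1) : ∃ i j : ℤ, x = l ^ i * (a ^ Nat.card (ClassGroup (𝓞 F))) ^ j := by
  set h := Nat.card (ClassGroup (𝓞 F)) with hh
  let S : Subgroup (ClassGroup (𝓞 K)) := (Subgroup.zpowers l ⊔ Subgroup.zpowers (a ^ h)).comap
    (powMonoidHom h)
  have hodd : ∀ y : ClassGroup (𝓞 K), y ^ 2 = 1 → y ^ h = y := by
    intro y hy
    obtain ⟨m, hm⟩ := s.fd.hodd
    rw [← hh] at hm
    rw [hm, pow_succ, pow_mul, hy, one_pow, one_mul]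
  have hmem : x ∈ S := by
    refine s.q.two_tors_mem s.fd.hodd s.hU S ?_ ?_ x hx
    · intro c
      rw [Subgroup.mem_comap, powMonoidHom_apply, ← map_pow, pow_card_eq_one', map_one]
      exact one_mem _
    · intro Q hQ
      rw [Subgroup.mem_comap, powMonoidHom_apply]
      rcases hR Q hQ with h1 | h1 | h1 <;> rw [h1]
      · rw [hodd l hl]; exact Subgroup.mem_sup_left (Subgroup.mem_zpowers l)
      · exact Subgroup.mem_sup_right (Subgroup.mem_zpowers _)
      · rw [inv_pow]
        exact inv_mem (Subgroup.mem_sup_right (Subgroup.mem_zpowers _))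
  rw [Subgroup.mem_comap, powMonoidHom_apply, hodd x hx] at hmem
  obtain ⟨y, hy, z, hz, rfl⟩ := Subgroup.mem_sup.1 hmem
  obtain ⟨i, rfl⟩ := Subgroup.mem_zpowers_iff.1 hy
  obtain ⟨j, rfl⟩ := Subgroup.mem_zpowers_iff.1 hz
  exact ⟨i, j, rfl⟩

end Layer

open NumberField
open scoped nonZeroDivisors

/-- the odd ramified primes -/
structure Odds (F : Type*) {K : Type*} [Field F] [Field K] [NumberField F]
    [NumberField K] [Algebra F K] (τ : K →+* K) (l Q₁ Q₂ : Ideal (𝓞 K)) : Prop where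
  r1 : IsQuad.Ram F τ Q₁
  two1 : (2 : 𝓞 K) ∉ Q₁
  r2 : IsQuad.Ram F τ Q₂
  prin : cl Q₁ * cl Q₂ = 1
  all : ∀ Q, IsQuad.Ram F τ Q → Q = l ∨ Q = Q₁ ∨ Q = Q₂

namespace Layer
variable {F K : Type*} [Field F] [Field K] [NumberField F] [NumberField K] [Algebra F K]
  {τ : K →+* K} {c : 𝓞 F} {θ : 𝓞 K} {D : ℕ} (s : Layer F τ c θ D)
include s

theorem alg_D : algebraMap (𝓞 F) (𝓞 K) (D : 𝓞 F) = θ * sg τ θ := by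
  rw [s.sgt, map_natCast]
  linear_combination s.hθ

theorem exists_odds {l : Ideal (𝓞 K)} (hl : Two F τ c l) (p₁ p₂ : Ideal (𝓞 F)) (h1 : PP c p₁)
    (h2 : PP c p₂) (hne : p₁ ≠ p₂) (hD : Ideal.span {(D : 𝓞 F)} = p₁ * p₂) :
    ∃ Q₁ Q₂, Odds F τ l Q₁ Q₂ := by
  have hm1 := h1.prime.isMaximal h1.ne
  have hm2 := h2.prime.isMaximal h2.ne
  -- a general construction
  have key : ∀ p p' : Ideal (𝓞 F), PP c p → PP c p' → p ≠ p' → Ideal.span {(D : 𝓞 F)} = p * p' →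
      (D : 𝓞 F) ∈ p ∧ (D : 𝓞 F) ∉ p ^ 2 := by
    intro p p' hp hp' hne hD
    refine ⟨?_, ?_⟩
    · have : Ideal.span {(D : 𝓞 F)} ≤ p := by rw [hD]; exact Ideal.mul_le_left (I := p) (J := p')
      exact this (Ideal.mem_span_singleton_self _)
    · intro h
      rw [← Ideal.span_singleton_le_iff_mem, hD, ← Ideal.dvd_iff_le, pow_two] at h
      rw [mul_dvd_mul_iff_left hp.ne, Ideal.dvd_iff_le] at h
      exact hne ((hp'.prime.isMaximal hp'.ne).eq_of_le hp.prime.ne_top h).symm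
  have hex : ∀ p p' : Ideal (𝓞 F), PP c p → PP c p' → p ≠ p' → Ideal.span {(D : 𝓞 F)} = p * p' →
      ∀ Q : Ideal (𝓞 K), Q.IsPrime → Q.comap (algebraMap (𝓞 F) (𝓞 K)) = p →
        IsQuad.Ram F τ Q ∧ p.map (algebraMap (𝓞 F) (𝓞 K)) = Q ^ 2 := by
    intro p p' hp hp' hne hD Q hQ hQc
    have hQ0 : Q ≠ 0 := by
      rintro rfl
      apply hp.ne
      refine hQc.symm.trans (le_antisymm ?_ bot_le)
      intro x hx
      rw [Ideal.mem_comap] at hx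
      exact algInj F K (by simpa using hx)
    obtain ⟨k1, k2⟩ := key p p' hp hp' hne hD
    have hDQ : algebraMap (𝓞 F) (𝓞 K) (D : 𝓞 F) ∈ Q := by
      rw [← Ideal.mem_comap, hQc]; exact k1
    have hθ : θ ∈ Q := by
      rw [s.alg_D, s.sgt] at hDQ
      rcases hQ.mem_or_mem hDQ with h | h
      · exact h
      · exact (Q.neg_mem_iff).1 h
    have hR := s.q.ram_of_mem hQ hQ0 θ hθ (by rw [s.sgt]; exact Q.neg_mem hθ) _ s.alg_D (by
      rw [hQc]; exact k2)
    exact ⟨hR, by rw [← hR.sq, hQc]⟩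
  obtain ⟨Q₁, hQ₁, -, hc1⟩ := exists_prime_mem (S := K) p₁ h1.prime h1.ne
  obtain ⟨Q₂, hQ₂, -, hc2⟩ := exists_prime_mem (S := K) p₂ h2.prime h2.ne
  have hD' : Ideal.span {(D : 𝓞 F)} = p₂ * p₁ := by rw [hD, mul_comm]
  obtain ⟨r1, e1⟩ := hex p₁ p₂ h1 h2 hne hD Q₁ hQ₁ hc1
  obtain ⟨r2, e2⟩ := hex p₂ p₁ h2 h1 hne.symm hD' Q₂ hQ₂ hc2
  refine ⟨Q₁, Q₂, r1, ?_, r2, ?_, ?_⟩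
  · intro h
    apply h1.two
    rw [← hc1, Ideal.mem_comap, map_ofNat]; exact h
  · have : Q₁ * Q₂ = Ideal.span {θ} := by
      apply pow_left_injective two_ne_zero
      change (Q₁ * Q₂) ^ 2 = Ideal.span {θ} ^ 2
      rw [mul_pow, ← e1, ← e2, ← Ideal.map_mul, ← hD, Ideal.map_span, Set.image_singleton, s.alg_D,
        s.sgt, Ideal.span_singleton_pow, mul_neg, Ideal.span_singleton_neg, pow_two]
    rw [← cl_mul r1.ne r2.ne, this, cl_span]
  · intro Q hQ
    have h3 := hQ.diff θ
    rw [s.sgt, sub_neg_eq_add, ← two_mul] at h3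
    rcases hQ.prime.mem_or_mem h3 with h | h
    · left; exact hl.uniq Q hQ.prime h
    right
    have hDQ : (D : 𝓞 F) ∈ Q.comap (algebraMap (𝓞 F) (𝓞 K)) := by
      rw [Ideal.mem_comap, s.alg_D]; exact Q.mul_mem_right _ h
    have hcp : (Q.comap (algebraMap (𝓞 F) (𝓞 K))).IsPrime := by
      haveI := hQ.prime; exact Ideal.IsPrime.comap _
    rw [← Ideal.span_singleton_le_iff_mem, hD] at hDQ
    rcases hcp.mul_le.1 hDQ with h4 | h4
    · left
      have h5 := hm1.eq_of_le hcp.ne_top h4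
      apply prime_eq_of_sq hQ.prime hQ₁
      rw [← (hex p₁ p₂ h1 h2 hne hD Q hQ.prime h5.symm).2, e1]
    · right
      have h5 := hm2.eq_of_le hcp.ne_top h4
      apply prime_eq_of_sq hQ.prime hQ₂
      rw [← (hex p₂ p₁ h2 h1 hne.symm hD' Q hQ.prime h5.symm).2, e2]

theorem l_sq {l : Ideal (𝓞 K)} (hl : Two F τ c l) : cl l ^ 2 = 1 := by
  rw [← cl_pow hl.ram.ne, hl.sq2, cl_span]

theorem ram_pow {Q : Ideal (𝓞 K)} (hQ : IsQuad.Ram F τ Q) :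
    (cl Q ^ Nat.card (ClassGroup (𝓞 F))) ^ 2 = 1 := by
  rw [← pow_mul, mul_comm, pow_mul, ← cl_pow hQ.ne, ← hQ.sq, ← clMap_cl _ (algInj F K), ← map_pow,
    pow_card_eq_one', map_one]

theorem tors_card {l Q₁ Q₂ : Ideal (𝓞 K)} (hl : Two F τ c l) (ho : Odds F τ l Q₁ Q₂) :
    Nat.card (powMonoidHom 2 : ClassGroup (𝓞 K) →* ClassGroup (𝓞 K)).ker ≤ 4 := by
  set h := Nat.card (ClassGroup (𝓞 F)) with hh
  have h1 := s.tors (cl l) (cl Q₁) (s.l_sq hl) (s.ram_pow ho.r1) (by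
    intro Q hQ
    rcases ho.all Q hQ with rfl | rfl | rfl
    · left; rfl
    · right; left; rfl
    · right; right; rw [eq_inv_iff_mul_eq_one, mul_comm]; exact ho.prin)
  have hl2 := s.l_sq hl
  have ha2 := s.ram_pow ho.r1
  generalize cl Q₁ ^ Nat.card (ClassGroup (𝓞 F)) = a at h1 ha2
  generalize cl l = b at h1 hl2
  have hp : ∀ y : ClassGroup (𝓞 K), y ^ 2 = 1 → ∀ i : ℤ, y ^ i = 1 ∨ y ^ i = y := by
    intro y hy i
    have hy' : y ^ (2 : ℤ) = 1 := by exact_mod_cast hy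
    rcases Int.even_or_odd' i with ⟨k, rfl | rfl⟩
    · left; rw [zpow_mul, hy', one_zpow]
    · right; rw [zpow_add, zpow_mul, hy', one_zpow, one_mul, zpow_one]
  have hsub : ((powMonoidHom 2 : ClassGroup (𝓞 K) →* ClassGroup (𝓞 K)).ker : Set (ClassGroup (𝓞 K)))
      ⊆ ({1, a, b, b * a} : Set (ClassGroup (𝓞 K))) := by
    intro x hx
    have hx' : x ^ 2 = 1 := hx
    obtain ⟨i, j, rfl⟩ := h1 x hx'
    rcases hp b hl2 i with h3 | h3 <;> rcases hp a ha2 j with h4 | h4 <;> rw [h3, h4] <;> simp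
  have hfin : ({1, a, b, b * a} : Set (ClassGroup (𝓞 K))).Finite := Set.toFinite _
  have h5 := Set.ncard_le_ncard hsub hfin
  have h6 : ({1, a, b, b * a} : Set (ClassGroup (𝓞 K))).ncard ≤ 4 := by
    classical
    have : ({1, a, b, b * a} : Set (ClassGroup (𝓞 K))) = (({1, a, b, b * a} : Finset _) : Set _) := by simp
    rw [this, Set.ncard_coe_finset]
    exact Finset.card_le_four
  exact (Nat.card_coe_set_eq _).le.trans (h5.trans h6)

end Layer

open NumberField
open scoped nonZeroDivisors

section groups
variable {G H : Type*} [CommGroup G] [Finite G] [CommGroup H] [Finite H]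

theorem pc_odd (G : Type*) [CommGroup G] [Finite G] :
    ∃ k : ℕ, Odd k ∧ ∀ x : G, x ^ k ∈ CommGroup.primaryComponent G 2 := by
  obtain ⟨a, m, hm, h⟩ := Nat.exists_eq_two_pow_mul_odd (Nat.card_pos (α := G)).ne'
  refine ⟨m, hm, fun x => ⟨a, ?_⟩⟩
  rw [← pow_mul, mul_comm, ← h, pow_card_eq_one']

theorem pc_inv {a : G} (ha : a ∈ CommGroup.primaryComponent G 2) {k : ℕ} (hk : Odd k) :
    ∃ k' : ℕ, a ^ (k * k') = a := by
  obtain ⟨s, hs⟩ := ha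
  have hcop : Nat.Coprime k (2 ^ s) := Nat.Coprime.pow_right _ (Nat.coprime_two_right.2 hk)
  rcases Nat.eq_zero_or_pos s with rfl | hs0
  · refine ⟨1, ?_⟩
    rw [pow_zero, pow_one] at hs
    rw [hs, one_pow]
  obtain ⟨k', -, hk'⟩ := Nat.exists_mul_mod_eq_one_of_coprime hcop (Nat.one_lt_two_pow hs0.ne')
  refine ⟨k', ?_⟩
  rw [← Nat.div_add_mod (k * k') (2 ^ s), hk', pow_add, pow_mul, hs, one_pow, one_mul, pow_one]

theorem pc_eq_one {a : G} (ha : a ∈ CommGroup.primaryComponent G 2) {k : ℕ} (hk : Odd k)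
    (h : a ^ k = 1) : a = 1 := by
  obtain ⟨k', hk'⟩ := pc_inv ha hk
  rw [← hk', pow_mul, h, one_pow]

theorem pc_map (j : H →* G) {x : H} (hx : x ∈ CommGroup.primaryComponent H 2) :
    j x ∈ CommGroup.primaryComponent G 2 := by
  obtain ⟨s, hs⟩ := hx
  exact ⟨s, by rw [← map_pow, hs, map_one]⟩

theorem pc_ker (h4 : Nat.card (powMonoidHom 2 : G →* G).ker ≤ 4) :
    Nat.card (powMonoidHom 2 : CommGroup.primaryComponent G 2 →*
      CommGroup.primaryComponent G 2).ker ≤ 4 := by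
  refine le_trans ?_ h4
  refine Nat.card_le_card_of_injective (fun x => ⟨((x : CommGroup.primaryComponent G 2) : G), ?_⟩) ?_
  · have := x.2
    rw [MonoidHom.mem_ker, powMonoidHom_apply] at this ⊢
    exact_mod_cast congrArg (fun t : CommGroup.primaryComponent G 2 => (t : G)) this
  · intro x y h
    simp only [Subtype.mk.injEq] at h
    exact Subtype.ext (Subtype.ext h)

theorem pc_two {l : G} (hl2 : l ^ 2 = 1) : l ∈ CommGroup.primaryComponent G 2 :=
  ⟨1, by rw [pow_one]; exact hl2⟩

theorem grp_full (l : G) (hl2 : l ^ 2 = 1) (hl : ∀ x : G, l ≠ x ^ 2)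
    (h4 : Nat.card (powMonoidHom 2 : G →* G).ker ≤ 4) (j : H →* G)
    (hg : ∃ g : G, ∀ (x : G) (e : ℤ) (y : H), g ≠ x ^ 2 * l ^ e * j y)
    (σ : G →* G) (hσ : ∀ a, a * σ a ∈ j.range) (hσj : ∀ y, σ (j y) = j y) (hσl : σ l = l)
    (hlj : ∀ y ∈ CommGroup.primaryComponent H 2, l ≠ j y) (lX : H) (hlX2 : lX ^ 2 = 1) (hlX : lX ≠ 1)
    (hjX : j lX = 1)
    (hker : ∀ y, j y = 1 → ∃ m : ℕ, Odd m ∧ (y ^ m = 1 ∨ y ^ m = lX))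
    (h8 : 8 ≤ Nat.card (CommGroup.primaryComponent H 2)) :
    Nat.card (CommGroup.primaryComponent G 2) = 2 * Nat.card (CommGroup.primaryComponent H 2) := by
  classical
  let jA : CommGroup.primaryComponent H 2 →* CommGroup.primaryComponent G 2 :=
    (j.comp (CommGroup.primaryComponent H 2).subtype).codRestrict _ (fun x => pc_map j x.2)
  have hjA : ∀ x, ((jA x : CommGroup.primaryComponent G 2) : G) = j x := fun x => rfl
  let σA : CommGroup.primaryComponent G 2 →* CommGroup.primaryComponent G 2 :=
    (σ.comp (CommGroup.primaryComponent G 2).subtype).codRestrict _ (fun x => pc_map σ x.2)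
  have hσA : ∀ x, ((σA x : CommGroup.primaryComponent G 2) : G) = σ x := fun x => rfl
  have hkerc : Nat.card jA.ker = 2 := by
    rw [Nat.card_eq_two_iff]
    refine ⟨1, ⟨⟨lX, pc_two hlX2⟩, Subtype.ext (by rw [hjA]; exact hjX)⟩, ?_, ?_⟩
    · intro h
      apply hlX
      have := congrArg (fun t : jA.ker => ((t : CommGroup.primaryComponent H 2) : H)) h
      exact this.symm
    · ext ⟨⟨y, hy⟩, hy'⟩
      simp only [Set.mem_insert_iff, Set.mem_singleton_iff, Set.mem_univ, iff_true]
      have hjy : j y = 1 := by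
        have := congrArg (fun t : CommGroup.primaryComponent G 2 => (t : G)) (MonoidHom.mem_ker.1 hy')
        exact this
      obtain ⟨m, hm, h | h⟩ := hker y hjy
      · left
        exact Subtype.ext (Subtype.ext (pc_eq_one hy hm h))
      · right
        apply Subtype.ext; apply Subtype.ext
        change y = lX
        have h1 : (y ^ 2) ^ m = 1 := by rw [← pow_mul, mul_comm, pow_mul, h, hlX2]
        have h2 := pc_eq_one (pow_mem hy 2) hm h1
        obtain ⟨t, rfl⟩ := hm
        rw [← h, pow_succ, pow_mul, h2, one_pow, one_mul]
  have hcard : Nat.card (CommGroup.primaryComponent H 2) = 2 * Nat.card jA.range := by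
    rw [← Subgroup.card_mul_index jA.ker, hkerc, Subgroup.index_ker]
  have hlA : ∀ x : CommGroup.primaryComponent G 2, x ^ 2 ≠ ⟨l, pc_two hl2⟩ := by
    intro x h
    apply hl x
    have := congrArg (fun t : CommGroup.primaryComponent G 2 => (t : G)) h
    exact this.symm
  have := grp_step (A := CommGroup.primaryComponent G 2) CommGroup.primaryComponent.isPGroup
    ⟨l, pc_two hl2⟩ (Subtype.ext hl2) hlA (pc_ker h4) jA.range ?_ σA ?_ ?_ (Subtype.ext hσl) ?_ (by omega)
  · rw [this, hcard]; ring
  · obtain ⟨g, hg⟩ := hg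
    obtain ⟨k, ⟨t, rfl⟩, hk⟩ := pc_odd G
    refine ⟨⟨g ^ (2 * t + 1), hk g⟩, ?_⟩
    rintro x e _ ⟨y, rfl⟩ h
    have h1 : g ^ (2 * t + 1) = (x : G) ^ 2 * l ^ e * j y :=
      congrArg (fun t : CommGroup.primaryComponent G 2 => (t : G)) h
    apply hg ((g ^ t)⁻¹ * x) e y
    rw [mul_pow, inv_pow, mul_assoc, mul_assoc, ← mul_assoc ((x : G) ^ 2), ← h1, ← pow_mul, pow_succ,
      mul_comm t 2]
    group
  · intro a
    obtain ⟨y, hy⟩ := hσ a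
    obtain ⟨k, hk, hk'⟩ := pc_odd H
    obtain ⟨k', h⟩ := pc_inv (a * σA a).2 hk
    refine ⟨⟨y ^ (k * k'), by rw [pow_mul]; exact pow_mem (hk' y) k'⟩, ?_⟩
    apply Subtype.ext
    rw [hjA, map_pow, hy]
    exact h
  · rintro _ ⟨y, rfl⟩
    apply Subtype.ext
    rw [hσA, hjA, hσj]
  · rintro ⟨y, hy⟩
    have h1 : j y = l := congrArg (fun t : CommGroup.primaryComponent G 2 => (t : G)) hy
    exact hlj y y.2 h1.symm

theorem grp_iso' (l : G) (hl2 : l ^ 2 = 1) (hl : ∀ x : G, l ≠ x ^ 2)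
    (h4 : Nat.card (powMonoidHom 2 : G →* G).ker ≤ 4)
    (hg : ∃ g : G, ∀ (x : G) (e : ℤ), g ≠ x ^ 2 * l ^ e) (m : ℕ)
    (hm : Nat.card (CommGroup.primaryComponent G 2) = 2 ^ (m + 1)) :
    Nonempty (CommGroup.primaryComponent G 2 ≃* Multiplicative (ZMod 2 × ZMod (2 ^ m))) := by
  refine grp_iso CommGroup.primaryComponent.isPGroup ⟨l, pc_two hl2⟩ (Subtype.ext hl2) ?_ (pc_ker h4) ?_ m hm
  · intro x h
    apply hl x
    have := congrArg (fun t : CommGroup.primaryComponent G 2 => (t : G)) h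
    exact this.symm
  · obtain ⟨g, hg⟩ := hg
    obtain ⟨k, ⟨t, rfl⟩, hk⟩ := pc_odd G
    refine ⟨⟨g ^ (2 * t + 1), hk g⟩, ?_⟩
    intro x e h
    have h1 : g ^ (2 * t + 1) = (x : G) ^ 2 * l ^ e :=
      congrArg (fun t : CommGroup.primaryComponent G 2 => (t : G)) h
    apply hg ((g ^ t)⁻¹ * x) e
    rw [mul_pow, inv_pow, mul_assoc, ← h1, ← pow_mul, pow_succ, mul_comm t 2]
    group

end groups

open NumberField
open scoped nonZeroDivisors

/-- the biquadratic step -/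
structure AStep {F F' X L : Type*} [Field F] [NumberField F] [Field F'] [NumberField F'] [Field X]
    [NumberField X] [Field L] [NumberField L] [Algebra F F'] [Algebra F X] [Algebra F' L] [Algebra X L]
    (σ₀ : F' →+* F') (τX : X →+* X) (τ : L →+* L) (σ : L →+* L) (c : 𝓞 F) (c' : 𝓞 F')
    (θX : 𝓞 X) (θ : 𝓞 L) (DX D : ℕ) : Prop where
  st : FStep F σ₀ c c'
  lX : Layer F τX c θX DX
  lL : Layer F' τ c' θ D
  qs : IsQuad X σ (algebraMap F' L (c' : F'))
  comp : ∀ u : F, algebraMap X L (algebraMap F X u) = algebraMap F' L (algebraMap F F' u)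
  res : ∀ u : F', σ (algebraMap F' L u) = algebraMap F' L (σ₀ u)

namespace AStep
variable {F F' X L : Type*} [Field F] [NumberField F] [Field F'] [NumberField F'] [Field X]
    [NumberField X] [Field L] [NumberField L] [Algebra F F'] [Algebra F X] [Algebra F' L] [Algebra X L]
    {σ₀ : F' →+* F'} {τX : X →+* X} {τ : L →+* L} {σ : L →+* L} {c : 𝓞 F} {c' : 𝓞 F'}
    {θX : 𝓞 X} {θ : 𝓞 L} {DX D : ℕ} (s : AStep σ₀ τX τ σ c c' θX θ DX D)
include s

theorem compI (u : 𝓞 F) : algebraMap (𝓞 X) (𝓞 L) (algebraMap (𝓞 F) (𝓞 X) u) =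
    algebraMap (𝓞 F') (𝓞 L) (algebraMap (𝓞 F) (𝓞 F') u) := by
  apply RingOfIntegers.ext
  simp only [coe_alg]
  exact s.comp u

theorem resI (u : 𝓞 F') : sg σ (algebraMap (𝓞 F') (𝓞 L) u) = algebraMap (𝓞 F') (𝓞 L) (sg σ₀ u) := by
  apply RingOfIntegers.ext
  simp only [coe_alg, coe_sg]
  exact s.res u

theorem span_c' : (Ideal.span {c'} : Ideal (𝓞 F')) = Ideal.span {2 + c'} :=
  s.lL.fd.eq_span2 _ s.st.prime_c s.st.two_mem

theorem map_l {l : Ideal (𝓞 X)} (hl : Two F τX c l) :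
    l.map (algebraMap (𝓞 X) (𝓞 L)) = Ideal.span {algebraMap (𝓞 F') (𝓞 L) c'} := by
  apply pow_left_injective two_ne_zero
  change (l.map (algebraMap (𝓞 X) (𝓞 L))) ^ 2 = Ideal.span {algebraMap (𝓞 F') (𝓞 L) c'} ^ 2
  rw [← Ideal.map_pow, hl.sq2, Ideal.map_span, Set.image_singleton, s.compI, Ideal.span_singleton_pow,
    ← map_pow, s.st.hc]

theorem sq_l {l : Ideal (𝓞 L)} (hl : Two F' τ c' l) :
    l ^ 2 = Ideal.span {algebraMap (𝓞 F') (𝓞 L) c'} := by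
  rw [hl.sq2, ← Set.image_singleton, ← Ideal.map_span, ← s.span_c', Ideal.map_span, Set.image_singleton]

theorem fix_l {l : Ideal (𝓞 L)} (hl : Two F' τ c' l) : l.map (sg σ) = l := by
  apply hl.uniq
  · exact s.qs.isPrime_map_sg hl.ram.prime
  · rw [s.qs.mem_map_sg, map_ofNat]
    have h : algebraMap (𝓞 F') (𝓞 L) 2 ∈ l ^ 2 := by
      rw [hl.sq2, ← Set.image_singleton, ← Ideal.map_span]
      exact Ideal.mem_map_of_mem _ s.lL.fd.two_mem
    rw [map_ofNat] at h
    exact Ideal.pow_le_self two_ne_zero h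

/-- (6) -/
theorem l_range {l : Ideal (𝓞 X)} (hl : Two F τX c l) {l' : Ideal (𝓞 L)} (hl' : Two F' τ c' l')
    (y : ClassGroup (𝓞 X)) (h : cl l' = clMap (algebraMap (𝓞 X) (𝓞 L)) (algInj X L) y) :
    cl l = y ^ 2 := by
  obtain ⟨I, hI, rfl⟩ := cl_surj y
  have hI' := map_ne_zero_of_inj _ (algInj X L) hI
  rw [clMap_cl] at h
  obtain ⟨x, y, hx, hy, hxy⟩ := (cl_eq_iff hl'.ram.ne hI').1 h
  obtain ⟨nx, hnx⟩ := s.qs.norm_mem_int x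
  obtain ⟨ny, hny⟩ := s.qs.norm_mem_int y
  have hsg : ∀ z : 𝓞 L, z ≠ 0 → sg σ z ≠ 0 := fun z hz h => hz (sg_inj σ (by rw [h, map_zero]))
  have hnx0 : nx ≠ 0 := by
    rintro rfl
    rw [map_zero] at hnx
    rcases mul_eq_zero.1 hnx.symm with h | h
    · exact hx h
    · exact hsg x hx h
  have hny0 : ny ≠ 0 := by
    rintro rfl
    rw [map_zero] at hny
    rcases mul_eq_zero.1 hny.symm with h | h
    · exact hy h
    · exact hsg y hy h
  rw [← cl_pow hI, cl_eq_iff hl.ram.ne (pow_ne_zero 2 hI)]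
  refine ⟨nx, ny, hnx0, hny0, ?_⟩
  apply s.qs.map_inj
  have e2 := congrArg (Ideal.map (sg σ)) hxy
  rw [Ideal.map_mul, Ideal.map_mul, Ideal.map_span, Ideal.map_span, Set.image_singleton,
    Set.image_singleton, s.fix_l hl', s.qs.map_sg_map] at e2
  rw [Ideal.map_mul, Ideal.map_mul, s.map_l hl, ← s.sq_l hl', Ideal.map_span, Ideal.map_span,
    Set.image_singleton, Set.image_singleton, hnx, hny, Ideal.map_pow,
    ← Ideal.span_singleton_mul_span_singleton, ← Ideal.span_singleton_mul_span_singleton]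
  calc _ = (Ideal.span {x} * l') * (Ideal.span {sg σ x} * l') := by ring
    _ = _ := by rw [hxy, e2]; ring

/-- (5) -/
theorem ker_j {l : Ideal (𝓞 X)} (hl : Two F τX c l) (Q : Ideal (𝓞 L)) (hR : IsQuad.Ram F' τ Q)
    (h2 : (2 : 𝓞 L) ∉ Q)
    (y : ClassGroup (𝓞 X)) (h : clMap (algebraMap (𝓞 X) (𝓞 L)) (algInj X L) y = 1) :
    ∃ m : ℕ, Odd m ∧ (y ^ m = 1 ∨ y ^ m = cl l) := by
  obtain ⟨I, hI, rfl⟩ := cl_surj y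
  have hI' := map_ne_zero_of_inj _ (algInj X L) hI
  rw [clMap_cl, cl_eq_one_iff hI'] at h
  obtain ⟨β, hβ0, hβ⟩ := h
  have h1 : Ideal.span {β} = Ideal.span {sg σ β} := by
    have := s.qs.map_sg_map I
    rw [hβ, Ideal.map_span, Set.image_singleton] at this
    exact this.symm
  obtain ⟨u, hu⟩ := Ideal.span_singleton_eq_span_singleton.1 h1
  have huu : (u : 𝓞 L) * sg σ u = 1 := by
    have h3 := congrArg (sg σ) hu
    rw [map_mul, s.qs.sg_sg, ← hu, mul_assoc] at h3
    exact mul_left_cancel₀ hβ0 (h3.trans (mul_one β).symm)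
  obtain ⟨m, hm, ε, hε⟩ := s.lL.unit_odd Q hR h2 u
  have hεε : (ε : 𝓞 F') * sg σ₀ ε = 1 := by
    apply algInj F' L
    rw [map_mul, ← s.resI, hε, map_pow, ← mul_pow, huu, one_pow, map_one]
  obtain ⟨γ, hγ0, hγ⟩ := s.st.q.hilbert90_int ((ε : 𝓞 F') : F') (by
    have := congrArg (fun t : 𝓞 F' => (t : F')) hεε
    simpa only [ic_mul, coe_sg, ic_one] using this)
  have hγ' : (ε : 𝓞 F') * sg σ₀ γ = γ := by
    apply RingOfIntegers.ext
    rw [ic_mul, coe_sg]; exact hγ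
  have hinv : (Ideal.span {γ}).map (sg σ₀) = Ideal.span {γ} := by
    rw [Ideal.map_span, Set.image_singleton, Ideal.span_singleton_eq_span_singleton]
    exact ⟨ε, by rw [mul_comm]; exact hγ'⟩
  obtain ⟨α, hα0, i, hα⟩ := s.st.inv_span (Ideal.span {γ}) (by simpa using hγ0) hinv
  obtain ⟨y, hy⟩ := s.qs.of_fixed_int (β ^ m * algebraMap (𝓞 F') (𝓞 L) γ) (by
    rw [map_mul, map_pow, ← hu, s.resI, mul_pow, ← hε, mul_assoc, ← map_mul, hγ'])
  set h := Nat.card (ClassGroup (𝓞 F)) with hh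
  have hαX : algebraMap (𝓞 F) (𝓞 X) α ≠ 0 := fun h0 => hα0 (algInj F X (by rw [h0, map_zero]))
  have e : Ideal.span {y} ^ h = I ^ (m * h) * Ideal.span {algebraMap (𝓞 F) (𝓞 X) α} * l ^ i := by
    apply s.qs.map_inj
    rw [Ideal.map_mul, Ideal.map_mul, Ideal.map_pow, Ideal.map_pow, Ideal.map_pow, s.map_l hl, hβ,
      Ideal.map_span, Ideal.map_span, Set.image_singleton, Set.image_singleton, hy, s.compI]
    have e3 := congrArg (Ideal.map (algebraMap (𝓞 F') (𝓞 L))) hα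
    rw [Ideal.map_pow, Ideal.map_span, Ideal.map_span, Set.image_singleton, Set.image_singleton,
      map_mul, map_pow, ← Ideal.span_singleton_mul_span_singleton, ← Ideal.span_singleton_pow] at e3
    rw [← Ideal.span_singleton_mul_span_singleton, mul_pow, e3, ← Ideal.span_singleton_pow, ← pow_mul]
    ring
  have e' := congrArg cl e
  rw [Ideal.span_singleton_pow, cl_span, cl_mul (mul_ne_zero (pow_ne_zero _ hI) (by simpa using hαX))
    (pow_ne_zero _ hl.ram.ne), cl_mul (pow_ne_zero _ hI) (by simpa using hαX), cl_span, mul_one,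
    cl_pow hI, cl_pow hl.ram.ne] at e'
  refine ⟨m * h, hm.mul s.st.fd.hodd, ?_⟩
  have hl2 := s.lX.l_sq hl
  have e4 : cl I ^ (m * h) = (cl l ^ i)⁻¹ := eq_inv_of_mul_eq_one_left e'.symm
  have hlinv : (cl l)⁻¹ = cl l := by
    rw [inv_eq_iff_mul_eq_one, ← pow_two, hl2]
  rw [e4, ← inv_pow, hlinv]
  rcases Nat.even_or_odd' i with ⟨t, rfl | rfl⟩
  · left; rw [pow_mul, hl2, one_pow]
  · right; rw [pow_succ, pow_mul, hl2, one_pow, one_mul]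

theorem main {l : Ideal (𝓞 X)} (hl : Two F τX c l) {l' Q₁ Q₂ : Ideal (𝓞 L)} (hl' : Two F' τ c' l')
    (ho : Odds F' τ l' Q₁ Q₂)
    (hn : ∀ X Y : F', 2 + (c' : F') ≠ X ^ 2 + D * Y ^ 2)
    (hg : ∃ g : ClassGroup (𝓞 L), ∀ (x : ClassGroup (𝓞 L)) (e : ℤ) (y : ClassGroup (𝓞 X)),
      g ≠ x ^ 2 * cl l' ^ e * clMap (algebraMap (𝓞 X) (𝓞 L)) (algInj X L) y)
    (hl1 : cl l ≠ 1)
    (hlj : ∀ y ∈ CommGroup.primaryComponent (ClassGroup (𝓞 X)) 2, cl l = y ^ 2 → ∃ z, y = z ^ 2)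
    (h8 : 8 ≤ Nat.card (CommGroup.primaryComponent (ClassGroup (𝓞 X)) 2)) :
    Nat.card (CommGroup.primaryComponent (ClassGroup (𝓞 L)) 2) =
      2 * Nat.card (CommGroup.primaryComponent (ClassGroup (𝓞 X)) 2) := by
  refine grp_full (cl l') (s.lL.l_sq hl') (s.lL.l_nsq hl' hn) (s.lL.tors_card hl' ho)
    (clMap (algebraMap (𝓞 X) (𝓞 L)) (algInj X L)) hg (clMap (sg σ) (sg_inj σ)) ?_ ?_ ?_ ?_
    (cl l) (s.lX.l_sq hl) hl1 ?_ (s.ker_j hl Q₁ ho.r1 ho.two1) h8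
  · intro a
    obtain ⟨I, hI, rfl⟩ := cl_surj a
    obtain ⟨b, hb⟩ := s.qs.norm_ideal I
    exact ⟨cl b, by rw [clMap_cl, clMap_cl, ← hb, cl_mul hI (map_ne_zero_of_inj _ (sg_inj σ) hI)]⟩
  · intro y
    obtain ⟨I, hI, rfl⟩ := cl_surj y
    rw [clMap_cl, clMap_cl, s.qs.map_sg_map]
  · rw [clMap_cl, s.fix_l hl']
  · intro y hy h
    obtain ⟨z, rfl⟩ := hlj y hy (s.l_range hl hl' y h)
    rw [map_pow] at h
    exact s.lL.l_nsq hl' hn _ h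
  · rw [clMap_cl, s.map_l hl, cl_span]

end AStep

open NumberField
open scoped nonZeroDivisors

/-- represented over `ℚ` -/
def QRep (D : ℕ) (r : ℚ) : Prop := ∃ X Y : ℚ, r = X ^ 2 + D * Y ^ 2

namespace QRep
variable {D : ℕ} {r t : ℚ}

theorem mul (hr : QRep D r) (ht : QRep D t) : QRep D (r * t) := by
  obtain ⟨X, Y, rfl⟩ := hr
  obtain ⟨Z, W, rfl⟩ := ht
  exact ⟨X * Z - D * Y * W, X * W + Y * Z, by ring⟩

theorem sqr (x : ℚ) : QRep D (x ^ 2) := ⟨x, 0, by ring⟩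

theorem inv (hr : QRep D r) : QRep D r⁻¹ := by
  by_cases h : r = 0
  · rw [h, inv_zero]; exact ⟨0, 0, by ring⟩
  have : r⁻¹ = r * r⁻¹ ^ 2 := by field_simp
  rw [this]
  exact hr.mul (sqr _)

theorem of_mul_sq {x : ℚ} (hx : x ≠ 0) (h : QRep D (r * x ^ 2)) : QRep D r := by
  have : r = r * x ^ 2 * (x⁻¹) ^ 2 := by field_simp
  rw [this]; exact h.mul (sqr _)

theorem of_mul (h : QRep D (r * t)) (ht : QRep D t) (h0 : t ≠ 0) : QRep D r := by
  have : r = r * t * t⁻¹ := by field_simp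
  rw [this]; exact h.mul ht.inv

theorem nonneg (h : QRep D r) : 0 ≤ r := by
  obtain ⟨X, Y, rfl⟩ := h
  positivity

end QRep

theorem norm_rep {L : Type*} [Field L] [NumberField L] (D : ℕ) (hD : D ≠ 0) (δ : L)
    (hδ : δ ^ 2 = -(D : L)) (x : L) : QRep D (Algebra.norm ℚ x) := by
  haveI : Fact (∀ r : ℚ, r ^ 2 ≠ (-(D : ℚ)) + 0 * r) := ⟨fun r h => by
    have h1 : (0 : ℚ) < D := by exact_mod_cast Nat.pos_of_ne_zero hD
    nlinarith [sq_nonneg r]⟩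
  let f : QuadraticAlgebra ℚ (-(D : ℚ)) 0 →ₐ[ℚ] L := QuadraticAlgebra.lift ⟨δ, by
    rw [← pow_two, hδ, zero_smul, add_zero, Algebra.smul_def, mul_one]; simp⟩
  letI : Algebra (QuadraticAlgebra ℚ (-(D : ℚ)) 0) L := f.toRingHom.toAlgebra
  haveI : IsScalarTower ℚ (QuadraticAlgebra ℚ (-(D : ℚ)) 0) L :=
    IsScalarTower.of_algebraMap_eq (fun r => (f.commutes r).symm)
  haveI : Module.Finite (QuadraticAlgebra ℚ (-(D : ℚ)) 0) L := Module.Finite.of_restrictScalars_finite ℚ _ _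
  rw [← Algebra.norm_norm (S := QuadraticAlgebra ℚ (-(D : ℚ)) 0)]
  generalize Algebra.norm (QuadraticAlgebra ℚ (-(D : ℚ)) 0) x = z
  have : Algebra.norm ℚ z = z.norm := by
    rw [← QuadraticAlgebra.det_toLinearMap_eq_norm, Algebra.norm_apply]
    congr 1
  rw [this, QuadraticAlgebra.norm_def]
  exact ⟨z.re, z.im, by ring⟩

theorem absNorm_rep {L : Type*} [Field L] [NumberField L] (D : ℕ) (hD : D ≠ 0) (δ : L)
    (hδ : δ ^ 2 = -(D : L)) (x : 𝓞 L) : QRep D (Ideal.absNorm (Ideal.span {x}) : ℚ) := by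
  rw [Ideal.absNorm_span_singleton]
  have h1 := norm_rep D hD δ hδ (x : L)
  have h2 : Algebra.norm ℚ (x : L) = (Algebra.norm ℤ x : ℚ) := (Algebra.coe_norm_int x).symm
  rw [h2] at h1
  have h3 := h1.nonneg
  have h4 : 0 ≤ Algebra.norm ℤ x := by exact_mod_cast h3
  have h5 : (((Algebra.norm ℤ x).natAbs : ℕ) : ℚ) = (Algebra.norm ℤ x : ℚ) := by
    have : (((Algebra.norm ℤ x).natAbs : ℤ)) = Algebra.norm ℤ x := Int.natAbs_of_nonneg h4
    have h6 := congrArg (Int.cast : ℤ → ℚ) this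
    rw [Int.cast_natCast] at h6
    exact h6
  rw [h5]; exact h1

/-- residue degree one at all primes above `ℓ` -/
def EP (F : Type*) [Field F] (ℓ : ℕ) : Prop :=
  ∀ Q : Ideal (𝓞 F), Q.IsPrime → (ℓ : 𝓞 F) ∈ Q → ∀ x : 𝓞 F, x ^ ℓ - x ∈ Q

/-- iterates -/
def It {R : Type*} [CommRing R] (n : ℕ) (c : R) : Prop := (fun x : R => x ^ 2 - 2)^[n] c = 0

theorem It.map {R S : Type*} [CommRing R] [CommRing S] (f : R →+* S) {n : ℕ} {c : R} (h : It n c) :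
    It n (f c) := by
  have : ∀ n : ℕ, ∀ x : R, (fun x : S => x ^ 2 - 2)^[n] (f x) = f ((fun x : R => x ^ 2 - 2)^[n] x) := by
    intro n
    induction n with
    | zero => intro x; rfl
    | succ n ih =>
      intro x
      rw [Function.iterate_succ_apply, Function.iterate_succ_apply, ← ih]
      simp [map_ofNat]
  unfold It at h ⊢
  rw [this, h, map_zero]

theorem It.succ {R : Type*} [CommRing R] {n : ℕ} {c : R} (h : It n (c ^ 2 - 2)) : It (n + 1) c := by
  unfold It at h ⊢
  rw [Function.iterate_succ_apply]; exact h

theorem It.frob {k : Type*} [Field k] (ℓ : ℕ) [hℓ : Fact ℓ.Prime] [CharP k ℓ] {n : ℕ} {c : k} (h : It n c)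
    (hn : 2 ^ (n + 2) ∣ ℓ + 1) : c ^ ℓ = c := by
  have inj := (algebraMap k (AlgebraicClosure k)).injective
  apply inj
  rw [map_pow]
  have h' := h.map (algebraMap k (AlgebraicClosure k))
  generalize algebraMap k (AlgebraicClosure k) c = C at h'
  haveI : CharP (AlgebraicClosure k) ℓ := charP_of_injective_algebraMap inj ℓ
  obtain ⟨ζ, hζ⟩ : ∃ ζ : AlgebraicClosure k, ζ ^ 2 - C * ζ + 1 = 0 := by
    open Polynomial in
    have hdeg : (X ^ 2 - Polynomial.C C * X + 1 : (AlgebraicClosure k)[X]).degree ≠ 0 := by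
      have : (X ^ 2 - Polynomial.C C * X + 1 : (AlgebraicClosure k)[X]).degree = 2 := by compute_degree!
      rw [this]; decide
    obtain ⟨z, hz⟩ := IsAlgClosed.exists_root _ hdeg
    exact ⟨z, by simpa [Polynomial.IsRoot] using hz⟩
  have hζ0 : ζ ≠ 0 := by rintro rfl; simp at hζ
  have hC : C = ζ + ζ⁻¹ := by field_simp; linear_combination -hζ
  have hit : ∀ m : ℕ, ∀ z : AlgebraicClosure k, z ≠ 0 →
      (fun x : AlgebraicClosure k => x ^ 2 - 2)^[m] (z + z⁻¹) = z ^ 2 ^ m + (z ^ 2 ^ m)⁻¹ := by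
    intro m
    induction m with
    | zero => intro z hz; simp
    | succ m ih =>
      intro z hz
      rw [Function.iterate_succ_apply]
      have : (z + z⁻¹) ^ 2 - 2 = z ^ 2 + (z ^ 2)⁻¹ := by field_simp; ring
      rw [this, ih _ (pow_ne_zero 2 hz), ← pow_mul, pow_succ' 2 m]
  unfold It at h'
  rw [hC, hit n ζ hζ0] at h'
  have hw : (ζ ^ 2 ^ n) ^ 2 = -1 := by
    have hw0 : ζ ^ 2 ^ n ≠ 0 := pow_ne_zero _ hζ0
    field_simp at h'
    linear_combination h'
  have h1 : ζ ^ (2 ^ (n + 2)) = 1 := by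
    have : 2 ^ (n + 2) = 2 ^ n * 2 * 2 := by ring
    rw [this, pow_mul, pow_mul, hw]; ring
  obtain ⟨t, ht⟩ := hn
  have h2 : ζ ^ ℓ = ζ⁻¹ := by
    apply eq_inv_of_mul_eq_one_left
    rw [← pow_succ, ht, pow_mul, h1, one_pow]
  rw [hC, add_pow_char, inv_pow, h2, inv_inv, add_comm]

section ep
variable {k L : Type*} [Field k] [NumberField k] [Field L] [NumberField L] [Algebra k L]
  {σ : L →+* L} {θ : 𝓞 L}

theorem EP.step (q : IsQuad k σ (θ : L)) {ℓ : ℕ} (hℓ : ℓ.Prime) (h : EP k ℓ)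
    (h2 : ∀ Q : Ideal (𝓞 L), Q.IsPrime → (ℓ : 𝓞 L) ∈ Q → 2 * θ ∉ Q ∧ θ ^ ℓ - θ ∈ Q) : EP L ℓ := by
  intro Q hQ hlQ x
  obtain ⟨h2θ, hθ⟩ := h2 Q hQ hlQ
  have hsθ : sg σ θ = -θ := by
    apply RingOfIntegers.ext; simpa using q.conj
  obtain ⟨u, hu⟩ := q.of_fixed_int (x + sg σ x) (by rw [map_add, q.sg_sg, add_comm])
  obtain ⟨v, hv⟩ := q.of_fixed_int ((x - sg σ x) * θ) (by rw [map_mul, map_sub, q.sg_sg, hsθ]; ring)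
  haveI := hQ
  have hQc : (Q.comap (algebraMap (𝓞 k) (𝓞 L))).IsPrime := Ideal.IsPrime.comap _
  have hbase : ∀ w : 𝓞 k, algebraMap (𝓞 k) (𝓞 L) w ^ ℓ - algebraMap (𝓞 k) (𝓞 L) w ∈ Q := by
    intro w
    have := h _ hQc (by rw [Ideal.mem_comap, map_natCast]; exact hlQ) w
    rw [Ideal.mem_comap, map_sub, map_pow] at this
    exact this
  have hex : 2 * θ * x = θ * algebraMap (𝓞 k) (𝓞 L) u + algebraMap (𝓞 k) (𝓞 L) v := by
    rw [hu, hv]; ring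
  haveI : Fact ℓ.Prime := ⟨hℓ⟩
  haveI : CharP (𝓞 L ⧸ Q) ℓ := by
    apply (CharP.charP_iff_prime_eq_zero hℓ).2
    have := Ideal.Quotient.eq_zero_iff_mem.2 hlQ
    simpa using this
  rw [← Ideal.Quotient.eq_zero_iff_mem, map_sub, map_pow, sub_eq_zero]
  have e1 := congrArg (Ideal.Quotient.mk Q) hex
  have e2 := hbase u
  have e3 := hbase v
  have e4 := hbase 2
  rw [← Ideal.Quotient.eq_zero_iff_mem, map_sub, map_pow, sub_eq_zero] at e2 e3 e4 hθ
  rw [map_ofNat] at e4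
  simp only [map_mul, map_add, map_ofNat] at e1 e4
  have h0 : (2 : 𝓞 L ⧸ Q) * Ideal.Quotient.mk Q θ ≠ 0 := by
    intro h0
    apply h2θ
    rw [← Ideal.Quotient.eq_zero_iff_mem, map_mul, map_ofNat]; exact h0
  apply mul_left_cancel₀ h0
  have e5 := congrArg (fun t => t ^ ℓ) e1
  simp only [mul_pow, add_pow_char, e2, e3, e4, hθ] at e5
  rw [e5, e1]

theorem absNorm_of_ep {ℓ : ℕ} (hℓ : ℓ.Prime) (h : EP k ℓ) (Q : Ideal (𝓞 k)) (hQ : Q.IsPrime)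
    (hlQ : (ℓ : 𝓞 k) ∈ Q) : Ideal.absNorm Q = ℓ := by
  have hQ0 : Q ≠ ⊥ := by
    rintro rfl
    exact hℓ.ne_zero (by simpa using hlQ)
  haveI := hQ
  haveI := hQ.isMaximal hQ0
  letI : Field (𝓞 k ⧸ Q) := Ideal.Quotient.field Q
  haveI : Fact ℓ.Prime := ⟨hℓ⟩
  haveI : CharP (𝓞 k ⧸ Q) ℓ := by
    apply (CharP.charP_iff_prime_eq_zero hℓ).2
    have := Ideal.Quotient.eq_zero_iff_mem.2 hlQ
    simpa using this
  rw [Ideal.absNorm_apply, Submodule.cardQuot_apply]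
  haveI : Finite (𝓞 k ⧸ Q) := Ideal.finiteQuotientOfFreeOfNeBot Q hQ0
  apply le_antisymm
  · haveI := Fintype.ofFinite (𝓞 k ⧸ Q)
    rw [Nat.card_eq_fintype_card]
    by_contra hlt
    push Not at hlt
    have := FiniteField.X_pow_card_sub_X_ne_zero (𝓞 k ⧸ Q) hℓ.one_lt
    apply this
    apply Polynomial.eq_zero_of_natDegree_lt_card_of_eval_eq_zero' _ Finset.univ
    · intro x _
      obtain ⟨x, rfl⟩ := Ideal.Quotient.mk_surjective x
      have := Ideal.Quotient.eq_zero_iff_mem.2 (h Q hQ hlQ x)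
      simpa using this
    · rw [FiniteField.X_pow_card_sub_X_natDegree_eq _ hℓ.one_lt]
      exact hlt
  · have : Function.Injective (ZMod.castHom (dvd_refl ℓ) (𝓞 k ⧸ Q)) := RingHom.injective _
    have := Nat.card_le_card_of_injective _ this
    rwa [Nat.card_zmod] at this

end ep

theorem two_notMem {F : Type*} [Field F] [NumberField F] {ℓ : ℕ} (hodd : Odd ℓ) (Q : Ideal (𝓞 F))
    (hQ : Q.IsPrime) (hl : (ℓ : 𝓞 F) ∈ Q) : (2 : 𝓞 F) ∉ Q := by
  intro h
  obtain ⟨t, rfl⟩ := hodd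
  push_cast at hl
  apply hQ.ne_top
  rw [Ideal.eq_top_iff_one]
  exact (Q.add_mem_iff_right (Q.mul_mem_right _ h)).1 hl

theorem FStep.ep {F F' : Type*} [Field F] [Field F'] [NumberField F] [NumberField F'] [Algebra F F']
    {σ : F' →+* F'} {c : 𝓞 F} {c' : 𝓞 F'} (s : FStep F σ c c') {ℓ : ℕ} (hℓ : ℓ.Prime) (hodd : Odd ℓ)
    {n : ℕ} (hc : It n c') (hn : 2 ^ (n + 2) ∣ ℓ + 1) (h : EP F ℓ) : EP F' ℓ := by
  refine h.step s.q hℓ (fun Q hQ hl => ?_)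
  have h2 := two_notMem hodd Q hQ hl
  constructor
  · intro h3
    rcases hQ.mem_or_mem h3 with h4 | h4
    · exact h2 h4
    · obtain ⟨a, ha⟩ := Ideal.mem_span_singleton.1 s.two_mem
      rw [ha] at h2
      exact h2 (Q.mul_mem_right _ h4)
  · have hQ0 : Q ≠ ⊥ := by
      rintro rfl
      exact hℓ.ne_zero (by simpa using hl)
    haveI := hQ
    haveI := hQ.isMaximal hQ0
    letI : Field (𝓞 F' ⧸ Q) := Ideal.Quotient.field Q
    haveI : Fact ℓ.Prime := ⟨hℓ⟩
    haveI : CharP (𝓞 F' ⧸ Q) ℓ := by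
      apply (CharP.charP_iff_prime_eq_zero hℓ).2
      have := Ideal.Quotient.eq_zero_iff_mem.2 hl
      simpa using this
    rw [← Ideal.Quotient.eq_zero_iff_mem, map_sub, map_pow, sub_eq_zero]
    exact (hc.map (Ideal.Quotient.mk Q)).frob ℓ hn

theorem Layer.ep {F K : Type*} [Field F] [Field K] [NumberField F] [NumberField K] [Algebra F K]
    {τ : K →+* K} {c : 𝓞 F} {θ : 𝓞 K} {D : ℕ} (s : Layer F τ c θ D) {ℓ : ℕ} (hℓ : ℓ.Prime) (hodd : Odd ℓ)
    (hD : ¬ ℓ ∣ D) (hs : ∃ t : ℤ, (ℓ : ℤ) ∣ t ^ 2 + D) (h : EP F ℓ) : EP K ℓ := by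
  refine h.step s.q hℓ (fun Q hQ hl => ?_)
  have h2 := two_notMem hodd Q hQ hl
  have hintg : ∀ a : ℤ, (ℓ : ℤ) ∣ a → (a : 𝓞 K) ∈ Q := by
    rintro _ ⟨b, rfl⟩
    push_cast
    exact Q.mul_mem_right _ hl
  constructor
  · intro h3
    rcases hQ.mem_or_mem h3 with h4 | h4
    · exact h2 h4
    · have h5 : (D : 𝓞 K) ∈ Q := by
        have : (D : 𝓞 K) = θ * (-θ) := by linear_combination s.hθ
        rw [this]; exact Q.mul_mem_right _ h4
      have hcop : IsCoprime (ℓ : ℤ) (D : ℤ) := Nat.isCoprime_iff_coprime.2 ((Nat.Prime.coprime_iff_not_dvd hℓ).2 hD)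
      obtain ⟨a, b, hab⟩ := hcop
      apply hQ.ne_top
      rw [Ideal.eq_top_iff_one]
      have : (1 : 𝓞 K) = a * ℓ + b * D := by exact_mod_cast (congrArg (Int.cast : ℤ → 𝓞 K) hab).symm
      rw [this]
      exact Q.add_mem (Q.mul_mem_left _ hl) (Q.mul_mem_left _ h5)
  · obtain ⟨t, ht⟩ := hs
    haveI : Fact ℓ.Prime := ⟨hℓ⟩
    have h3 := hintg _ ht
    have hfer : (t : 𝓞 K) ^ ℓ - t ∈ Q := by
      have : (ℓ : ℤ) ∣ t ^ ℓ - t := by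
        rw [← ZMod.intCast_eq_intCast_iff_dvd_sub]
        push_cast
        rw [ZMod.pow_card]
      have := hintg _ this
      push_cast at this
      exact this
    have h4 : ((t : 𝓞 K) - θ) * (t + θ) ∈ Q := by
      have : ((t : 𝓞 K) - θ) * (t + θ) = ((t ^ 2 + D : ℤ) : 𝓞 K) := by
        push_cast; linear_combination -s.hθ
      rw [this]; exact h3
    rw [← Ideal.Quotient.eq_zero_iff_mem, map_sub, map_pow, sub_eq_zero] at hfer ⊢
    rcases hQ.mem_or_mem h4 with h5 | h5
    · have h5' := h5
      rw [← Ideal.Quotient.eq_zero_iff_mem, map_sub, sub_eq_zero] at h5'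
      rw [← h5']; exact hfer
    · have h5' := h5
      rw [← Ideal.Quotient.eq_zero_iff_mem, map_add, add_eq_zero_iff_neg_eq] at h5'
      rw [← h5', hodd.neg_pow, hfer]

open NumberField
open scoped nonZeroDivisors

theorem not_qrep (p : ℕ) (hp : p.Prime) (D : ℕ) (hD : p ∣ D) (hD2 : ¬ p ^ 2 ∣ D) (a : ℤ)
    (ha : ¬ IsSquare (a : ZMod p)) : ¬ QRep D (a : ℚ) := by
  rintro ⟨X, Y, h⟩
  have hpr : (Ideal.span {(p : ℤ)}).IsPrime := by
    rw [Ideal.span_singleton_prime (by exact_mod_cast hp.ne_zero)]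
    exact Nat.prime_iff_prime_int.1 hp
  refine not_repr (K := ℚ) (Ideal.span {(p : ℤ)}) hpr (D : ℤ) a ?_ ?_ ?_ X Y ?_
  · rw [Ideal.mem_span_singleton]; exact_mod_cast hD
  · rw [Ideal.span_singleton_pow, Ideal.mem_span_singleton]; exact_mod_cast hD2
  · intro x hx
    apply ha
    rw [Ideal.mem_span_singleton, ← ZMod.intCast_eq_intCast_iff_dvd_sub] at hx
    exact ⟨x, by rw [hx]; push_cast; ring⟩
  · simpa using h

section rep
variable {L : Type*} [Field L] [NumberField L] {D : ℕ} {δ : L}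

theorem rep_of_cl_eq (hD : D ≠ 0) (hδ : δ ^ 2 = -(D : L)) {A B : Ideal (𝓞 L)} (hA : A ≠ 0) (hB : B ≠ 0)
    (h : cl A = cl B) : QRep D ((Ideal.absNorm A : ℚ) * Ideal.absNorm B) := by
  obtain ⟨x, y, hx, hy, hxy⟩ := (cl_eq_iff hA hB).1 h
  have h1 := congrArg Ideal.absNorm hxy
  rw [map_mul, map_mul] at h1
  have hx' := absNorm_rep D hD δ hδ x
  have hy' := absNorm_rep D hD δ hδ y
  have hx0 : Ideal.absNorm (Ideal.span {x}) ≠ 0 := by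
    rw [Ne, Ideal.absNorm_eq_zero_iff]; simpa using hx
  generalize Ideal.absNorm (Ideal.span {x}) = u at *
  generalize Ideal.absNorm (Ideal.span {y}) = v at *
  have h2 : (u : ℚ) * Ideal.absNorm A = v * Ideal.absNorm B := by exact_mod_cast h1
  have hu : (u : ℚ) ≠ 0 := by exact_mod_cast hx0
  apply QRep.of_mul (t := (u : ℚ)) _ hx' hu
  have : (Ideal.absNorm A : ℚ) * Ideal.absNorm B * u = v * (Ideal.absNorm B : ℚ) ^ 2 := by
    linear_combination (Ideal.absNorm B : ℚ) * h2
  rw [this]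
  exact hy'.mul (QRep.sqr _)

theorem exists_over (L : Type*) [Field L] [NumberField L] (ℓ : ℕ) (hℓ : ℓ.Prime) :
    ∃ Q : Ideal (𝓞 L), Q.IsPrime ∧ Q ≠ 0 ∧ (ℓ : 𝓞 L) ∈ Q := by
  have hne : Ideal.span {(ℓ : 𝓞 L)} ≠ ⊤ := by
    intro h
    have h1 := Ideal.absNorm_span_singleton (ℓ : 𝓞 L)
    rw [h, Ideal.absNorm_top] at h1
    have h2 : Algebra.norm ℤ (ℓ : 𝓞 L) = (ℓ : ℤ) ^ Module.finrank ℤ (𝓞 L) := by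
      have := Algebra.norm_algebraMap (S := 𝓞 L) (ℓ : ℤ)
      simpa using this
    rw [h2, Int.natAbs_pow, Int.natAbs_natCast] at h1
    have h4 : Module.finrank ℤ (𝓞 L) ≠ 0 := Module.finrank_pos.ne'
    have h3 := Nat.one_lt_pow h4 hℓ.one_lt
    omega
  obtain ⟨Q, hQ, hle⟩ := Ideal.exists_le_maximal _ hne
  have hm : (ℓ : 𝓞 L) ∈ Q := hle (Ideal.mem_span_singleton_self _)
  refine ⟨Q, hQ.isPrime, ?_, hm⟩
  rintro rfl
  exact hℓ.ne_zero (by simpa using hm)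

theorem exists_g {X : Type*} [Field X] [NumberField X] [Algebra X L] {σ : L →+* L} {η : L}
    (q : IsQuad X σ η) (hD : D ≠ 0) (hδ : δ ^ 2 = -(D : L)) {ℓ : ℕ} (hℓ : ℓ.Prime) (hE : EP L ℓ)
    {l : Ideal (𝓞 L)} (hl : Ideal.absNorm l = 2) (hl2 : cl l ^ 2 = 1) (h1 : ¬ QRep D ℓ)
    (h2 : ¬ QRep D (ℓ * 2)) : ∃ g : ClassGroup (𝓞 L), ∀ (x : ClassGroup (𝓞 L)) (e : ℤ)
      (y : ClassGroup (𝓞 X)), g ≠ x ^ 2 * cl l ^ e * clMap (algebraMap (𝓞 X) (𝓞 L)) (algInj X L) y := by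
  obtain ⟨Q, hQ, hQ0, hQl⟩ := exists_over L ℓ hℓ
  have hNQ := absNorm_of_ep hℓ hE Q hQ hQl
  have hl0 : l ≠ 0 := by
    rintro rfl
    rw [Submodule.zero_eq_bot, Ideal.absNorm_bot] at hl
    omega
  refine ⟨cl Q, fun x e y h => ?_⟩
  obtain ⟨I, hI, rfl⟩ := cl_surj x
  obtain ⟨J, hJ, rfl⟩ := cl_surj y
  have hJ' := map_ne_zero_of_inj _ (algInj X L) hJ
  have he : ∃ i : ℕ, (i = 0 ∨ i = 1) ∧ cl l ^ e = cl l ^ i := by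
    have hy' : cl l ^ (2 : ℤ) = 1 := by exact_mod_cast hl2
    rcases Int.even_or_odd' e with ⟨k, rfl | rfl⟩
    · refine ⟨0, Or.inl rfl, ?_⟩
      rw [zpow_mul, hy', one_zpow, pow_zero]
    · refine ⟨1, Or.inr rfl, ?_⟩
      rw [zpow_add, zpow_mul, hy', one_zpow, one_mul, zpow_one, pow_one]
  obtain ⟨i, hi, he⟩ := he
  rw [he, clMap_cl, ← cl_pow hI, ← cl_pow hl0, ← cl_mul (pow_ne_zero 2 hI) (pow_ne_zero i hl0),
    ← cl_mul (mul_ne_zero (pow_ne_zero 2 hI) (pow_ne_zero i hl0)) hJ'] at h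
  have h3 := rep_of_cl_eq hD hδ hQ0
    (mul_ne_zero (mul_ne_zero (pow_ne_zero 2 hI) (pow_ne_zero i hl0)) hJ') h
  rw [map_mul, map_mul, map_pow, map_pow, q.absNorm_map, hl, hNQ] at h3
  push_cast at h3
  have hNI : (Ideal.absNorm I : ℚ) ≠ 0 := by
    rw [Nat.cast_ne_zero, Ne, Ideal.absNorm_eq_zero_iff]; exact hI
  have hNJ : (Ideal.absNorm J : ℚ) ≠ 0 := by
    rw [Nat.cast_ne_zero, Ne, Ideal.absNorm_eq_zero_iff]; exact hJ
  have h4 : QRep D ((ℓ : ℚ) * 2 ^ i) := by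
    apply QRep.of_mul_sq (mul_ne_zero hNI hNJ)
    convert h3 using 1
    ring
  rcases hi with rfl | rfl
  · exact h1 (by simpa using h4)
  · exact h2 (by simpa using h4)

end rep

theorem Two.absNorm {F K : Type*} [Field F] [Field K] [NumberField F] [NumberField K] [Algebra F K]
    {τ : K →+* K} {c : 𝓞 F} {θ : 𝓞 K} {D : ℕ} (s : Layer F τ c θ D) {l : Ideal (𝓞 K)}
    (hl : Two F τ c l) : Ideal.absNorm l = 2 := by
  have h := congrArg Ideal.absNorm hl.sq2
  rw [← Set.image_singleton, ← Ideal.map_span, s.q.absNorm_map, s.fd.n2p, map_pow] at h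
  exact Nat.pow_left_injective two_ne_zero h

open NumberField
open scoped nonZeroDivisors

theorem quad_exists {k L : Type*} [Field k] [Field L] [CharZero L] [Algebra k L] (θ : L)
    (hs : ∃ a : k, θ ^ 2 = algebraMap k L a) (hn : ∀ u : k, algebraMap k L u ≠ θ)
    (hsp : ∀ x : L, ∃ u v : k, x = algebraMap k L u + algebraMap k L v * θ) :
    ∃ σ : L →+* L, IsQuad k σ θ := by
  obtain ⟨a, ha⟩ := hs
  have huniq : ∀ u v u' v' : k, algebraMap k L u + algebraMap k L v * θ =
      algebraMap k L u' + algebraMap k L v' * θ → u = u' ∧ v = v' := by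
    intro u v u' v' h
    have hv : v = v' := by
      by_contra hne
      have hne' : algebraMap k L v - algebraMap k L v' ≠ 0 := by
        rw [← map_sub, map_ne_zero]; exact sub_ne_zero.2 hne
      apply hn ((u' - u) / (v - v'))
      rw [map_div₀, map_sub, map_sub, div_eq_iff hne']
      linear_combination (-1 : L) * h
    subst hv
    exact ⟨(algebraMap k L).injective (by linear_combination h), rfl⟩
  choose U V hUV using hsp
  have hU : ∀ u v : k, U (algebraMap k L u + algebraMap k L v * θ) = u ∧
      V (algebraMap k L u + algebraMap k L v * θ) = v := by
    intro u v
    have := huniq _ _ _ _ (hUV (algebraMap k L u + algebraMap k L v * θ))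
    exact ⟨this.1.symm, this.2.symm⟩
  let f : L → L := fun x => algebraMap k L (U x) - algebraMap k L (V x) * θ
  have hf : ∀ u v : k, f (algebraMap k L u + algebraMap k L v * θ) =
      algebraMap k L u - algebraMap k L v * θ := by
    intro u v
    simp only [f]
    rw [(hU u v).1, (hU u v).2]
  have hf1 : ∀ u : k, f (algebraMap k L u) = algebraMap k L u := by
    intro u
    have := hf u 0
    simpa using this
  refine ⟨{ toFun := f, map_one' := ?_, map_mul' := ?_, map_zero' := ?_, map_add' := ?_ }, ?_⟩
  · simpa using hf1 1
  · intro x y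
    have h1 : x * y = algebraMap k L (U x * U y + V x * V y * a) +
        algebraMap k L (U x * V y + V x * U y) * θ := by
      simp only [map_add, map_mul, ← ha]
      conv_lhs => rw [hUV x, hUV y]
      ring
    rw [h1, hf]
    simp only [map_add, map_mul, ← ha, f]
    ring
  · simpa using hf1 0
  · intro x y
    have h1 : x + y = algebraMap k L (U x + U y) + algebraMap k L (V x + V y) * θ := by
      simp only [map_add]
      conv_lhs => rw [hUV x, hUV y]
      ring
    change f _ = f _ + f _
    rw [h1, hf]
    simp only [map_add, f]
    ring
  · refine ⟨?_, ?_, ⟨a, ha⟩, ?_, fun x => ⟨U x, V x, hUV x⟩⟩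
    · rintro rfl; exact hn 0 (map_zero _)
    · have := hf 0 1
      simpa using this
    · intro u; exact hf1 u

/-- a field equal to the rationals -/
def RatF (F : Type*) [Field F] [CharZero F] : Prop := ∀ x : F, ∃ q : ℚ, x = (q : F)

namespace RatF
variable {F : Type*} [Field F] [NumberField F] (h : RatF F)
include h

theorem int (x : 𝓞 F) : ∃ z : ℤ, x = (z : 𝓞 F) := by
  obtain ⟨q, hq⟩ := h (x : F)
  have h1 : IsIntegral ℤ (q : F) := hq ▸ x.2
  have h2 : IsIntegral ℤ q := by
    have h3 : IsIntegral ℤ (algebraMap ℚ F q) := by simpa using h1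
    exact (isIntegral_algebraMap_iff (algebraMap ℚ F).injective).1 h3
  obtain ⟨z, hz⟩ := IsIntegrallyClosed.isIntegral_iff.1 h2
  refine ⟨z, RingOfIntegers.ext ?_⟩
  rw [hq, ← hz]
  simp

theorem finrank : Module.finrank ℚ F = 1 := by
  refine finrank_eq_one (1 : F) one_ne_zero fun w => ?_
  obtain ⟨q, rfl⟩ := h w
  exact ⟨q, by rw [Rat.smul_one_eq_cast]⟩

theorem absNorm_int (z : ℤ) : Ideal.absNorm (Ideal.span {(z : 𝓞 F)}) = z.natAbs := by
  rw [Ideal.absNorm_span_singleton]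
  have h2 : Algebra.norm ℤ (z : 𝓞 F) = z ^ Module.finrank ℤ (𝓞 F) := by
    have := Algebra.norm_algebraMap (S := 𝓞 F) z
    simpa using this
  rw [h2, RingOfIntegers.rank, h.finrank, pow_one]

theorem fd : FD F 0 := by
  have h2 : Ideal.absNorm (Ideal.span {(2 : 𝓞 F)}) = 2 := by
    have := h.absNorm_int 2
    simpa using this
  have hpos : TotPos (2 : F) := fun φ => ⟨2, two_pos, by rw [map_ofNat]; simp⟩
  refine ⟨?_, ?_, ?_, ?_, ?_, ?_, ?_, ?_⟩
  · intro φ x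
    obtain ⟨q, rfl⟩ := h x
    exact ⟨q, by simp⟩
  · simpa using hpos
  · simpa using hpos
  · simpa using h2
  · simpa using h2
  · intro Q _ _; exact Q.zero_mem
  · have hs : Function.Surjective (Int.castRingHom (𝓞 F)) := fun x => by
      obtain ⟨z, rfl⟩ := h.int x; exact ⟨z, by simp⟩
    have : IsPrincipalIdealRing (𝓞 F) := IsPrincipalIdealRing.of_surjective _ hs
    have h1 : Subsingleton (ClassGroup (𝓞 F)) := by infer_instance
    rw [Nat.card_of_subsingleton (1 : ClassGroup (𝓞 F))]
    exact odd_one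
  · intro u hu
    obtain ⟨z, hz⟩ := h.int (u : 𝓞 F)
    have h1 : (z.natAbs) = 1 := by
      rw [← h.absNorm_int z, ← hz, Ideal.absNorm_eq_one_iff, Ideal.span_singleton_eq_top]
      exact u.isUnit
    refine ⟨1, Units.ext ?_⟩
    rcases Int.natAbs_eq_iff.1 h1 with h3 | h3
    · rw [hz, h3]; simp
    · exfalso
      have φ : F →+* ℂ := Classical.choice (inferInstance : Nonempty (F →+* ℂ))
      obtain ⟨r, hr, h4⟩ := hu φ
      rw [hz, h3] at h4
      simp at h4
      have : (r : ℂ) = ((-1 : ℝ) : ℂ) := by rw [← h4]; simp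
      rw [Complex.ofReal_inj] at this
      linarith

theorem ep (ℓ : ℕ) (hℓ : ℓ.Prime) : EP F ℓ := by
  intro Q hQ hl x
  obtain ⟨z, rfl⟩ := h.int x
  have : (ℓ : ℤ) ∣ z ^ ℓ - z := by
    haveI := Fact.mk hℓ
    rw [← ZMod.intCast_zmod_eq_zero_iff_dvd]
    push_cast
    rw [ZMod.pow_card, sub_self]
  obtain ⟨w, hw⟩ := this
  have h1 : ((z : 𝓞 F)) ^ ℓ - z = ℓ * w := by exact_mod_cast congrArg (Int.cast : ℤ → 𝓞 F) hw
  rw [h1]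
  exact Q.mul_mem_right _ hl

end RatF

open NumberField
open scoped nonZeroDivisors

section ZM
variable {p : ℕ} [Fact p.Prime]

theorem isSquare_mul_nn {a b : ZMod p} (ha : ¬ IsSquare a) (hb : ¬ IsSquare b) : IsSquare (a * b) := by
  have h1 := quadraticChar_neg_one_iff_not_isSquare.2 ha
  have h2 := quadraticChar_neg_one_iff_not_isSquare.2 hb
  have ha0 : a ≠ 0 := by rintro rfl; exact ha ⟨0, by simp⟩
  have hb0 : b ≠ 0 := by rintro rfl; exact hb ⟨0, by simp⟩
  rw [← quadraticChar_one_iff_isSquare (mul_ne_zero ha0 hb0), map_mul, h1, h2]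
  norm_num

theorem not_isSquare_mul {a b : ZMod p} (h0 : a ≠ 0) (ha : IsSquare a) (hb : ¬ IsSquare b) :
    ¬ IsSquare (a * b) := by
  intro h
  apply hb
  have : b = (a * b) * a⁻¹ := by field_simp
  rw [this]
  exact h.mul (by rw [isSquare_inv]; exact ha)

theorem isSquare_of_mul {a b : ZMod p} (h0 : a ≠ 0) (ha : IsSquare a) (hb : IsSquare (a * b)) :
    IsSquare b := by
  by_contra h
  exact not_isSquare_mul h0 ha h hb
end ZM

theorem exists_ell (p q : ℕ) (hp : p.Prime) (hq : q.Prime) (hpq : p ≠ q) (hp2 : p ≠ 2) (hq2 : q ≠ 2)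
    (a : ZMod p) (b : ZMod q) (ha : a ≠ 0) (hb : b ≠ 0) (N : ℕ) (B : ℕ) :
    ∃ ℓ : ℕ, B < ℓ ∧ ℓ.Prime ∧ 2 ^ N ∣ ℓ + 1 ∧ (ℓ : ZMod p) = a ∧ (ℓ : ZMod q) = b := by
  haveI := Fact.mk hp
  haveI := Fact.mk hq
  have h1 : Nat.Coprime p q := (Nat.coprime_primes hp hq).2 hpq
  have h2 : Nat.Coprime (2 ^ N) (p * q) := by
    apply Nat.Coprime.pow_left
    exact Nat.Coprime.mul_right ((Nat.coprime_primes Nat.prime_two hp).2 (Ne.symm hp2))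
      ((Nat.coprime_primes Nat.prime_two hq).2 (Ne.symm hq2))
  let e1 := ZMod.chineseRemainder h2
  let e2 := ZMod.chineseRemainder h1
  have hu : IsUnit (e1.symm (-1, e2.symm (a, b))) := by
    apply IsUnit.map e1.symm
    rw [Prod.isUnit_iff]
    refine ⟨isUnit_one.neg, IsUnit.map e2.symm ?_⟩
    rw [Prod.isUnit_iff]
    exact ⟨ha.isUnit, hb.isUnit⟩
  haveI : NeZero (2 ^ N * (p * q)) := ⟨by
    have := hp.pos; have := hq.pos; positivity⟩
  obtain ⟨ℓ, hB, hℓ, he⟩ := Nat.forall_exists_prime_gt_and_eq_mod hu B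
  refine ⟨ℓ, hB, hℓ, ?_, ?_, ?_⟩
  all_goals
    have h3 : ((ℓ : ZMod (2 ^ N)), (ℓ : ZMod (p * q))) = (-1, e2.symm (a, b)) := by
      have := congrArg e1 he
      rw [RingEquiv.apply_symm_apply, map_natCast] at this
      exact this
    rw [Prod.mk.injEq] at h3
    have h4 : ((ℓ : ZMod p), (ℓ : ZMod q)) = (a, b) := by
      have := congrArg e2 h3.2
      rw [RingEquiv.apply_symm_apply, map_natCast] at this
      exact this
    rw [Prod.mk.injEq] at h4
  · rw [← ZMod.natCast_eq_zero_iff]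
    push_cast
    rw [h3.1]; ring
  · exact h4.1
  · exact h4.2

/-- the auxiliary prime -/
structure Ell (d ℓ N : ℕ) : Prop where
  prime : ℓ.Prime
  odd : ℓ ≠ 2
  dvd : 2 ^ N ∣ ℓ + 1
  nd : ¬ ℓ ∣ 2 * d
  s1 : ∃ t : ℤ, (ℓ : ℤ) ∣ t ^ 2 + d
  s2 : ∃ t : ℤ, (ℓ : ℤ) ∣ t ^ 2 + 2 * d
  r1 : ¬ QRep d ℓ
  r2 : ¬ QRep d (ℓ * 2)

theorem dvd_of_isSquare_neg (ℓ d : ℕ) (h : IsSquare (-(d : ZMod ℓ))) : ∃ t : ℤ, (ℓ : ℤ) ∣ t ^ 2 + d := by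
  obtain ⟨y, hy⟩ := h
  obtain ⟨t, rfl⟩ := ZMod.intCast_surjective y
  refine ⟨t, ?_⟩
  rw [← ZMod.intCast_zmod_eq_zero_iff_dvd]
  push_cast
  linear_combination -hy

theorem two_sq (p : ℕ) [Fact p.Prime] (hp : p ≠ 2) : IsSquare (2 : ZMod p) ↔ p % 8 = 1 ∨ p % 8 = 7 :=
  ZMod.exists_sq_eq_two_iff hp

theorem ell_mod (ℓ N : ℕ) (h : 2 ^ (N + 3) ∣ ℓ + 1) : ℓ % 8 = 7 := by
  have : 8 ∣ ℓ + 1 := dvd_trans ⟨2 ^ N, by ring⟩ h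
  omega

theorem neg_one_ns (ℓ : ℕ) [Fact ℓ.Prime] (h : ℓ % 8 = 7) : ¬ IsSquare (-1 : ZMod ℓ) := by
  rw [ZMod.exists_sq_eq_neg_one_iff]
  omega

theorem mk_ell (d ℓ N : ℕ) (hℓ : ℓ.Prime) (hN : 2 ^ (N + 3) ∣ ℓ + 1) (hd : ¬ ℓ ∣ d)
    (hs : ¬ IsSquare (d : ZMod ℓ)) (r1 : ¬ QRep d ℓ) (r2 : ¬ QRep d (ℓ * 2)) : Ell d ℓ (N + 3) := by
  haveI := Fact.mk hℓ
  have h7 := ell_mod ℓ N hN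
  have h2 : ℓ ≠ 2 := by omega
  have hsq : IsSquare (-(d : ZMod ℓ)) := by
    have := isSquare_mul_nn (neg_one_ns ℓ h7) hs
    simpa using this
  refine ⟨hℓ, h2, hN, ?_, dvd_of_isSquare_neg ℓ d hsq, ?_, r1, r2⟩
  · rw [hℓ.dvd_mul]
    rintro (h | h)
    · exact h2 ((Nat.prime_dvd_prime_iff_eq hℓ Nat.prime_two).1 h)
    · exact hd h
  · have := dvd_of_isSquare_neg ℓ (2 * d) (by
      have h3 : IsSquare (2 : ZMod ℓ) := (two_sq ℓ h2).2 (Or.inr h7)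
      push_cast
      rw [← mul_neg]
      exact h3.mul hsq)
    simpa using this

theorem not_dvd_of_gt {a b : ℕ} (ha : 0 < a) (h : a < b) : ¬ b ∣ a := fun h' => by
  have := Nat.le_of_dvd ha h'; omega

theorem pq_sqfree (p q : ℕ) (hp : p.Prime) (hq : q.Prime) (hpq : p ≠ q) : ¬ p ^ 2 ∣ p * q := by
  rw [pow_two, Nat.mul_dvd_mul_iff_left hp.pos, Nat.prime_dvd_prime_iff_eq hp hq]
  exact hpq

theorem pq_ell (p q : ℕ) (hp : p.Prime) (hq : q.Prime) (hp8 : p % 8 = 3) (hq8 : q % 8 = 3) (hpq : p ≠ q)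
    (N : ℕ) : ∃ ℓ, Ell (p * q) ℓ (N + 3) ∧ ¬ IsSquare (ℓ : ZMod p) ∧ IsSquare (ℓ : ZMod q) ∧
      (ℓ : ZMod q) ≠ 0 := by
  haveI := Fact.mk hp
  haveI := Fact.mk hq
  have hp2 : p ≠ 2 := by omega
  have hq2 : q ≠ 2 := by omega
  obtain ⟨a, ha⟩ := FiniteField.exists_nonsquare (F := ZMod p) (by rwa [ZMod.ringChar_zmod_n])
  have ha0 : a ≠ 0 := by rintro rfl; exact ha ⟨0, by simp⟩
  obtain ⟨ℓ, hB, hℓ, hN, h1, h2⟩ := exists_ell p q hp hq hpq hp2 hq2 a 1 ha0 one_ne_zero (N + 3) (p * q)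
  have hn : ¬ IsSquare (ℓ : ZMod p) := by rwa [h1]
  have hs : IsSquare (ℓ : ZMod q) := by rw [h2]; exact IsSquare.one
  have hl0 : (ℓ : ZMod q) ≠ 0 := by rw [h2]; exact one_ne_zero
  haveI := Fact.mk hℓ
  have h7 := ell_mod ℓ N hN
  refine ⟨ℓ, mk_ell _ ℓ N hℓ hN (not_dvd_of_gt (Nat.mul_pos hp.pos hq.pos) hB) ?_ ?_ ?_, hn, hs, hl0⟩
  · have hpl : ℓ ≠ p := by
      have := hq.two_le; have := hp.pos; nlinarith
    have hql : ℓ ≠ q := by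
      have := hp.two_le; have := hq.pos; nlinarith
    have e1 : IsSquare (p : ZMod ℓ) :=
      (ZMod.exists_sq_eq_prime_iff_of_mod_four_eq_three (by omega) (by omega) hpl).2 hn
    have e2 : ¬ IsSquare (q : ZMod ℓ) := fun h =>
      (ZMod.exists_sq_eq_prime_iff_of_mod_four_eq_three (by omega) (by omega) hql).1 h hs
    push_cast
    refine not_isSquare_mul ?_ e1 e2
    rw [Ne, ZMod.natCast_eq_zero_iff]
    exact fun h => hpl ((Nat.prime_dvd_prime_iff_eq hℓ hp).1 h)
  · have := not_qrep p hp (p * q) (Dvd.intro _ rfl) (pq_sqfree p q hp hq hpq) (ℓ : ℤ) (by simpa using hn)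
    simpa using this
  · have := not_qrep q hq (p * q) (Dvd.intro_left _ rfl) (by
      rw [mul_comm]; exact pq_sqfree q p hq hp hpq.symm) ((ℓ * 2 : ℕ) : ℤ) (by
      push_cast
      refine not_isSquare_mul hl0 hs ?_
      rw [two_sq q hq2]; omega)
    push_cast at this
    exact this

theorem p_ell (p : ℕ) (hp : p.Prime) (hp8 : p % 16 = 9)
    (N : ℕ) : ∃ ℓ, Ell p ℓ (N + 3) ∧ ¬ IsSquare (ℓ : ZMod p) := by
  haveI := Fact.mk hp
  haveI : Fact (Nat.Prime 3) := ⟨Nat.prime_three⟩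
  have hp2 : p ≠ 2 := by omega
  obtain ⟨a, ha⟩ := FiniteField.exists_nonsquare (F := ZMod p) (by rwa [ZMod.ringChar_zmod_n])
  have ha0 : a ≠ 0 := by rintro rfl; exact ha ⟨0, by simp⟩
  obtain ⟨ℓ, hB, hℓ, hN, h1, h2⟩ := exists_ell p 3 hp Nat.prime_three (by rintro rfl; omega) hp2
    (by omega) a 1 ha0 one_ne_zero (N + 3) p
  have hn : ¬ IsSquare (ℓ : ZMod p) := by rwa [h1]
  haveI := Fact.mk hℓ
  have h7 := ell_mod ℓ N hN
  have hs2 : ¬ p ^ 2 ∣ p := fun h => by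
    have := Nat.le_of_dvd hp.pos h
    have := hp.two_le
    nlinarith
  refine ⟨ℓ, mk_ell _ ℓ N hℓ hN (not_dvd_of_gt hp.pos hB) ?_ ?_ ?_, hn⟩
  · exact fun h =>
      hn ((ZMod.exists_sq_eq_prime_iff_of_mod_four_eq_one (by omega) (by omega)).2 h)
  · have := not_qrep p hp p dvd_rfl hs2 (ℓ : ℤ) (by simpa using hn)
    simpa using this
  · have := not_qrep p hp p dvd_rfl hs2 ((2 * ℓ : ℕ) : ℤ) (by
      push_cast
      refine not_isSquare_mul ?_ ?_ hn
      · intro h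
        have : ((2 : ℕ) : ZMod p) = 0 := by exact_mod_cast h
        rw [ZMod.natCast_eq_zero_iff] at this
        exact hp2 ((Nat.prime_dvd_prime_iff_eq hp Nat.prime_two).1 this)
      · rw [two_sq p hp2]; omega)
    push_cast at this
    rwa [mul_comm]

open NumberField
open scoped nonZeroDivisors

theorem grp8 {G : Type*} [CommGroup G] [Finite G] (x : Fin 5 → G) (hi : Function.Injective x)
    (hx : ∀ i, x i ∈ CommGroup.primaryComponent G 2) : 8 ≤ Nat.card (CommGroup.primaryComponent G 2) := by
  haveI : Fact (Nat.Prime 2) := ⟨Nat.prime_two⟩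
  obtain ⟨n, hn⟩ := IsPGroup.iff_card.1 (CommGroup.primaryComponent.isPGroup (G := G) (p := 2))
  have h5 : 5 ≤ Nat.card (CommGroup.primaryComponent G 2) := by
    have := Nat.card_le_card_of_injective (fun i : Fin 5 => (⟨x i, hx i⟩ : CommGroup.primaryComponent G 2))
      (fun i j h => hi (by simpa using h))
    simpa using this
  rw [hn] at h5 ⊢
  have : 3 ≤ n := by
    by_contra h
    interval_cases n <;> omega
  calc 8 = 2 ^ 3 := by norm_num
    _ ≤ 2 ^ n := Nat.pow_le_pow_right two_pos this

theorem grp8_pq {G : Type*} [CommGroup G] [Finite G] (a b g : G) (ha : a ^ 2 = 1) (hb : b ^ 2 = 1)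
    (ha1 : a ≠ 1) (hb1 : b ≠ 1) (hab : a * b ≠ 1)
    (hg : ∀ m i j : ℕ, Odd m → i < 2 → j < 2 → g ^ m ≠ a ^ i * b ^ j) :
    8 ≤ Nat.card (CommGroup.primaryComponent G 2) := by
  obtain ⟨m, hm, hmA⟩ := pc_odd G
  have h00 := hg m 0 0 hm (by norm_num) (by norm_num)
  have h10 := hg m 1 0 hm (by norm_num) (by norm_num)
  have h01 := hg m 0 1 hm (by norm_num) (by norm_num)
  have h11 := hg m 1 1 hm (by norm_num) (by norm_num)
  simp only [pow_zero, pow_one, mul_one, one_mul] at h00 h10 h01 h11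
  have hab' : a ≠ b := fun h => hab (by rw [← h, ← pow_two, ha])
  have h1 : a * b ≠ a := fun h => hb1 (by simpa using h)
  have h2 : a * b ≠ b := fun h => ha1 (by simpa using h)
  refine grp8 ![1, a, b, a * b, g ^ m] ?_ ?_
  · intro i j h
    fin_cases i <;> fin_cases j <;> simp_all [eq_comm]
  · intro i
    fin_cases i
    · exact one_mem _
    · exact pc_two ha
    · exact pc_two hb
    · exact mul_mem (pc_two ha) (pc_two hb)
    · exact hmA g

theorem grp8_p {G : Type*} [CommGroup G] [Finite G] (b g : G) (hb : b ^ 4 = 1) (hb2 : b ^ 2 ≠ 1)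
    (hg : ∀ m i : ℕ, Odd m → g ^ m ≠ b ^ i) :
    8 ≤ Nat.card (CommGroup.primaryComponent G 2) := by
  obtain ⟨m, hm, hmA⟩ := pc_odd G
  have h0 := hg m 0 hm
  have h1 := hg m 1 hm
  have h2 := hg m 2 hm
  have h3 := hg m 3 hm
  have hbA : b ∈ CommGroup.primaryComponent G 2 := ⟨2, hb⟩
  rw [pow_zero] at h0
  rw [pow_one] at h1
  have hb1 : b ≠ 1 := by rintro rfl; simp at hb2
  have e3 : b ^ 3 = b ^ 2 * b := by rw [pow_succ]
  have hb3 : b ^ 3 ≠ 1 := by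
    intro h; apply hb1; rw [← hb, pow_succ, h, one_mul]
  have hb21 : b ^ 2 ≠ b := by
    intro h; apply hb1; rw [pow_two] at h; simpa using h
  have hb31 : b ^ 3 ≠ b := by rw [e3]; intro h; apply hb2; simpa using h
  have hb32 : b ^ 3 ≠ b ^ 2 := by rw [e3]; intro h; apply hb1; simpa using h
  refine grp8 ![1, b, b ^ 2, b ^ 3, g ^ m] ?_ ?_
  · intro i j h
    fin_cases i <;> fin_cases j <;> first | rfl | (exfalso; revert h; simp [*]; done) | (exfalso; revert h; simp [*, eq_comm]; done) | skip
    all_goals simp_all [eq_comm]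
  · intro i
    fin_cases i
    · exact one_mem _
    · exact hbA
    · exact pow_mem hbA _
    · exact pow_mem hbA _
    · exact hmA g

theorem rat_int_of_sq {D : ℕ} (hD : Squarefree D) (w : ℚ) (n : ℤ) (h : (D : ℚ) * w ^ 2 = n) :
    ∃ V : ℤ, w = V := by
  have h1 : (w.den : ℤ) ^ 2 ∣ (D : ℤ) := by
    have hw : (w.den : ℚ) ≠ 0 := by exact_mod_cast w.den_ne_zero
    have h2 : (D : ℤ) * w.num ^ 2 = n * (w.den : ℤ) ^ 2 := by
      have h3 : (w.num : ℚ) = w * w.den := (Rat.mul_den_eq_num w).symm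
      have : ((D : ℚ)) * (w.num : ℚ) ^ 2 = n * (w.den : ℚ) ^ 2 := by rw [h3, ← h]; ring
      exact_mod_cast this
    have hc : IsCoprime ((w.den : ℤ) ^ 2) (w.num ^ 2) := by
      apply IsCoprime.pow
      rw [Int.isCoprime_iff_nat_coprime]
      simpa using w.reduced.symm
    exact hc.dvd_of_dvd_mul_right (Dvd.intro_left _ h2.symm)
  have h4 : w.den ^ 2 ∣ D := by exact_mod_cast h1
  have h5 := hD w.den (by rwa [← pow_two])
  rw [Nat.isUnit_iff] at h5
  exact ⟨w.num, ((Rat.den_eq_one_iff w).1 h5).symm⟩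

theorem IsQuad.absNorm_sg {k L : Type*} [Field k] [NumberField k] [Field L] [NumberField L] [Algebra k L]
    {σ : L →+* L} {θ : L} (q : IsQuad k σ θ) (x : 𝓞 L) :
    Ideal.absNorm (Ideal.span {sg σ x}) = Ideal.absNorm (Ideal.span {x}) := by
  rw [Ideal.absNorm_span_singleton, Ideal.absNorm_span_singleton]
  let e : 𝓞 L ≃+* 𝓞 L := RingEquiv.ofRingHom (sg σ) (sg σ) (RingHom.ext fun x => q.sg_sg x)
    (RingHom.ext fun x => q.sg_sg x)
  have h : ∀ x : 𝓞 L, e x = sg σ x := fun x => rfl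
  rw [← h]
  congr 1
  exact (Algebra.norm_eq_of_algEquiv e.toIntAlgEquiv x)

section X0
variable {F K : Type*} [Field F] [Field K] [NumberField F] [NumberField K] [Algebra F K]
  {τ : K →+* K} {θ : 𝓞 K} {D : ℕ}

theorem x0_int (hF : RatF F) (s : Layer F τ 0 θ D) (hD : Squarefree D) (x : 𝓞 K) :
    ∃ U V : ℤ, 4 * (Ideal.absNorm (Ideal.span {x}) : ℤ) = U ^ 2 + D * V ^ 2 := by
  obtain ⟨u, v, huv⟩ := s.q.span (x : K)
  obtain ⟨a, rfl⟩ := hF u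
  obtain ⟨b, rfl⟩ := hF v
  have hnf := s.norm_form (a : F) (b : F)
  obtain ⟨y, hy⟩ := s.q.norm_mem_int x
  obtain ⟨N, rfl⟩ := hF.int y
  obtain ⟨t, ht⟩ := s.q.of_fixed_int (x + sg τ x) (by rw [map_add, s.q.sg_sg, add_comm])
  obtain ⟨U, rfl⟩ := hF.int t
  have hN : (N : ℚ) = a ^ 2 + D * b ^ 2 := by
    have := congrArg (fun z : 𝓞 K => (z : K)) hy
    simp only [map_intCast, ic_mul, ic_int, coe_sg] at this
    rw [huv] at this
    have h2 := this.trans hnf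
    simp only [map_add, map_mul, map_pow, map_ratCast, map_natCast] at h2
    exact_mod_cast h2
  have hU : (U : ℚ) = 2 * a := by
    have := congrArg (fun z : 𝓞 K => (z : K)) ht
    simp only [map_intCast, ic_add, ic_int, coe_sg] at this
    rw [huv, map_add, map_mul, s.q.fix, s.q.fix, s.q.conj] at this
    simp only [map_ratCast] at this
    have h2 : (U : K) = 2 * (a : K) := by rw [this]; ring
    exact_mod_cast h2
  obtain ⟨V, hV⟩ := rat_int_of_sq hD (2 * b) (4 * N - U ^ 2) (by push_cast; rw [hN, hU]; ring)
  refine ⟨U, V, ?_⟩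
  have hNN : 4 * N = U ^ 2 + D * V ^ 2 := by
    have : (4 : ℚ) * N = U ^ 2 + D * V ^ 2 := by rw [hN, hU, ← hV]; ring
    exact_mod_cast this
  have habs : Ideal.absNorm (Ideal.span {x}) = N.natAbs := by
    have h1 := congrArg (fun z : 𝓞 K => Ideal.absNorm (Ideal.span {z})) hy
    rw [← Ideal.span_singleton_mul_span_singleton, map_mul, s.q.absNorm_sg, ← Set.image_singleton,
      ← Ideal.map_span, s.q.absNorm_map, hF.absNorm_int, ← pow_two] at h1
    exact (Nat.pow_left_injective two_ne_zero h1).symm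
  rw [habs, Int.natCast_natAbs, abs_of_nonneg, hNN]
  nlinarith [sq_nonneg U, sq_nonneg V, mul_nonneg (Int.natCast_nonneg D) (sq_nonneg V)]
end X0

open NumberField
open scoped nonZeroDivisors

theorem pair_sq {R : Type*} [CommRing R] (n e : ℤ) (hc : IsCoprime n e) (θ : R)
    (hθ : θ ^ 2 = -((n : R) * e)) : Ideal.span {(n : R), θ} ^ 2 = Ideal.span {(n : R)} := by
  obtain ⟨u, v, huv⟩ := hc
  have h1 : (u : R) * n + v * e = 1 := by exact_mod_cast congrArg (Int.cast : ℤ → R) huv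
  have hn : (n : R) ∈ Ideal.span {(n : R), θ} := Ideal.subset_span (by simp)
  have ht : θ ∈ Ideal.span {(n : R), θ} := Ideal.subset_span (by simp)
  apply le_antisymm
  · rw [pow_two, Ideal.span_pair_mul_span_pair, Ideal.span_le]
    intro x hx
    rw [SetLike.mem_coe, Ideal.mem_span_singleton]
    simp only [Set.mem_insert_iff, Set.mem_singleton_iff] at hx
    rcases hx with rfl | rfl | rfl | rfl
    · exact Dvd.intro _ rfl
    · exact Dvd.intro _ rfl
    · exact Dvd.intro_left _ rfl
    · rw [← pow_two, hθ]; exact (Dvd.intro _ rfl : (n : R) ∣ n * e).neg_right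
  · rw [Ideal.span_singleton_le_iff_mem]
    have : (n : R) = u * (n * n) + (-v) * (θ * θ) := by
      linear_combination (-(n : R)) * h1 + v * hθ
    have h3 : (u : R) * (n * n) + (-v) * (θ * θ) ∈ Ideal.span {(n : R), θ} ^ 2 := by
      rw [pow_two]
      exact Ideal.add_mem _ (Ideal.mul_mem_left _ _ (Ideal.mul_mem_mul hn hn))
        (Ideal.mul_mem_left _ _ (Ideal.mul_mem_mul ht ht))
    rwa [← this] at h3

section X0
variable {F K : Type*} [Field F] [Field K] [NumberField F] [NumberField K] [Algebra F K]
  {τ : K →+* K} {θ : 𝓞 K} {D : ℕ}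

theorem x0_two {d : ℕ} (hF : RatF F) (s : Layer F τ 0 θ (2 * d)) (hd : Odd d) : ∃ l, Two F τ 0 l := by
  refine s.exists_two θ 0 (d : 𝓞 F) ?_ ?_ ?_
  · rw [← s.alg_D]; congr 1; push_cast; ring
  · rw [s.sgt]; simp
  · rw [add_zero, Ideal.mem_span_singleton]
    rintro ⟨y, hy⟩
    obtain ⟨z, rfl⟩ := hF.int y
    have : (d : ℤ) = 2 * z := by
      have h2 : ((d : ℤ) : 𝓞 F) = ((2 * z : ℤ) : 𝓞 F) := by push_cast; exact hy
      exact_mod_cast h2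
    obtain ⟨k, rfl⟩ := hd
    omega

theorem x0_l {d : ℕ} (s : Layer F τ 0 θ (2 * d)) (hd : Odd d) {l : Ideal (𝓞 K)} (hl : Two F τ 0 l) :
    l = Ideal.span {(2 : 𝓞 K), θ} := by
  have h := pair_sq (R := 𝓞 K) 2 (d : ℤ) (by
    rw [Int.isCoprime_iff_nat_coprime]
    simpa using hd) θ (by rw [s.hθ]; push_cast; ring)
  rw [Int.cast_ofNat] at h
  apply pow_left_injective two_ne_zero
  change l ^ 2 = _ ^ 2
  rw [h, hl.sq2, add_zero, map_ofNat]

theorem x0_g {ℓ N d : ℕ} (hF : RatF F) (s : Layer F τ 0 θ (2 * d)) (hE : Ell d ℓ N) :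
    ∃ Q : Ideal (𝓞 K), Q ≠ 0 ∧ Ideal.absNorm Q = ℓ := by
  have hep : EP K ℓ := s.ep hE.prime (hE.prime.odd_of_ne_two hE.odd) hE.nd (by
    obtain ⟨t, ht⟩ := hE.s2
    exact ⟨t, by push_cast; exact ht⟩) (hF.ep ℓ hE.prime)
  obtain ⟨Q, hQ, h0, hl⟩ := exists_over K ℓ hE.prime
  exact ⟨Q, h0, absNorm_of_ep hE.prime hep Q hQ hl⟩

theorem x0_pow {ℓ : ℕ} (s : Layer F τ 0 θ D) (hD : D ≠ 0) (hℓ : ℓ ≠ 0) {Q J : Ideal (𝓞 K)} (hQ0 : Q ≠ 0)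
    (hQ : Ideal.absNorm Q = ℓ) (hJ : J ≠ 0) (m : ℕ) (hm : Odd m) (h : cl Q ^ m = cl J) :
    QRep D ((ℓ : ℚ) * Ideal.absNorm J) := by
  obtain ⟨k, rfl⟩ := hm
  rw [← cl_pow hQ0] at h
  have h1 := rep_of_cl_eq (δ := (θ : K)) hD (by
    have := s.hθK
    exact this) (pow_ne_zero _ hQ0) hJ h
  rw [map_pow, hQ] at h1
  push_cast at h1
  apply QRep.of_mul_sq (x := (ℓ : ℚ) ^ k) (pow_ne_zero _ (by exact_mod_cast hℓ))
  convert h1 using 1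
  ring

end X0

theorem not_sq_mul {p : ℕ} (hp : p.Prime) (U k : ℤ) (h : U ^ 2 = p * k) (hk : ¬ (p : ℤ) ∣ k) : False := by
  have hp' : Prime (p : ℤ) := Nat.prime_iff_prime_int.1 hp
  have h1 : (p : ℤ) ∣ U := hp'.dvd_of_dvd_pow (n := 2) ⟨k, h⟩
  obtain ⟨w, rfl⟩ := h1
  apply hk
  refine ⟨w ^ 2, mul_left_cancel₀ hp'.ne_zero ?_⟩
  rw [← h]; ring

section X0pq
variable {F K : Type*} [Field F] [Field K] [NumberField F] [NumberField K] [Algebra F K]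
  {τ : K →+* K} {θ : 𝓞 K}

theorem rat_ns (hF : RatF F) (D : ℕ) (a : ℤ) (h : ¬ QRep D (a : ℚ)) (X Y : F) :
    (a : F) ≠ X ^ 2 + D * Y ^ 2 := by
  obtain ⟨x, rfl⟩ := hF X
  obtain ⟨y, rfl⟩ := hF Y
  intro e
  exact h ⟨x, y, by exact_mod_cast e⟩

theorem sqfree_pq (p q : ℕ) (hp : p.Prime) (hq : q.Prime) (hp2 : p ≠ 2) (hq2 : q ≠ 2) (hpq : p ≠ q) :
    Squarefree (2 * (p * q)) := by
  have h1 : Nat.Coprime p q := (Nat.coprime_primes hp hq).2 hpq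
  have h2 : Nat.Coprime 2 (p * q) := Nat.Coprime.mul_right ((Nat.coprime_primes Nat.prime_two hp).2 (Ne.symm hp2))
      ((Nat.coprime_primes Nat.prime_two hq).2 (Ne.symm hq2))
  rw [Nat.squarefree_mul h2, Nat.squarefree_mul h1]
  exact ⟨Nat.prime_two.squarefree, hp.squarefree, hq.squarefree⟩

theorem x0_pq (p q : ℕ) (hp : p.Prime) (hq : q.Prime) (hp8 : p % 8 = 3) (hq8 : q % 8 = 3) (hpq : p ≠ q)
    (hF : RatF F) (s : Layer F τ 0 θ (2 * (p * q))) {l : Ideal (𝓞 K)} (hl : Two F τ 0 l) :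
    (∀ g, cl l ≠ g ^ 2) ∧ 8 ≤ Nat.card (CommGroup.primaryComponent (ClassGroup (𝓞 K)) 2) := by
  haveI := Fact.mk hp
  haveI := Fact.mk hq
  have hp2 : p ≠ 2 := by omega
  have hq2 : q ≠ 2 := by omega
  have hp0 := hp.pos
  have hq0 := hq.pos
  have hsf := sqfree_pq p q hp hq hp2 hq2 hpq
  have hpD : ¬ p ^ 2 ∣ 2 * (p * q) := fun h => by
    rw [pow_two] at h
    exact hp.one_lt.ne' (Nat.isUnit_iff.1 (hsf p h))
  have hqD : ¬ q ^ 2 ∣ 2 * (p * q) := fun h => by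
    rw [pow_two] at h
    exact hq.one_lt.ne' (Nat.isUnit_iff.1 (hsf q h))
  have n2p : ¬ IsSquare (2 : ZMod p) := by rw [two_sq p hp2]; omega
  have n2q : ¬ IsSquare (2 : ZMod q) := by rw [two_sq q hq2]; omega
  have dp : ∀ a : ℤ, QRep (2 * (p * q)) (a : ℚ) → IsSquare (a : ZMod p) := fun a h => by
    by_contra h'
    exact not_qrep p hp _ ⟨2 * q, by ring⟩ hpD a h' h
  have dq : ∀ a : ℤ, QRep (2 * (p * q)) (a : ℚ) → IsSquare (a : ZMod q) := fun a h => by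
    by_contra h'
    exact not_qrep q hq _ ⟨2 * p, by ring⟩ hqD a h' h
  have hns : ∀ g, cl l ≠ g ^ 2 := by
    refine s.l_nsq hl fun X Y => ?_
    have := rat_ns hF (2 * (p * q)) 2 (fun h => n2p (by simpa using dp 2 h)) X Y
    rw [ic_zero, add_zero]
    simpa using this
  refine ⟨hns, ?_⟩
  obtain ⟨ℓ, hE, hlp, hlq, hlq0⟩ := pq_ell p q hp hq hp8 hq8 hpq 0
  obtain ⟨Q, hQ0, hQ⟩ := x0_g hF s hE
  -- the prime over p
  have hcop : IsCoprime (p : ℤ) (2 * q : ℤ) := by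
    rw [Int.isCoprime_iff_nat_coprime]
    simp only [Int.natAbs_mul, Int.natAbs_natCast]
    exact Nat.Coprime.mul_right ((Nat.coprime_primes hp Nat.prime_two).2 hp2)
      ((Nat.coprime_primes hp hq).2 hpq)
  have hP := pair_sq (R := 𝓞 K) (p : ℤ) (2 * q : ℤ) hcop θ (by rw [s.hθ]; push_cast; ring)
  set P := Ideal.span {((p : ℤ) : 𝓞 K), θ} with hPdef
  have hP0 : P ≠ 0 := by
    intro h
    rw [h, zero_pow two_ne_zero, eq_comm, Submodule.zero_eq_bot, Ideal.span_singleton_eq_bot] at hP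
    exact hp.ne_zero (by exact_mod_cast hP)
  have hNP : Ideal.absNorm P = p := by
    have h := congrArg Ideal.absNorm hP
    rw [← map_intCast (algebraMap (𝓞 F) (𝓞 K)), ← Set.image_singleton, ← Ideal.map_span,
      s.q.absNorm_map, hF.absNorm_int, map_pow] at h
    exact Nat.pow_left_injective two_ne_zero h
  have hl0 := hl.ram.ne
  have hNl := hl.absNorm s
  have hcP : cl P ^ 2 = 1 := by rw [← cl_pow hP0, hP, cl_span]
  refine grp8_pq (cl l) (cl P) (cl Q) (s.l_sq hl) hcP ?_ ?_ ?_ ?_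
  · intro h; exact hns 1 (by rw [h, one_pow])
  · intro h
    obtain ⟨x, -, hx⟩ := (cl_eq_one_iff hP0).1 h
    obtain ⟨U, V, hUV⟩ := x0_int hF s hsf x
    rw [← hx, hNP] at hUV
    push_cast at hUV
    refine not_sq_mul hp U (4 - 2 * q * V ^ 2) (by linear_combination -hUV) ?_
    have hV : V = 0 := by
      by_contra hV
      have h1 : 1 ≤ V ^ 2 := by have := sq_pos_of_ne_zero hV; omega
      have h2 : (3 : ℤ) ≤ q := by omega
      nlinarith [sq_nonneg U, mul_pos (show (0:ℤ) < p by exact_mod_cast hp0) (show (0 : ℤ) < q by omega),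
        mul_nonneg (show (0:ℤ) ≤ p * q by positivity) (sub_nonneg.2 h1)]
    rw [hV]
    intro h
    have : p ∣ 4 := by exact_mod_cast (by simpa using h : (p : ℤ) ∣ 4)
    have := Nat.le_of_dvd (by norm_num) this
    have : p = 3 := by omega
    subst this; omega
  · intro h
    rw [← cl_mul hl0 hP0] at h
    obtain ⟨x, -, hx⟩ := (cl_eq_one_iff (mul_ne_zero hl0 hP0)).1 h
    obtain ⟨U, V, hUV⟩ := x0_int hF s hsf x
    rw [← hx, map_mul, hNP, hNl] at hUV
    push_cast at hUV
    refine not_sq_mul hp U (8 - 2 * q * V ^ 2) (by linear_combination -hUV) ?_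
    have hpz : (0 : ℤ) < p := by exact_mod_cast hp0
    have h2 : (3 : ℤ) ≤ q := by omega
    have h3 : 0 ≤ 8 - 2 * q * V ^ 2 := by
      by_contra hneg
      push Not at hneg
      nlinarith [sq_nonneg U]
    intro h
    have hp3 : ¬ p ∣ 8 := fun h => by
      have := (Nat.dvd_prime_pow Nat.prime_two (m := 3)).1 h
      obtain ⟨k, hk, rfl⟩ := this
      interval_cases k <;> omega
    by_cases hV : V = 0
    · rw [hV] at h
      exact hp3 (by exact_mod_cast (by simpa using h : (p : ℤ) ∣ 8))
    · have h1 : 1 ≤ V ^ 2 := by have := sq_pos_of_ne_zero hV; omega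
      have h4 : (q : ℤ) = 3 := by
        have : (q : ℤ) < 5 := by nlinarith
        omega
      have h5 : V ^ 2 = 1 := by rw [h4] at h3; omega
      rw [h4, h5] at h
      have : p ∣ 2 := by exact_mod_cast (by simpa using h : (p : ℤ) ∣ 2)
      have := Nat.le_of_dvd (by norm_num) this
      omega
  · intro m i j hm hi hj h
    rw [← cl_pow hl0, ← cl_pow hP0, ← cl_mul (pow_ne_zero _ hl0) (pow_ne_zero _ hP0)] at h
    have h1 := x0_pow s (by positivity) hE.prime.ne_zero hQ0 hQ
      (mul_ne_zero (pow_ne_zero _ hl0) (pow_ne_zero _ hP0)) m hm h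
    rw [map_mul, map_pow, map_pow, hNP, hNl] at h1
    have hpq0 : (p : ZMod q) ≠ 0 := by
      rw [Ne, ZMod.natCast_eq_zero_iff, Nat.prime_dvd_prime_iff_eq hq hp]; exact hpq.symm
    have hlp0 : (ℓ : ZMod p) ≠ 0 := by intro h; apply hlp; rw [h]; exact IsSquare.zero
    have h2p0 : (2 : ZMod p) ≠ 0 := by intro h; apply n2p; rw [h]; exact IsSquare.zero
    have hqr := ZMod.exists_sq_eq_prime_iff_of_mod_four_eq_three (p := p) (q := q) (by omega) (by omega) hpq
    interval_cases j
    · interval_cases i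
      · have := dp ℓ (by simpa using h1)
        exact hlp (by simpa using this)
      · have := dq (ℓ * 2) (by simpa using h1)
        push_cast at this
        exact n2q (isSquare_of_mul hlq0 hlq this)
    · have e1 : IsSquare (((ℓ * 2 ^ i * p : ℤ)) : ZMod q) := dq _ (by
        convert h1 using 1; push_cast; ring)
      have e2 : IsSquare (((ℓ * 2 ^ i * 2 * q : ℤ)) : ZMod p) := dp _ (by
        have h2 : QRep (2 * (p * q)) ((2 * (p * q) : ℕ) : ℚ) := ⟨0, 1, by ring⟩
        apply QRep.of_mul_sq (x := (p : ℚ)) (by exact_mod_cast hp.ne_zero)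
        convert h1.mul h2 using 1
        push_cast; ring)
      push_cast at e1 e2
      interval_cases i
      · rw [pow_zero, mul_one] at e1 e2
        have f1 : IsSquare (p : ZMod q) := isSquare_of_mul hlq0 hlq e1
        have f2 : IsSquare (q : ZMod p) :=
          isSquare_of_mul (mul_ne_zero hlp0 h2p0) (isSquare_mul_nn hlp n2p) e2
        exact hqr.1 f2 f1
      · rw [pow_one] at e1 e2
        have f1 : ¬ IsSquare (p : ZMod q) := fun f => by
          rw [mul_assoc] at e1
          have := isSquare_of_mul hlq0 hlq e1
          rw [mul_comm] at this
          exact n2q (isSquare_of_mul hpq0 f this)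
        have f2 : ¬ IsSquare (q : ZMod p) := fun f => by
          have hq0' : (q : ZMod p) ≠ 0 := by
            rw [Ne, ZMod.natCast_eq_zero_iff, Nat.prime_dvd_prime_iff_eq hp hq]; exact hpq
          have e3 : (ℓ : ZMod p) * 2 * 2 * q = (2 * 2 * q) * ℓ := by ring
          rw [e3] at e2
          exact hlp (isSquare_of_mul (mul_ne_zero (mul_ne_zero h2p0 h2p0) hq0')
            (IsSquare.mul ⟨2, rfl⟩ f) e2)
        exact f2 (hqr.2 f1)

end X0pq

open NumberField
open scoped nonZeroDivisors

theorem thue (p : ℕ) (hp : p.Prime) (t : ZMod p) : ∃ x y : ℤ, ((x : ZMod p) = t * y) ∧ x ^ 2 < p ∧ y ^ 2 < p ∧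
    (x ≠ 0 ∨ y ≠ 0) := by
  haveI := Fact.mk hp
  set s := Nat.sqrt p with hs
  have hs1 : p < (s + 1) * (s + 1) := Nat.lt_succ_sqrt p
  have hs2 : s * s < p := by
    refine lt_of_le_of_ne (Nat.sqrt_le p) fun h => ?_
    have h2 : IsSquare p := ⟨s, h.symm⟩
    exact hp.prime.irreducible.not_isSquare h2
  let f : ℕ × ℕ → ZMod p := fun z => (z.1 : ZMod p) - t * z.2
  obtain ⟨u, hu, v, hv, huv, he⟩ := Finset.exists_ne_map_eq_of_card_lt_of_maps_to
    (s := Finset.range (s + 1) ×ˢ Finset.range (s + 1)) (t := (Finset.univ : Finset (ZMod p)))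
    (by rw [Finset.card_product, Finset.card_range, Finset.card_univ, ZMod.card]; exact hs1)
    (f := f) (fun _ _ => Finset.mem_coe.2 (Finset.mem_univ _))
  simp only [Finset.mem_product, Finset.mem_range] at hu hv
  have hlt : ∀ a b : ℕ, a < s + 1 → b < s + 1 → ((a : ℤ) - b) ^ 2 < p := by
    intro a b ha hb
    have h3 : (s : ℤ) * s < p := by exact_mod_cast hs2
    have h1 : (a : ℤ) - b ≤ s := by omega
    have h2 : -(s : ℤ) ≤ (a : ℤ) - b := by omega
    nlinarith
  refine ⟨u.1 - v.1, u.2 - v.2, ?_, hlt _ _ hu.1 hv.1, hlt _ _ hu.2 hv.2, ?_⟩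
  · push_cast
    simp only [f] at he
    linear_combination he
  · by_contra h
    push Not at h
    apply huv
    ext <;> omega

theorem p_rep (p : ℕ) (hp : p.Prime) (hp8 : p % 8 = 1) : ∃ a b : ℤ, (p : ℤ) = a ^ 2 - 2 * b ^ 2 := by
  haveI := Fact.mk hp
  have hp2 : p ≠ 2 := by omega
  obtain ⟨t, ht⟩ := (two_sq p hp2).2 (Or.inl hp8)
  obtain ⟨x, y, hxy, hx, hy, h0⟩ := thue p hp t
  have hd : (p : ℤ) ∣ x ^ 2 - 2 * y ^ 2 := by
    rw [← ZMod.intCast_zmod_eq_zero_iff_dvd]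
    push_cast
    rw [hxy]
    linear_combination -(y : ZMod p) ^ 2 * ht
  obtain ⟨k, hk⟩ := hd
  have hp0 : (0 : ℤ) < p := by exact_mod_cast hp.pos
  have hk1 : k < 1 := by
    by_contra h
    push Not at h
    nlinarith [sq_nonneg y]
  have hk2 : -2 < k := by
    by_contra h
    push Not at h
    nlinarith [sq_nonneg x]
  have hk0 : k ≠ 0 := by
    rintro rfl
    have h1 : x ^ 2 = 2 * y ^ 2 := by linarith
    have hy0 : y ≠ 0 := by
      rintro rfl
      rcases h0 with h0 | h0
      · exact h0 (by simpa using h1)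
      · exact h0 rfl
    have h2 : (2 : ℝ) = ((x : ℝ) / y) ^ 2 := by
      have : (x : ℝ) ^ 2 = 2 * y ^ 2 := by exact_mod_cast h1
      have hy' : (y : ℝ) ≠ 0 := by exact_mod_cast hy0
      field_simp; linarith
    apply irrational_sqrt_two
    rw [h2, Real.sqrt_sq_eq_abs]
    exact ⟨|(x : ℚ) / y|, by push_cast; rfl⟩
  have : k = -1 := by omega
  subst this
  exact ⟨x + 2 * y, x + y, by linear_combination hk⟩

theorem b_sq (p : ℕ) [Fact p.Prime] (hp8 : p % 8 = 1) (a b : ℤ) (h : (p : ℤ) = a ^ 2 - 2 * b ^ 2)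
    (hb : ¬ (p : ℤ) ∣ b) : IsSquare ((b : ℤ) : ZMod p) := by
  have hp := Fact.out (p := p.Prime)
  have hp2 : p ≠ 2 := by omega
  have hbn : b.natAbs ≠ 0 := by
    intro h; apply hb; rw [Int.natAbs_eq_zero.1 h]; exact dvd_zero _
  obtain ⟨k, m, hm, hbm⟩ := Nat.exists_eq_two_pow_mul_odd hbn
  have hm1 : IsSquare ((m : ℤ) : ZMod p) := by
    have hm0 : (((m : ℕ) : ℤ) : ZMod p) ≠ 0 := by
      rw [Ne, ZMod.intCast_zmod_eq_zero_iff_dvd]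
      intro h
      apply hb
      rw [← Int.dvd_natAbs, hbm]
      push_cast
      exact Dvd.dvd.mul_left h _
    rw [← legendreSym.eq_one_iff p hm0, jacobiSym.legendreSym.to_jacobiSym,
      jacobiSym.quadratic_reciprocity_one_mod_four' hm (by omega)]
    have hmb : (m : ℤ) ∣ b := by
      rw [← Int.dvd_natAbs, hbm]; exact_mod_cast Dvd.intro_left _ rfl
    rw [jacobiSym.mod_left' (a₂ := a ^ 2)]
    · apply jacobiSym.sq_one'
      by_contra hg
      obtain ⟨r, hr, hrd⟩ := Nat.exists_prime_and_dvd hg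
      have h1 : (r : ℤ) ∣ a := (Int.natCast_dvd_natCast.2 hrd).trans (Int.gcd_dvd_left _ _)
      have h2 : (r : ℤ) ∣ b := ((Int.natCast_dvd_natCast.2 hrd).trans (Int.gcd_dvd_right _ _)).trans hmb
      obtain ⟨a', rfl⟩ := h1
      obtain ⟨b', rfl⟩ := h2
      have h3 : (p : ℤ) = r ^ 2 * (a' ^ 2 - 2 * b' ^ 2) := by rw [h]; ring
      have h4 : r ∣ p := by
        have : (r : ℤ) ∣ p := by rw [h3]; exact Dvd.dvd.mul_right (dvd_pow_self _ two_ne_zero) _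
        exact_mod_cast this
      rw [Nat.prime_dvd_prime_iff_eq hr hp] at h4
      subst h4
      exact hb (Dvd.intro _ rfl)
    · rw [h]
      apply Int.ModEq.symm
      rw [Int.modEq_iff_dvd]
      have : a ^ 2 - 2 * b ^ 2 - a ^ 2 = b * (-2 * b) := by ring
      rw [this]
      exact hmb.mul_right _
  have h2 : IsSquare (2 : ZMod p) := (two_sq p hp2).2 (Or.inl hp8)
  have hn : IsSquare (-1 : ZMod p) := by rw [ZMod.exists_sq_eq_neg_one_iff]; omega
  have hn' : IsSquare ((b.natAbs : ℤ) : ZMod p) := by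
    rw [hbm]
    push_cast
    exact (h2.pow k).mul (by simpa using hm1)
  rcases Int.natAbs_eq b with h | h
  · rw [h]; exact hn'
  · rw [h, Int.cast_neg, neg_eq_neg_one_mul]; exact hn.mul hn'

theorem a_sq (p : ℕ) (hp : p.Prime) (hp8 : p % 8 = 1) (x : ZMod p) (hx : x ^ 4 = 2) (a b : ℤ)
    (h : (p : ℤ) = a ^ 2 - 2 * b ^ 2) : IsSquare ((a.natAbs : ℕ) : ZMod p) ∧ ((a.natAbs : ℕ) : ZMod p) ≠ 0 := by
  haveI := Fact.mk hp
  have hp' : Prime (p : ℤ) := Nat.prime_iff_prime_int.1 hp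
  have hp2 : p ≠ 2 := by omega
  have ha : ¬ (p : ℤ) ∣ a := by
    intro ha
    have h1 : (p : ℤ) ∣ 2 * b ^ 2 := by
      have : 2 * b ^ 2 = a * a - p := by linarith
      rw [this]
      exact dvd_sub (ha.mul_left _) dvd_rfl
    rcases hp'.dvd_or_dvd h1 with h2 | h2
    · have : p ∣ 2 := by exact_mod_cast h2
      exact hp2 ((Nat.prime_dvd_prime_iff_eq hp Nat.prime_two).1 this)
    · obtain ⟨b', rfl⟩ := hp'.dvd_of_dvd_pow h2
      obtain ⟨a', rfl⟩ := ha
      have h3 : (p : ℤ) * 1 = p * (p * (a' ^ 2 - 2 * b' ^ 2)) := by linear_combination h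
      have h4 := mul_left_cancel₀ hp'.ne_zero h3
      exact hp'.not_unit (IsUnit.of_mul_eq_one _ h4.symm)
  have hb : ¬ (p : ℤ) ∣ b := by
    intro hb
    apply ha
    apply hp'.dvd_of_dvd_pow (n := 2)
    have : a ^ 2 = p + b * (2 * b) := by linarith
    rw [this]
    exact dvd_add dvd_rfl (hb.mul_right _)
  have hbs := b_sq p hp8 a b h hb
  have hn : IsSquare (-1 : ZMod p) := by rw [ZMod.exists_sq_eq_neg_one_iff]; omega
  have e : ((a : ZMod p)) ^ 2 = (x ^ 2 * b) ^ 2 := by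
    have h1 : ((p : ℤ) : ZMod p) = ((a ^ 2 - 2 * b ^ 2 : ℤ) : ZMod p) := by rw [h]
    push_cast at h1
    rw [ZMod.natCast_self] at h1
    linear_combination -h1 - (b : ZMod p) ^ 2 * hx
  have hx2 : IsSquare (x ^ 2 * b) := IsSquare.mul ⟨x, by ring⟩ hbs
  have has : IsSquare ((a : ℤ) : ZMod p) := by
    rcases sq_eq_sq_iff_eq_or_eq_neg.1 e with e | e
    · rw [e]; exact hx2
    · rw [e, neg_eq_neg_one_mul]; exact hn.mul hx2
  constructor
  · have h3 : ((a.natAbs : ℕ) : ZMod p) = (((a.natAbs : ℕ) : ℤ) : ZMod p) := by simp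
    rw [h3]
    rcases Int.natAbs_eq a with h | h
    · rw [← h]; exact has
    · have : ((a.natAbs : ℕ) : ℤ) = -a := by omega
      rw [this, Int.cast_neg, neg_eq_neg_one_mul]; exact hn.mul has
  · rw [Ne, ZMod.natCast_eq_zero_iff]
    intro h'
    exact ha (Int.natCast_dvd.2 h')

open NumberField
open scoped nonZeroDivisors

theorem grp_cyc {A : Type*} [CommGroup A] [Finite A] (hA : IsPGroup 2 A) (l : A)
    (hl : ∀ x : A, x ^ 2 = 1 → x = 1 ∨ x = l) (y : A) (hy : y ^ 4 = 1) (h8 : 8 ≤ Nat.card A) :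
    ∃ z, y = z ^ 2 := by
  by_contra hns
  set f : A →* A := powMonoidHom 2 with hf
  have hker : Nat.card f.ker ≤ 2 := by
    have : Set.ncard (f.ker : Set A) ≤ Set.ncard ({1, l} : Set A) := by
      apply Set.ncard_le_ncard _ (Set.toFinite _)
      intro x hx
      exact hl x (by simpa [hf] using hx)
    refine le_trans ?_ (this.trans ((Set.ncard_insert_le _ _).trans (by rw [Set.ncard_singleton])))
    rw [← Nat.card_coe_set_eq]
    rfl
  have h1 : Nat.card f.ker * Nat.card f.range = Nat.card A := by
    have h2 := Subgroup.card_mul_index f.ker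
    rwa [Subgroup.index_ker] at h2
  have h2 : Nat.card f.range * f.range.index = Nat.card A := Subgroup.card_mul_index _
  have hidx : f.range.index = Nat.card f.ker := by
    have hpos : 0 < Nat.card f.range := Nat.card_pos
    apply Nat.eq_of_mul_eq_mul_left hpos
    rw [h2, ← h1, mul_comm]
  have hyr : y ∉ f.range := by
    rintro ⟨z, hz⟩
    exact hns ⟨z, by rw [← hz]; rfl⟩
  have hidx2 : f.range.index = 2 := by
    have h3 : f.range.index ≠ 1 := by
      rw [Ne, Subgroup.index_eq_one]
      intro h; apply hyr; rw [h]; trivial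
    have h4 : f.range.index ≠ 0 := Subgroup.index_ne_zero_of_finite
    omega
  have key : ∀ a : A, ∃ (i : ℤ) (z : A), a = y ^ i * z ^ 2 := by
    intro a
    by_cases ha : a ∈ f.range
    · obtain ⟨z, rfl⟩ := ha
      exact ⟨0, z, by rw [zpow_zero, one_mul]; rfl⟩
    · have h5 : a * y ∈ f.range := (Subgroup.mul_mem_iff_of_index_two hidx2).2 (by tauto)
      obtain ⟨z, hz⟩ := h5
      refine ⟨-1, z, ?_⟩
      have hz' : z ^ 2 = a * y := hz
      rw [hz', zpow_neg_one, mul_comm a y, inv_mul_cancel_left]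
  have key2 : ∀ k : ℕ, ∀ a : A, ∃ (i : ℤ) (z : A), a = y ^ i * z ^ 2 ^ k := by
    intro k
    induction k with
    | zero => intro a; exact ⟨0, a, by simp⟩
    | succ k ih =>
      intro a
      obtain ⟨i, z, rfl⟩ := ih a
      obtain ⟨j, w, rfl⟩ := key z
      refine ⟨i + j * 2 ^ k, w, ?_⟩
      have e1 : (2 : ℕ) ^ (k + 1) = 2 * 2 ^ k := by ring
      have e2 : (y ^ j) ^ (2 ^ k : ℕ) = (y ^ j) ^ ((2 : ℤ) ^ k) := by
        rw [← zpow_natCast]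
        push_cast
        rfl
      rw [mul_pow, ← pow_mul, ← e1, zpow_add, zpow_mul, mul_assoc, e2]
  haveI : Fact (Nat.Prime 2) := ⟨Nat.prime_two⟩
  obtain ⟨n, hn⟩ := IsPGroup.iff_card.1 hA
  have h6 : Subgroup.zpowers y = ⊤ := by
    rw [eq_top_iff]
    intro a _
    obtain ⟨i, z, rfl⟩ := key2 n a
    rw [← hn, pow_card_eq_one', mul_one]
    exact ⟨i, rfl⟩
  have h7 := Nat.card_zpowers y
  rw [h6, Subgroup.card_top] at h7
  have := Nat.le_of_dvd (by norm_num) (orderOf_dvd_of_pow_eq_one hy)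
  omega

section X0p
variable {F K : Type*} [Field F] [Field K] [NumberField F] [NumberField K] [Algebra F K]
  {τ : K →+* K} {θ : 𝓞 K}

theorem x0_J {R : Type*} [CommRing R] (p a b : ℤ) (h : p = a ^ 2 - 2 * b ^ 2) (hc : IsCoprime (a ^ 2) (8 * b))
    (θ : R) (hθ : θ ^ 2 = -(2 * p : R)) :
    Ideal.span {(2 : R), θ} * Ideal.span {(a : R), 2 * b + θ} ^ 2 = Ideal.span {2 * (b : R) + θ} := by
  obtain ⟨u, v, huv⟩ := hc
  have h1 : (u : R) * a ^ 2 + v * (8 * b) = 1 := by exact_mod_cast congrArg (Int.cast : ℤ → R) huv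
  have hp : (p : R) = a ^ 2 - 2 * b ^ 2 := by exact_mod_cast congrArg (Int.cast : ℤ → R) h
  have h2 : (2 : R) ∈ Ideal.span {(2 : R), θ} := Ideal.subset_span (by simp)
  have ht : θ ∈ Ideal.span {(2 : R), θ} := Ideal.subset_span (by simp)
  have ha : (a : R) ∈ Ideal.span {(a : R), 2 * b + θ} := Ideal.subset_span (by simp)
  have hb : 2 * b + θ ∈ Ideal.span {(a : R), 2 * b + θ} := Ideal.subset_span (by simp)
  apply le_antisymm
  · rw [pow_two, Ideal.span_pair_mul_span_pair, Ideal.span_mul_span, Ideal.span_le]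
    intro x hx
    rw [SetLike.mem_coe, Ideal.mem_span_singleton]
    rw [Set.mem_mul] at hx
    obtain ⟨y, hy, z, hz, rfl⟩ := hx
    simp only [Set.mem_insert_iff, Set.mem_singleton_iff] at hy hz
    have e2 : 2 * b + θ ∣ 2 * ((a : R) * a) := ⟨2 * b - θ, by linear_combination hθ - 2 * hp⟩
    have et : 2 * b + θ ∣ θ * ((a : R) * a) := by
      have : θ * ((a : R) * a) = (2 * b + θ) * a ^ 2 - b * (2 * (a * a)) := by ring
      rw [this]
      exact dvd_sub (Dvd.intro _ rfl) (e2.mul_left _)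
    have e3 : ∀ y w : R, 2 * b + θ ∣ y * (w * (2 * b + θ)) := fun y w => ⟨y * w, by ring⟩
    have e4 : ∀ y w : R, 2 * b + θ ∣ y * ((2 * b + θ) * w) := fun y w => ⟨y * w, by ring⟩
    rcases hz with rfl | rfl | rfl | rfl
    · rcases hy with rfl | rfl
      · exact e2
      · exact et
    · exact e3 _ _
    · exact e4 _ _
    · exact e3 _ _
  · rw [Ideal.span_singleton_le_iff_mem]
    have hm : ∀ y z w : R, y ∈ Ideal.span {(2 : R), θ} → z ∈ Ideal.span {(a : R), 2 * b + θ} →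
      w ∈ Ideal.span {(a : R), 2 * b + θ} → y * (z * w) ∈
        Ideal.span {(2 : R), θ} * Ideal.span {(a : R), 2 * b + θ} ^ 2 := by
      intro y z w hy hz hw
      rw [pow_two]
      exact Ideal.mul_mem_mul hy (Ideal.mul_mem_mul hz hw)
    have m1 := hm _ _ _ h2 ha ha
    have m2 := hm _ _ _ ht ha ha
    have m3 := hm _ _ _ h2 hb hb
    have hfin := Ideal.add_mem _ (Ideal.add_mem _ (Ideal.mul_mem_left _ (u * b + 2 * v : R) m1)
      (Ideal.mul_mem_left _ (u : R) m2)) (Ideal.mul_mem_left _ (v : R) m3)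
    convert hfin using 1
    linear_combination (-(2 * (b : R) + θ)) * h1 - 2 * v * hθ + 4 * v * hp

theorem x0_p (p : ℕ) (hp : p.Prime) (hp16 : p % 16 = 9) (x : ZMod p) (hx : x ^ 4 = 2)
    (hF : RatF F) (s : Layer F τ 0 θ (2 * p)) {l : Ideal (𝓞 K)} (hl : Two F τ 0 l) :
    cl l ≠ 1 ∧ (∀ y ∈ CommGroup.primaryComponent (ClassGroup (𝓞 K)) 2, cl l = y ^ 2 → ∃ z, y = z ^ 2) ∧
     8 ≤ Nat.card (CommGroup.primaryComponent (ClassGroup (𝓞 K)) 2) := by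
  haveI := Fact.mk hp
  have hp2 : p ≠ 2 := by omega
  have hp0 := hp.pos
  have hpodd : Odd p := hp.odd_of_ne_two hp2
  have hsf : Squarefree (2 * p) := by
    rw [Nat.squarefree_mul ((Nat.coprime_primes Nat.prime_two hp).2 (Ne.symm hp2))]
    exact ⟨Nat.prime_two.squarefree, hp.squarefree⟩
  have hpD : ¬ p ^ 2 ∣ 2 * p := fun h => by
    rw [pow_two] at h
    exact hp.one_lt.ne' (Nat.isUnit_iff.1 (hsf p h))
  have hl0 := hl.ram.ne
  have hNl := hl.absNorm s
  have hll := x0_l s hpodd hl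
  have hlsq := s.l_sq hl
  have hl1 : cl l ≠ 1 := by
    intro h
    obtain ⟨x, -, hx⟩ := (cl_eq_one_iff hl0).1 h
    obtain ⟨U, V, hUV⟩ := x0_int hF s hsf x
    rw [← hx, hNl] at hUV
    push_cast at hUV
    have h9 : (9 : ℤ) ≤ p := by omega
    have hV : V = 0 := by
      by_contra hV
      have h1 : 1 ≤ V ^ 2 := by have := sq_pos_of_ne_zero hV; omega
      nlinarith [sq_nonneg U]
    rw [hV] at hUV
    have h3 : U < 3 := by nlinarith
    have h4 : -3 < U := by nlinarith
    interval_cases U <;> omega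
  have h8 : 8 ≤ Nat.card (CommGroup.primaryComponent (ClassGroup (𝓞 K)) 2) := by
    obtain ⟨a, b, hab⟩ := p_rep p hp (by omega)
    obtain ⟨has, ha0⟩ := a_sq p hp (by omega) x hx a b hab
    have hcop : IsCoprime (a ^ 2) (8 * b) := by
      have haodd : Odd a := by
        rw [← Int.odd_pow' two_ne_zero]
        have : Odd (p : ℤ) := by exact_mod_cast hpodd
        have h2 : a ^ 2 = p + 2 * b ^ 2 := by linarith
        rw [h2]
        exact this.add_even (even_two_mul _)
      have h8 : IsCoprime (a ^ 2) 8 := by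
        have h3 : IsCoprime a 2 := Int.isCoprime_two_right.2 haodd
        have : (8 : ℤ) = 2 ^ 3 := by norm_num
        rw [this]; exact h3.pow
      refine IsCoprime.mul_right h8 ?_
      apply IsCoprime.pow_left
      rw [Int.isCoprime_iff_gcd_eq_one]
      by_contra hg
      obtain ⟨r, hr, hrd⟩ := Nat.exists_prime_and_dvd hg
      have h1 : (r : ℤ) ∣ a := (Int.natCast_dvd_natCast.2 hrd).trans (Int.gcd_dvd_left _ _)
      have h2 : (r : ℤ) ∣ b := (Int.natCast_dvd_natCast.2 hrd).trans (Int.gcd_dvd_right _ _)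
      obtain ⟨a', rfl⟩ := h1
      obtain ⟨b', rfl⟩ := h2
      have h3 : (p : ℤ) = r * r * (a' ^ 2 - 2 * b' ^ 2) := by rw [hab]; ring
      have h4 : r * r ∣ p := by
        have : (r : ℤ) * r ∣ p := by rw [h3]; exact Dvd.intro _ rfl
        exact_mod_cast this
      exact hr.one_lt.ne' (Nat.isUnit_iff.1 (hp.squarefree r h4))
    have hJ := x0_J (R := 𝓞 K) (p : ℤ) a b hab hcop θ (by rw [s.hθ]; push_cast; ring)
    rw [← hll] at hJ
    set J := Ideal.span {(a : 𝓞 K), 2 * b + θ} with hJdef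
    set β : 𝓞 K := 2 * b + θ with hβ
    have hββ : β * sg τ β = algebraMap (𝓞 F) (𝓞 K) ((2 * a ^ 2 : ℤ) : 𝓞 F) := by
      rw [hβ, map_add, s.sgt]
      have h2 : (p : 𝓞 K) = a ^ 2 - 2 * b ^ 2 := by exact_mod_cast congrArg (Int.cast : ℤ → 𝓞 K) hab
      have h3 := s.hθ
      simp only [map_mul, map_intCast, map_ofNat]
      push_cast at h3 ⊢
      linear_combination -h3 + 2 * h2
    have haz : a ≠ 0 := by rintro rfl; simp at ha0
    have hNβ : Ideal.absNorm (Ideal.span {β}) = 2 * a.natAbs ^ 2 := by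
      have h1 := congrArg (fun z : 𝓞 K => Ideal.absNorm (Ideal.span {z})) hββ
      have hm : ∀ y : 𝓞 F, Ideal.absNorm (Ideal.span {algebraMap (𝓞 F) (𝓞 K) y}) =
          Ideal.absNorm (Ideal.span {y}) ^ 2 := by
        intro y
        rw [← Set.image_singleton, ← Ideal.map_span, s.q.absNorm_map]
      rw [← Ideal.span_singleton_mul_span_singleton, map_mul, s.q.absNorm_sg, hm,
        hF.absNorm_int, ← pow_two] at h1
      have := Nat.pow_left_injective two_ne_zero h1
      rw [this, Int.natAbs_mul, Int.natAbs_pow]; rfl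
    have hNJ : Ideal.absNorm J = a.natAbs := by
      have h1 := congrArg Ideal.absNorm hJ
      rw [map_mul, map_pow, hNl, hNβ] at h1
      exact Nat.pow_left_injective two_ne_zero (Nat.eq_of_mul_eq_mul_left two_pos h1)
    have hJ0 : J ≠ 0 := by
      intro h
      rw [h, Submodule.zero_eq_bot, Ideal.absNorm_bot] at hNJ
      exact haz (Int.natAbs_eq_zero.1 hNJ.symm)
    have hcJ : cl l * cl J ^ 2 = 1 := by
      rw [← cl_pow hJ0, ← cl_mul hl0 (pow_ne_zero _ hJ0), hJ, cl_span]
    have hcJ2 : cl J ^ 2 = cl l := by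
      rw [← mul_right_inj (cl l), hcJ, ← pow_two, hlsq]
    obtain ⟨ℓ, hE, hlp⟩ := p_ell p hp hp16 0
    obtain ⟨Q, hQ0, hQ⟩ := x0_g hF s hE
    refine grp8_p (cl J) (cl Q) ?_ ?_ ?_
    · have : (4 : ℕ) = 2 * 2 := rfl
      rw [this, pow_mul, hcJ2, hlsq]
    · rw [hcJ2]; exact hl1
    · intro m i hm h
      rw [← cl_pow hJ0] at h
      have h1 := x0_pow s (by positivity) hE.prime.ne_zero hQ0 hQ (pow_ne_zero _ hJ0) m hm h
      rw [map_pow, hNJ] at h1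
      refine not_qrep p hp _ (Dvd.intro_left _ rfl) hpD ((ℓ * a.natAbs ^ i : ℕ) : ℤ) ?_ (by
        rw [Int.cast_natCast, Nat.cast_mul]
        exact h1)
      rw [Int.cast_natCast, Nat.cast_mul, Nat.cast_pow, mul_comm]
      exact not_isSquare_mul (pow_ne_zero _ ha0) (has.pow i) hlp
  refine ⟨hl1, ?_, h8⟩
  -- torsion
  have hcop : IsCoprime (p : ℤ) (2 : ℤ) := by
    rw [Int.isCoprime_iff_nat_coprime]
    exact (Nat.coprime_primes hp Nat.prime_two).2 hp2
  have hP := pair_sq (R := 𝓞 K) (p : ℤ) (2 : ℤ) hcop θ (by rw [s.hθ]; push_cast; ring)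
  set P := Ideal.span {((p : ℤ) : 𝓞 K), θ} with hPdef
  have hP0 : P ≠ 0 := by
    intro h
    rw [h, zero_pow two_ne_zero, eq_comm, Submodule.zero_eq_bot, Ideal.span_singleton_eq_bot] at hP
    exact hp.ne_zero (by exact_mod_cast hP)
  have hlP : l * P = Ideal.span {θ} := by
    apply pow_left_injective two_ne_zero
    change (l * P) ^ 2 = Ideal.span {θ} ^ 2
    rw [mul_pow, hP, hl.sq2, Ideal.span_singleton_mul_span_singleton, Ideal.span_singleton_pow, s.hθ,
      Ideal.span_singleton_neg]
    congr 2
    rw [add_zero, map_ofNat]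
    push_cast
    ring
  have hcP : cl P = cl l := by
    rw [← mul_right_inj (cl l), ← cl_mul hl0 hP0, hlP, cl_span, ← pow_two, hlsq]
  have htors : ∀ z : ClassGroup (𝓞 K), z ^ 2 = 1 → z = 1 ∨ z = cl l := by
    intro z hz
    have hpw : ∀ k : ℕ, (cl l ^ k) ^ 2 = 1 := fun k => by rw [← pow_mul, mul_comm, pow_mul, hlsq, one_pow]
    obtain ⟨i, j, h⟩ := s.tors (cl l) (cl l) hlsq (hpw _) (by
      intro Q hQ
      left
      have h2θ := hQ.diff θ
      rw [s.sgt, sub_neg_eq_add, ← two_mul] at h2θ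
      rcases hQ.prime.mem_or_mem h2θ with h2 | hθQ
      · rw [hl.uniq Q hQ.prime h2]
      have h3 : (2 : 𝓞 K) * p ∈ Q := by
        have : (2 : 𝓞 K) * p = -θ * θ := by
          have h3 := s.hθ
          push_cast at h3
          linear_combination h3
        rw [this]
        exact Q.mul_mem_left _ hθQ
      rcases hQ.prime.mem_or_mem h3 with h2 | hpQ
      · rw [hl.uniq Q hQ.prime h2]
      rw [← hcP]
      congr 1
      apply pow_left_injective two_ne_zero
      change Q ^ 2 = P ^ 2
      rw [hP, ← hQ.sq]
      have hpr : (Ideal.span {((p : ℤ) : 𝓞 F)}).IsPrime := by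
        apply Ideal.isPrime_of_irreducible_absNorm
        rw [hF.absNorm_int, Int.natAbs_natCast]
        exact hp
      have hpm : (Ideal.span {((p : ℤ) : 𝓞 F)}).IsMaximal := hpr.isMaximal (by
        rw [Ne, Ideal.span_singleton_eq_bot]
        exact_mod_cast hp.ne_zero)
      have hQp := hQ.prime.comap (algebraMap (𝓞 F) (𝓞 K))
      have := hpm.eq_of_le hQp.ne_top (by
        rw [Ideal.span_singleton_le_iff_mem, Ideal.mem_comap, map_intCast]
        simpa using hpQ)
      rw [← this, Ideal.map_span, Set.image_singleton, map_intCast]) z hz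
    rw [← zpow_natCast, ← zpow_mul, ← zpow_add] at h
    rcases Int.even_or_odd' (i + (Nat.card (ClassGroup (𝓞 F)) : ℤ) * j) with ⟨k, hk | hk⟩
    · left
      rw [h, hk, zpow_mul, zpow_ofNat, hlsq, one_zpow]
    · right
      rw [h, hk, zpow_add, zpow_mul, zpow_ofNat, hlsq, one_zpow, one_mul, zpow_one]
  intro y hy hly
  obtain ⟨z, hz⟩ := grp_cyc (A := CommGroup.primaryComponent (ClassGroup (𝓞 K)) 2)
    CommGroup.primaryComponent.isPGroup ⟨cl l, pc_two hlsq⟩ (by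
      intro z hz
      have h1 : (z : ClassGroup (𝓞 K)) ^ 2 = 1 := congrArg Subtype.val hz
      rcases htors _ h1 with h2 | h2
      · left; exact Subtype.ext h2
      · right; exact Subtype.ext h2) ⟨y, hy⟩ (by
      apply Subtype.ext
      change y ^ 4 = 1
      have : (4 : ℕ) = 2 * 2 := rfl
      rw [this, pow_mul, ← hly, hlsq]) h8
  exact ⟨z, congrArg Subtype.val hz⟩

end X0p

open NumberField
open scoped nonZeroDivisors

theorem exists_zeta (p : ℕ) [Fact p.Prime] (hp : p % 16 = 9) : ∃ z : ZMod p, z ^ 4 = -1 := by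
  obtain ⟨i, hi⟩ := ZMod.exists_sq_eq_neg_one_iff (p := p) |>.2 (by omega)
  have hi0 : i ≠ 0 := by rintro rfl; simp at hi
  obtain ⟨z, hz⟩ := (ZMod.euler_criterion p hi0).2 (by
    obtain ⟨k, hk⟩ : ∃ k, p / 2 = 4 * k := ⟨p / 8, by omega⟩
    rw [hk, pow_mul]
    have : i ^ 4 = 1 := by
      have : i ^ 4 = (i * i) * (i * i) := by ring
      rw [this, ← hi]; ring
    rw [this, one_pow])
  refine ⟨z, ?_⟩
  have : z ^ 4 = (z * z) * (z * z) := by ring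
  rw [this, ← hz, ← hi]

theorem zeta_c {k : Type*} [Field k] (p : ℕ) [Fact p.Prime] [CharP k p] (hp : p % 16 = 9)
    (c : k) (hc : c ^ 2 = 2) : ∃ z : ZMod p, z ^ 4 = -1 ∧
      c = ZMod.castHom (dvd_refl p) k z + (ZMod.castHom (dvd_refl p) k z)⁻¹ := by
  obtain ⟨z, hz⟩ := exists_zeta p hp
  have hz0 : z ≠ 0 := by rintro rfl; simp at hz
  set f := ZMod.castHom (dvd_refl p) k
  have hf0 : f z ≠ 0 := (map_ne_zero f).2 hz0
  have hf4 : f z ^ 4 = -1 := by rw [← map_pow, hz, map_neg, map_one]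
  have h1 : (f z + (f z)⁻¹) ^ 2 = c ^ 2 := by
    rw [hc]
    field_simp
    linear_combination hf4
  rcases sq_eq_sq_iff_eq_or_eq_neg.1 h1 with h | h
  · exact ⟨z, hz, h.symm⟩
  · refine ⟨-z, by rw [← hz]; ring, ?_⟩
    rw [map_neg, inv_neg]
    linear_combination h

theorem pp_field {k : Type*} [Field k] (p : ℕ) [Fact p.Prime] [CharP k p] (hp : p % 16 = 9)
    (hfr : ∀ x : k, x ^ p = x) (c : k) (hc : c ^ 2 = 2) (x : k) : x ^ 2 ≠ 2 + c := by
  intro hx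
  obtain ⟨z, hz, hcz⟩ := zeta_c p hp c hc
  set f := ZMod.castHom (dvd_refl p) k
  have hz0 : z ≠ 0 := by rintro rfl; simp at hz
  have hf0 : f z ≠ 0 := (map_ne_zero f).2 hz0
  have hf4 : f z ^ 4 = -1 := by rw [← map_pow, hz, map_neg, map_one]
  have h2 : (2 : k) ≠ 0 := by
    intro h
    have : ((2 : ℕ) : k) = 0 := by exact_mod_cast h
    rw [CharP.cast_eq_zero_iff k p] at this
    have := Nat.le_of_dvd two_pos this
    omega
  have hfr' : ∀ y : k, y ≠ 0 → y ^ (p - 1) = 1 := by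
    intro y hy
    apply mul_right_cancel₀ hy
    rw [← pow_succ, Nat.sub_add_cancel (by omega), hfr, one_mul]
  have h1 : f z * x ^ 2 = (1 + f z) ^ 2 := by
    rw [hx, hcz]
    field_simp
    ring
  have hz1 : 1 + f z ≠ 0 := by
    intro h
    have h3 : f z = -1 := by linear_combination h
    rw [h3] at hf4
    apply h2
    linear_combination hf4
  have hx0 : x ≠ 0 := by
    rintro rfl
    rw [zero_pow two_ne_zero, mul_zero] at h1
    exact hz1 (pow_eq_zero_iff two_ne_zero |>.1 h1.symm)
  obtain ⟨m, hm⟩ : ∃ m, p - 1 = 2 * (4 * (2 * m + 1)) := ⟨p / 16, by omega⟩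
  have h3 := congrArg (fun t => t ^ (4 * (2 * m + 1))) h1
  simp only [mul_pow] at h3
  rw [← pow_mul x, ← pow_mul (1 + f z), ← hm, hfr' _ hx0, hfr' _ hz1, pow_mul, hf4, mul_one,
    Odd.neg_one_pow ⟨m, rfl⟩] at h3
  apply h2
  linear_combination -h3

/-- the base data: the factorisation of `d` in `F` -/
def Base {F : Type*} [Field F] [NumberField F] (c : 𝓞 F) (d : ℕ) : Prop :=
  ∃ p₁ p₂ : Ideal (𝓞 F), PP c p₁ ∧ PP c p₂ ∧ p₁ ≠ p₂ ∧ Ideal.span {(d : 𝓞 F)} = p₁ * p₂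

theorem Base.nn {F : Type*} [Field F] [NumberField F] {c : 𝓞 F} {d : ℕ} (h : Base c d) (X Y : F) :
    2 + (c : F) ≠ X ^ 2 + d * Y ^ 2 := by
  obtain ⟨p₁, p₂, h1, h2, hne, hd⟩ := h
  have hd1 : (d : 𝓞 F) ∈ p₁ := by
    have : (d : 𝓞 F) ∈ p₁ * p₂ := by
      rw [← hd]; exact Ideal.mem_span_singleton_self _
    exact (Ideal.mul_le_left : p₁ * p₂ ≤ p₁) this
  have hd2 : (d : 𝓞 F) ∉ p₁ ^ 2 := by
    intro hm
    have h4 : p₁ ^ 2 ∣ p₁ * p₂ := by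
      rw [← hd, Ideal.dvd_span_singleton]; exact hm
    rw [pow_two] at h4
    have h5 := (mul_dvd_mul_iff_left h1.ne).1 h4
    have := (h2.prime.isMaximal h2.ne).eq_of_le h1.prime.ne_top (Ideal.le_of_dvd h5)
    exact hne this.symm
  have h3 := not_repr (K := F) p₁ h1.prime (d : 𝓞 F) (2 + c) hd1 hd2 h1.nsp X Y
  have e1 : algebraMap (𝓞 F) F (2 + c) = 2 + (c : F) := by rw [map_add, map_ofNat]
  have e2 : algebraMap (𝓞 F) F (d : 𝓞 F) = (d : F) := map_natCast _ _
  rw [e1, e2] at h3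
  exact h3

theorem FStep.base {F F' : Type*} [Field F] [Field F'] [NumberField F] [NumberField F'] [Algebra F F']
    {σ : F' →+* F'} {c : 𝓞 F} {c' : 𝓞 F'} (s : FStep F σ c c') {d : ℕ} (h : Base c d) : Base c' d := by
  obtain ⟨p₁, p₂, h1, h2, hne, hd⟩ := h
  refine ⟨_, _, s.pp h1, s.pp h2, fun h => hne (s.q.map_inj h), ?_⟩
  rw [← Ideal.map_mul, ← hd, Ideal.map_span, Set.image_singleton, map_natCast]

theorem base_pq {F : Type*} [Field F] [NumberField F] (hF : RatF F) (p q : ℕ) (hp : p.Prime) (hq : q.Prime)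
    (hp8 : p % 8 = 3) (hq8 : q % 8 = 3) (hpq : p ≠ q) : Base (0 : 𝓞 F) (p * q) := by
  have hmem : ∀ (p : ℕ) (z : ℤ), (z : 𝓞 F) ∈ Ideal.span {(p : 𝓞 F)} → (p : ℤ) ∣ z := by
    intro p z h
    obtain ⟨w, hw⟩ := Ideal.mem_span_singleton.1 h
    obtain ⟨y, rfl⟩ := hF.int w
    exact ⟨y, by exact_mod_cast hw⟩
  have key : ∀ p : ℕ, p.Prime → p % 8 = 3 → PP (0 : 𝓞 F) (Ideal.span {(p : 𝓞 F)}) := by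
    intro p hp hp8
    haveI := Fact.mk hp
    have hns : ∀ x : 𝓞 F, x ^ 2 - 2 ∉ Ideal.span {(p : 𝓞 F)} := by
      intro x hx
      obtain ⟨z, rfl⟩ := hF.int x
      have h1 := hmem p (z ^ 2 - 2) (by push_cast; exact hx)
      have h2 : ((z ^ 2 - 2 : ℤ) : ZMod p) = 0 := (ZMod.intCast_zmod_eq_zero_iff_dvd _ _).2 h1
      have h3 : IsSquare (2 : ZMod p) := ⟨z, by push_cast at h2; linear_combination -h2⟩
      rw [two_sq p (by omega)] at h3
      omega
    refine ⟨?_, ?_, ?_, by simpa using hns, by simpa using hns⟩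
    · apply Ideal.isPrime_of_irreducible_absNorm
      have := hF.absNorm_int p
      rw [Int.cast_natCast, Int.natAbs_natCast] at this
      rw [this]; exact hp
    · simpa using hp.ne_zero
    · intro h
      have h1 := hmem p 2 (by exact_mod_cast h)
      have := Int.le_of_dvd two_pos h1
      omega
  refine ⟨_, _, key p hp hp8, key q hq hq8, ?_, ?_⟩
  · intro h
    have h1 : (p : 𝓞 F) ∈ Ideal.span {(q : 𝓞 F)} := h ▸ Ideal.mem_span_singleton_self _
    have h2 := hmem q p (by rw [Int.cast_natCast]; exact h1)
    have h3 := Int.natCast_dvd_natCast.1 h2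
    exact hpq ((Nat.prime_dvd_prime_iff_eq hq hp).1 h3).symm
  · rw [Ideal.span_singleton_mul_span_singleton, Nat.cast_mul]

theorem base_p {F F' : Type*} [Field F] [Field F'] [NumberField F] [NumberField F'] [Algebra F F']
    {σ : F' →+* F'} {c' : 𝓞 F'} (hF : RatF F) (s : FStep F σ 0 c') (p : ℕ) (hp : p.Prime)
    (hp16 : p % 16 = 9) : Base c' p := by
  haveI := Fact.mk hp
  have hodd : Odd p := hp.odd_of_ne_two (by omega)
  have hc2 : c' ^ 2 = 2 := by rw [s.hc, add_zero, map_ofNat]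
  have hfield : ∀ Q : Ideal (𝓞 F'), Q.IsPrime → (p : 𝓞 F') ∈ Q → Q.IsMaximal ∧ CharP (𝓞 F' ⧸ Q) p := by
    intro Q hQ hpQ
    refine ⟨hQ.isMaximal (by rintro rfl; exact hp.ne_zero (by simpa using hpQ)), ?_⟩
    haveI := hQ
    apply (CharP.charP_iff_prime_eq_zero hp).2
    have := Ideal.Quotient.eq_zero_iff_mem.2 hpQ
    simpa using this
  have hmkc : ∀ Q : Ideal (𝓞 F'), (Ideal.Quotient.mk Q c') ^ 2 = 2 := by
    intro Q
    rw [← map_pow, hc2, map_ofNat]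
  have hep : EP F' p := by
    refine (hF.ep p hp).step s.q hp (fun Q hQ hpQ => ?_)
    have h2 := two_notMem hodd Q hQ hpQ
    constructor
    · intro h3
      rcases hQ.mem_or_mem h3 with h4 | h4
      · exact h2 h4
      · apply h2
        rw [← hc2, pow_two]
        exact Q.mul_mem_right _ h4
    · obtain ⟨hm, hch⟩ := hfield Q hQ hpQ
      letI : Field (𝓞 F' ⧸ Q) := Ideal.Quotient.field Q
      obtain ⟨z, -, hcz⟩ := zeta_c p hp16 (Ideal.Quotient.mk Q c') (hmkc Q)
      rw [← Ideal.Quotient.eq_zero_iff_mem, map_sub, map_pow, sub_eq_zero, hcz, ← map_inv₀, ← map_add,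
        ← map_pow, ZMod.pow_card]
  have hpp : ∀ Q : Ideal (𝓞 F'), Q.IsPrime → (p : 𝓞 F') ∈ Q → PP c' Q := by
    intro Q hQ hpQ
    obtain ⟨hm, hch⟩ := hfield Q hQ hpQ
    letI : Field (𝓞 F' ⧸ Q) := Ideal.Quotient.field Q
    have hfr : ∀ x : 𝓞 F' ⧸ Q, x ^ p = x := by
      intro x
      obtain ⟨x, rfl⟩ := Ideal.Quotient.mk_surjective x
      have := Ideal.Quotient.eq_zero_iff_mem.2 (hep Q hQ hpQ x)
      rwa [map_sub, map_pow, sub_eq_zero] at this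
    refine ⟨hQ, by rintro rfl; exact hp.ne_zero (by simpa using hpQ), two_notMem hodd Q hQ hpQ, ?_, ?_⟩
    · intro x hx
      rw [← Ideal.Quotient.eq_zero_iff_mem, map_sub, map_pow, map_add, map_ofNat, sub_eq_zero] at hx
      exact pp_field p hp16 hfr _ (hmkc Q) _ hx
    · intro x hx
      rw [← Ideal.Quotient.eq_zero_iff_mem, map_sub, map_pow, map_sub, map_ofNat, sub_eq_zero,
        sub_eq_add_neg (2 : 𝓞 F' ⧸ Q)] at hx
      exact pp_field p hp16 hfr _ (by rw [neg_sq]; exact hmkc Q) _ hx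
  have hpr : (Ideal.span {(p : 𝓞 F)}).IsPrime := by
    apply Ideal.isPrime_of_irreducible_absNorm
    have := hF.absNorm_int p
    rw [Int.cast_natCast, Int.natAbs_natCast] at this
    rw [this]; exact hp
  obtain ⟨Q, hQ, hQ0, hQp⟩ := exists_prime_mem (S := F') (Ideal.span {(p : 𝓞 F)}) hpr (by
    simpa using hp.ne_zero)
  have hpQ : (p : 𝓞 F') ∈ Q := by
    have : (p : 𝓞 F) ∈ Q.comap (algebraMap (𝓞 F) (𝓞 F')) := hQp ▸ Ideal.mem_span_singleton_self _
    rwa [Ideal.mem_comap, map_natCast] at this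
  have hnf : Q.map (sg σ) ≠ Q := by
    intro hfix
    have h2 := two_notMem hodd Q hQ hpQ
    obtain ⟨a, ha⟩ := (two_sq p (by omega)).2 (by omega)
    obtain ⟨a, rfl⟩ := ZMod.intCast_surjective a
    have h3 : (p : ℤ) ∣ 2 - a * a := by
      rw [← ZMod.intCast_zmod_eq_zero_iff_dvd]
      push_cast
      rw [ha, sub_self]
    obtain ⟨t, ht⟩ := h3
    have h4 : (c' - a) * (c' + a) ∈ Q := by
      have : (c' - a) * (c' + a) = p * t := by
        have : (2 : 𝓞 F') - a * a = p * t := by exact_mod_cast congrArg (Int.cast : ℤ → 𝓞 F') ht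
        linear_combination this + hc2
      rw [this]
      exact Q.mul_mem_right _ hpQ
    have hs : ∀ x ∈ Q, sg σ x ∈ Q := fun x hx => hfix ▸ Ideal.mem_map_of_mem _ hx
    have h5 : (2 : 𝓞 F') * c' ∈ Q := by
      rcases hQ.mem_or_mem h4 with h | h
      · have h6 := hs _ h
        rw [map_sub, s.sgc, map_intCast] at h6
        have := Q.sub_mem h h6
        ring_nf at this
        rwa [mul_comm] at this
      · have h6 := hs _ h
        rw [map_add, s.sgc, map_intCast] at h6
        have := Q.sub_mem h h6
        ring_nf at this
        rwa [mul_comm] at this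
    rcases hQ.mem_or_mem h5 with h6 | h6
    · exact h2 h6
    · apply h2
      rw [← hc2, pow_two]
      exact Q.mul_mem_right _ h6
  refine ⟨Q, Q.map (sg σ), hpp Q hQ hpQ, hpp _ (s.q.isPrime_map_sg hQ) ?_, hnf.symm, ?_⟩
  · have := Ideal.mem_map_of_mem (sg σ) hpQ
    rwa [map_natCast] at this
  · rcases s.q.trich hQ hQ0 with ⟨-, h⟩ | ⟨h, -⟩ | h
    · rw [← h, hQp, Ideal.map_span, Set.image_singleton, map_natCast]
    · exact absurd h hnf
    · exact absurd h.fixed hnf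

open NumberField
open scoped nonZeroDivisors

theorem Layer.two_of {F K : Type*} [Field F] [Field K] [NumberField F] [NumberField K] [Algebra F K]
    {τ : K →+* K} {c : 𝓞 F} {θ : 𝓞 K} {d : ℕ} (s : Layer F τ c θ d) (k : ℕ) (hd : d = 8 * k + 1)
    (e : 𝓞 F) (he : e ^ 2 = 4 - c ^ 2) : ∃ l, Two F τ c l := by
  set A := algebraMap (𝓞 F) (𝓞 K) with hA
  have hθ : ((θ : K)) ^ 2 = -(8 * k + 1) := by
    have := congrArg (fun t : 𝓞 K => (t : K)) s.hθ
    simp only [ic_pow, ic_neg, ic_nat] at this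
    rw [this, hd]; push_cast; ring
  have he' : ((A e : 𝓞 K) : K) ^ 2 = 4 - ((A c : 𝓞 K) : K) ^ 2 := by
    have := congrArg (fun t : 𝓞 F => ((A t : 𝓞 K) : K)) he
    simp only [map_pow, map_sub, ic_pow, ic_sub] at this
    rw [this, hA, map_ofNat, map_ofNat]
  set w : K := (((A c : 𝓞 K) : K) + ((A e : 𝓞 K) : K) * (θ : K)) / 2 with hw
  have hτ : τ w = (((A c : 𝓞 K) : K) - ((A e : 𝓞 K) : K) * (θ : K)) / 2 := by
    have hcc : τ ((A c : 𝓞 K) : K) = ((A c : 𝓞 K) : K) := by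
      rw [hA, coe_alg, s.q.fix]
    have hee : τ ((A e : 𝓞 K) : K) = ((A e : 𝓞 K) : K) := by
      rw [hA, coe_alg, s.q.fix]
    rw [hw, map_div₀, map_add, map_mul, s.q.conj, hcc, hee, map_ofNat]
    ring
  have h1 : w + τ w = ((A c : 𝓞 K) : K) := by rw [hτ, hw]; ring
  have h2 : w * τ w = ((A (1 + 2 * k * (4 - c ^ 2)) : 𝓞 K) : K) := by
    rw [hτ, hw, hA]
    simp only [map_add, map_sub, map_mul, map_pow, map_one, map_ofNat, map_natCast, ic_add, ic_mul, ic_sub,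
      ic_pow, ic_one, ic_ofNat, ic_nat]
    rw [← hA]
    linear_combination (-(((A e : 𝓞 K) : K) ^ 2) / 4) * hθ + (8 * k + 1) / 4 * he'
  have hwi : IsIntegral ℤ w := by
    apply isIntegral_trans (A := 𝓞 K) (R := ℤ)
    refine ⟨Polynomial.X ^ 2 + Polynomial.C (-A c) * Polynomial.X + Polynomial.C (A (1 + 2 * k * (4 - c ^ 2))), ?_, ?_⟩
    · monicity!
    · simp only [Polynomial.eval₂_add, Polynomial.eval₂_mul, Polynomial.eval₂_pow, Polynomial.eval₂_X,
        Polynomial.eval₂_C]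
      rw [map_neg]
      change w ^ 2 + -((A c : 𝓞 K) : K) * w + ((A (1 + 2 * k * (4 - c ^ 2)) : 𝓞 K) : K) = 0
      rw [← h1, ← h2]; ring
  set W : 𝓞 K := ⟨w, hwi⟩ with hW
  have g1 : W + sg τ W = A c := by
    apply RingOfIntegers.ext
    rw [ic_add, coe_sg]
    exact h1
  have g2 : W * sg τ W = A (1 + 2 * k * (4 - c ^ 2)) := by
    apply RingOfIntegers.ext
    rw [ic_mul, coe_sg]
    exact h2
  refine s.exists_two (1 + W) 1 (1 + 2 * k * (2 - c)) ?_ ?_ ?_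
  · rw [map_add, map_one]
    have : (1 + W) * (1 + sg τ W) = 1 + (W + sg τ W) + W * sg τ W := by ring
    rw [this, g1, g2, ← map_one A, ← map_add, ← map_add]
    congr 1
    ring
  · rw [map_add, map_one]
    have : (1 + W) + (1 + sg τ W) = 2 + (W + sg τ W) := by ring
    rw [this, g1, mul_one, map_add, map_ofNat]
  · intro h
    apply s.fd.prime2.ne_top
    rw [Ideal.eq_top_iff_one]
    refine (Ideal.add_mem_iff_left _ ?_).1 h
    rw [mul_assoc]
    exact Ideal.mul_mem_right _ _ s.fd.two_mem

theorem AStep.mk' {F F' X L : Type*} [Field F] [NumberField F] [Field F'] [NumberField F'] [Field X]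
    [NumberField X] [Field L] [NumberField L] [Algebra F F'] [Algebra F X] [Algebra F' L] [Algebra X L]
    {σ₀ : F' →+* F'} {τX : X →+* X} {τ : L →+* L} {σ : L →+* L} {c : 𝓞 F} {c' : 𝓞 F'}
    {θX : 𝓞 X} {θ : 𝓞 L} {DX D : ℕ} (st : FStep F σ₀ c c') (lX : Layer F τX c θX DX)
    (lL : Layer F' τ c' θ D) (qs : IsQuad X σ (algebraMap F' L (c' : F')))
    (comp : ∀ u : F, algebraMap X L (algebraMap F X u) = algebraMap F' L (algebraMap F F' u)) :
    AStep σ₀ τX τ σ c c' θX θ DX D := by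
  refine ⟨st, lX, lL, qs, comp, ?_⟩
  intro u
  obtain ⟨a, b, rfl⟩ := st.q.span u
  have hf : ∀ a : F, σ (algebraMap F' L (algebraMap F F' a)) = algebraMap F' L (algebraMap F F' a) := by
    intro a; rw [← comp, qs.fix]
  simp only [map_add, map_mul, st.q.fix, st.q.conj, hf, qs.conj, map_neg]

open NumberField
open scoped nonZeroDivisors

section IF

noncomputable instance ifAlg {k L : IntermediateField ℚ ℂ} [h : Fact (k ≤ L)] : Algebra k L :=
  (IntermediateField.inclusion h.out).toRingHom.toAlgebra

theorem ifAlg_coe {k L : IntermediateField ℚ ℂ} [h : Fact (k ≤ L)] (u : k) :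
    ((algebraMap k L u : L) : ℂ) = u := rfl

/-- the quadratic extension of `k` by `θ` -/
def quadExt (k : IntermediateField ℚ ℂ) (θ : ℂ) (hθ : θ ^ 2 ∈ k) : IntermediateField ℚ ℂ where
  carrier := {x | ∃ u ∈ k, ∃ v ∈ k, x = u + v * θ}
  mul_mem' := by
    rintro _ _ ⟨u, hu, v, hv, rfl⟩ ⟨u', hu', v', hv', rfl⟩
    exact ⟨u * u' + v * v' * θ ^ 2, k.add_mem (k.mul_mem hu hu') (k.mul_mem (k.mul_mem hv hv') hθ),
      u * v' + v * u', k.add_mem (k.mul_mem hu hv') (k.mul_mem hv hu'), by ring⟩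
  add_mem' := by
    rintro _ _ ⟨u, hu, v, hv, rfl⟩ ⟨u', hu', v', hv', rfl⟩
    exact ⟨u + u', k.add_mem hu hu', v + v', k.add_mem hv hv', by ring⟩
  algebraMap_mem' := fun r => ⟨_, k.algebraMap_mem r, 0, k.zero_mem, by ring⟩
  inv_mem' := by
    rintro _ ⟨u, hu, v, hv, rfl⟩
    by_cases h : u - v * θ = 0
    · have : u + v * θ = u + u := by linear_combination -h
      rw [this]
      exact ⟨(u + u)⁻¹, k.inv_mem (k.add_mem hu hu), 0, k.zero_mem, by ring⟩
    · by_cases h' : u + v * θ = 0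
      · exact ⟨0, k.zero_mem, 0, k.zero_mem, by rw [h']; simp⟩
      have hn : u ^ 2 - v ^ 2 * θ ^ 2 ∈ k := k.sub_mem (k.pow_mem hu 2) (k.mul_mem (k.pow_mem hv 2) hθ)
      refine ⟨u * (u ^ 2 - v ^ 2 * θ ^ 2)⁻¹, k.mul_mem hu (k.inv_mem hn), -v * (u ^ 2 - v ^ 2 * θ ^ 2)⁻¹,
        k.mul_mem (k.neg_mem hv) (k.inv_mem hn), ?_⟩
      have : u ^ 2 - v ^ 2 * θ ^ 2 = (u + v * θ) * (u - v * θ) := by ring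
      rw [this]
      field_simp
      ring

theorem quadExt_le (k : IntermediateField ℚ ℂ) (θ : ℂ) (hθ : θ ^ 2 ∈ k) : k ≤ quadExt k θ hθ :=
  fun x hx => ⟨x, hx, 0, k.zero_mem, by ring⟩

theorem quadExt_mem (k : IntermediateField ℚ ℂ) (θ : ℂ) (hθ : θ ^ 2 ∈ k) : θ ∈ quadExt k θ hθ :=
  ⟨0, k.zero_mem, 1, k.one_mem, by ring⟩

theorem if_quad {k L : IntermediateField ℚ ℂ} [h : Fact (k ≤ L)] (θ : L) (h2 : (θ : ℂ) ^ 2 ∈ k)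
    (hn : (θ : ℂ) ∉ k) (hg : ∀ M : IntermediateField ℚ ℂ, k ≤ M → (θ : ℂ) ∈ M → L ≤ M) :
    ∃ σ : L →+* L, IsQuad k σ θ := by
  apply quad_exists
  · exact ⟨⟨_, h2⟩, Subtype.ext rfl⟩
  · intro u hu
    apply hn
    rw [← hu]
    exact u.2
  · intro x
    obtain ⟨u, hu, v, hv, hx⟩ := hg _ (quadExt_le k θ h2) (quadExt_mem k θ h2) x.2
    exact ⟨⟨u, hu⟩, ⟨v, hv⟩, Subtype.ext hx⟩

theorem if_not_mem {k X : IntermediateField ℚ ℂ} [h : Fact (k ≤ X)] {τ : X →+* X} {θ : X}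
    (q : IsQuad k τ θ) (hr : ∀ x ∈ k, x.im = 0) (hθ : (θ : ℂ).re = 0) (c : ℂ) (hc : c.im = 0)
    (hck : c ∉ k) : c ∉ X := by
  intro hcX
  obtain ⟨u, v, huv⟩ := q.span ⟨c, hcX⟩
  have h1 : c = (u : ℂ) + (v : ℂ) * (θ : ℂ) := congrArg (Subtype.val : X → ℂ) huv
  have h2 := congrArg Complex.im h1
  rw [Complex.add_im, Complex.mul_im, hr _ u.2, hr _ v.2, hc] at h2
  have hθ0 : (θ : ℂ) ≠ 0 := fun h => q.ne (Subtype.ext h)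
  have hθi : (θ : ℂ).im ≠ 0 := fun h => hθ0 (Complex.ext hθ h)
  have hv : (v : ℂ).re = 0 := by
    have : (v : ℂ).re * (θ : ℂ).im = 0 := by linarith
    exact (mul_eq_zero.1 this).resolve_right hθi
  have hv0 : (v : ℂ) = 0 := Complex.ext hv (hr _ v.2)
  rw [hv0, zero_mul, add_zero] at h1
  exact hck (h1 ▸ u.2)

end IF

section fields

/-- the real cyclotomic generators -/
noncomputable def cc (n : ℕ) : ℂ := ((2 * Real.cos (2 * Real.pi / 2 ^ (n + 2)) : ℝ) : ℂ)

theorem cc_zero : cc 0 = 0 := by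
  unfold cc
  have : 2 * Real.pi / 2 ^ (0 + 2) = Real.pi / 2 := by ring
  rw [this, Real.cos_pi_div_two]; simp

theorem cc_sq (n : ℕ) : cc (n + 1) ^ 2 = 2 + cc n := by
  unfold cc
  have : 2 * Real.pi / 2 ^ (n + 2) = 2 * (2 * Real.pi / 2 ^ (n + 1 + 2)) := by
    field_simp
    ring
  rw [this, Real.cos_two_mul]
  push_cast
  ring

theorem cc_im (n : ℕ) : (cc n).im = 0 := Complex.ofReal_im _

theorem cc_int (n : ℕ) : IsIntegral ℤ (cc n) := by
  induction n with
  | zero => rw [cc_zero]; exact isIntegral_zero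
  | succ n ih =>
    apply IsIntegral.of_pow two_pos
    rw [cc_sq]
    have h2 : IsIntegral ℤ (2 : ℂ) := by
      have := isIntegral_algebraMap (R := ℤ) (A := ℂ) (x := 2)
      simpa using this
    exact h2.add ih

noncomputable def Fc (n : ℕ) : IntermediateField ℚ ℂ := IntermediateField.adjoin ℚ {cc n}

theorem cc_mem (n : ℕ) : cc n ∈ Fc n := IntermediateField.mem_adjoin_simple_self ℚ _

theorem Fc_le {n : ℕ} {M : IntermediateField ℚ ℂ} : Fc n ≤ M ↔ cc n ∈ M := by
  unfold Fc
  rw [IntermediateField.adjoin_le_iff, Set.singleton_subset_iff]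
  rfl

theorem Fc_real (n : ℕ) : ∀ x ∈ Fc n, x.im = 0 := by
  let R : IntermediateField ℚ ℂ :=
    { carrier := {x | x.im = 0}
      mul_mem' := by
        intro a b ha hb
        simp only [Set.mem_setOf_eq] at *
        rw [Complex.mul_im, ha, hb]; ring
      add_mem' := by
        intro a b ha hb
        simp only [Set.mem_setOf_eq] at *
        rw [Complex.add_im, ha, hb]; ring
      algebraMap_mem' := fun r => by simp
      inv_mem' := by
        intro a ha
        simp only [Set.mem_setOf_eq] at *
        simp [Complex.inv_im, ha] }
  have : Fc n ≤ R := Fc_le.2 (cc_im n)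
  intro x hx
  exact this hx

theorem nf_adjoin (S : Set ℂ) (hS : S.Finite) (h : ∀ x ∈ S, IsIntegral ℤ x) :
    NumberField (IntermediateField.adjoin ℚ S) := by
  haveI := hS.to_subtype
  haveI : FiniteDimensional ℚ (IntermediateField.adjoin ℚ S) :=
    IntermediateField.finiteDimensional_adjoin (fun x hx => (h x hx).tower_top)
  exact ⟨⟩

theorem sq_finite (a : ℂ) : {z : ℂ | z ^ 2 = a}.Finite := by
  by_cases h : ∃ w : ℂ, w ^ 2 = a
  · obtain ⟨w, rfl⟩ := h
    apply Set.Finite.subset (Set.toFinite {w, -w})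
    intro z hz
    exact sq_eq_sq_iff_eq_or_eq_neg.1 hz
  · apply Set.Finite.subset Set.finite_empty
    intro z hz
    exact absurd ⟨z, hz⟩ h

theorem sq_int (m : ℤ) (z : ℂ) (hz : z ^ 2 = (m : ℂ)) : IsIntegral ℤ z := by
  apply IsIntegral.of_pow two_pos
  rw [hz]
  exact isIntegral_algebraMap (R := ℤ) (x := m)

instance nfF (n : ℕ) : NumberField (Fc n) :=
  nf_adjoin _ (Set.finite_singleton _) (by rintro x rfl; exact cc_int n)

end fields

open NumberField
open scoped nonZeroDivisors

section concrete

/-- the square root of `-d` -/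
noncomputable def dl (d : ℕ) : ℂ := Complex.I * ((Real.sqrt d : ℝ) : ℂ)

theorem dl_sq (d : ℕ) : dl d ^ 2 = -(d : ℂ) := by
  unfold dl
  rw [mul_pow, Complex.I_sq, ← Complex.ofReal_pow, Real.sq_sqrt (Nat.cast_nonneg d)]
  simp

theorem dl_re (d : ℕ) : (dl d).re = 0 := by
  unfold dl
  simp

noncomputable def Kc (n d : ℕ) : IntermediateField ℚ ℂ := LplusField n (-(d : ℤ))

noncomputable def Xc (d : ℕ) : IntermediateField ℚ ℂ := quadField (-2 * (d : ℤ))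

theorem Kc_le {n d : ℕ} {M : IntermediateField ℚ ℂ} : Kc n d ≤ M ↔ cc n ∈ M ∧ dl d ∈ M := by
  unfold Kc LplusField
  rw [IntermediateField.adjoin_le_iff, Set.union_subset_iff, Set.singleton_subset_iff]
  refine and_congr Iff.rfl ?_
  constructor
  · intro h
    apply h
    change dl d ^ 2 = _
    rw [dl_sq]; push_cast; rfl
  · intro h z hz
    have hz' : z ^ 2 = dl d ^ 2 := by
      rw [dl_sq]; simpa using hz
    rcases sq_eq_sq_iff_eq_or_eq_neg.1 hz' with rfl | rfl
    · exact h
    · exact M.neg_mem h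

theorem Xc_le {d : ℕ} {M : IntermediateField ℚ ℂ} : Xc d ≤ M ↔ cc 1 * dl d ∈ M := by
  unfold Xc quadField
  have hsq : (cc 1 * dl d) ^ 2 = -2 * (d : ℂ) := by
    rw [mul_pow, dl_sq, cc_sq, cc_zero]; ring
  rw [IntermediateField.adjoin_le_iff]
  constructor
  · intro h
    apply h
    change (cc 1 * dl d) ^ 2 = _
    rw [hsq]; push_cast; rfl
  · intro h z hz
    have hz' : z ^ 2 = (cc 1 * dl d) ^ 2 := by
      rw [hsq]; simpa using hz
    rcases sq_eq_sq_iff_eq_or_eq_neg.1 hz' with rfl | rfl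
    · exact h
    · exact M.neg_mem h

theorem cc_mem_K (n d : ℕ) : cc n ∈ Kc n d := (Kc_le.1 le_rfl).1
theorem dl_mem_K (n d : ℕ) : dl d ∈ Kc n d := (Kc_le.1 le_rfl).2
theorem dl_mem_X (d : ℕ) : cc 1 * dl d ∈ Xc d := Xc_le.1 le_rfl

theorem cc_of_succ {n : ℕ} {M : IntermediateField ℚ ℂ} (h : cc (n + 1) ∈ M) : cc n ∈ M := by
  have : cc n = cc (n + 1) ^ 2 - 2 := by rw [cc_sq]; ring
  rw [this]
  exact M.sub_mem (M.pow_mem h 2) (ofNat_mem M 2)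

instance nfK (n d : ℕ) : NumberField (Kc n d) :=
  nf_adjoin _ ((Set.finite_singleton _).union (sq_finite _)) (by
    rintro x (rfl | hx)
    · exact cc_int n
    · exact sq_int _ x hx)

instance nfX (d : ℕ) : NumberField (Xc d) :=
  nf_adjoin _ (sq_finite _) (fun x hx => sq_int _ x hx)

instance leF (n : ℕ) : Fact (Fc n ≤ Fc (n + 1)) := ⟨Fc_le.2 (cc_of_succ (cc_mem _))⟩
instance leFK (n d : ℕ) : Fact (Fc n ≤ Kc n d) := ⟨Fc_le.2 (cc_mem_K n d)⟩
instance leK (n d : ℕ) : Fact (Kc n d ≤ Kc (n + 1) d) :=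
  ⟨Kc_le.2 ⟨cc_of_succ (cc_mem_K _ _), dl_mem_K _ _⟩⟩
instance leFX (d : ℕ) : Fact (Fc 0 ≤ Xc d) := ⟨Fc_le.2 (by rw [cc_zero]; exact zero_mem _)⟩
instance leXK (d : ℕ) : Fact (Xc d ≤ Kc 1 d) := ⟨Xc_le.2 (mul_mem (cc_mem_K 1 d) (dl_mem_K 1 d))⟩

/-- integral elements of a subfield from integral complex numbers -/
noncomputable def iO (M : IntermediateField ℚ ℂ) (z : ℂ) (hz : z ∈ M) (hi : IsIntegral ℤ z) : 𝓞 M :=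
  ⟨⟨z, hz⟩, by
    have := (isIntegral_algHom_iff (M.val.restrictScalars ℤ) M.val.injective (x := ⟨z, hz⟩)).1 hi
    exact this⟩

theorem iO_coe (M : IntermediateField ℚ ℂ) (z : ℂ) (hz : z ∈ M) (hi : IsIntegral ℤ z) :
    (((iO M z hz hi : 𝓞 M) : M) : ℂ) = z := rfl

theorem O_ext {M : IntermediateField ℚ ℂ} {x y : 𝓞 M} (h : ((x : M) : ℂ) = ((y : M) : ℂ)) : x = y :=
  RingOfIntegers.ext (Subtype.ext h)

noncomputable def cO (n : ℕ) : 𝓞 (Fc n) := iO _ (cc n) (cc_mem n) (cc_int n)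

theorem cO_zero : cO 0 = 0 := O_ext cc_zero

theorem dl_int (d : ℕ) : IsIntegral ℤ (dl d) := sq_int (-(d : ℤ)) _ (by rw [dl_sq]; push_cast; rfl)

noncomputable def dK (n d : ℕ) : 𝓞 (Kc n d) := iO _ (dl d) (dl_mem_K n d) (dl_int d)
noncomputable def dX (d : ℕ) : 𝓞 (Xc d) := iO _ (cc 1 * dl d) (dl_mem_X d) ((cc_int 1).mul (dl_int d))

theorem cO_sq (n : ℕ) : cO (n + 1) ^ 2 = algebraMap (𝓞 (Fc n)) (𝓞 (Fc (n + 1))) (2 + cO n) := by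
  apply O_ext
  rw [ic_pow, coe_alg, ifAlg_coe, ic_add, ic_two]
  exact cc_sq n

theorem ratF : RatF (Fc 0) := by
  intro x
  have : Fc 0 ≤ ⊥ := Fc_le.2 (by rw [cc_zero]; exact zero_mem _)
  obtain ⟨q, hq⟩ := IntermediateField.mem_bot.1 (this x.2)
  exact ⟨q, Subtype.ext (by rw [← hq]; simp)⟩

theorem cc_not_mem (n : ℕ) (h : FD (Fc n) (cO n)) : cc (n + 1) ∉ Fc n := by
  intro hm
  have h1 : (iO _ (cc (n + 1)) hm (cc_int _) : 𝓞 (Fc n)) ^ 2 = 2 + cO n := by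
    apply O_ext
    rw [ic_pow, ic_add, ic_two]
    exact cc_sq n
  have h2 := h.n2p
  rw [← h1, ← Ideal.span_singleton_pow, map_pow] at h2
  generalize Ideal.absNorm (Ideal.span {iO (Fc n) (cc (n + 1)) hm (cc_int _)}) = t at h2
  have : t < 2 := by nlinarith
  interval_cases t <;> omega

theorem fstep_of (n : ℕ) (h : FD (Fc n) (cO n)) : ∃ σ, FStep (Fc n) σ (cO n) (cO (n + 1)) := by
  obtain ⟨σ, hσ⟩ := if_quad (k := Fc n) (L := Fc (n + 1)) (cO (n + 1) : Fc (n + 1)) (by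
    change cc (n + 1) ^ 2 ∈ Fc n
    rw [cc_sq]
    exact add_mem (ofNat_mem _ 2) (cc_mem n)) (cc_not_mem n h) (fun M _ hM => Fc_le.2 hM)
  exact ⟨σ, h, hσ, cO_sq n⟩

theorem fd_all (n : ℕ) : FD (Fc n) (cO n) := by
  induction n with
  | zero => rw [cO_zero]; exact ratF.fd
  | succ n ih =>
    obtain ⟨σ, hs⟩ := fstep_of n ih
    exact hs.fd'

theorem fstep (n : ℕ) : ∃ σ, FStep (Fc n) σ (cO n) (cO (n + 1)) := fstep_of n (fd_all n)

theorem im_not_real {z : ℂ} (hz : z.re = 0) (h0 : z ≠ 0) (n : ℕ) : z ∉ Fc n := fun h =>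
  h0 (Complex.ext hz (Fc_real n z h))

theorem dl_ne {d : ℕ} (hd : d ≠ 0) : dl d ≠ 0 := by
  intro h
  have := dl_sq d
  rw [h, zero_pow two_ne_zero, eq_comm, neg_eq_zero] at this
  exact hd (by exact_mod_cast this)

theorem cc_one_ne : cc 1 ≠ 0 := by
  intro h
  have := cc_sq 0
  rw [h, cc_zero] at this
  norm_num at this

theorem layer (n : ℕ) {d : ℕ} (hd : d ≠ 0) : ∃ τ, Layer (Fc n) τ (cO n) (dK n d) d := by
  obtain ⟨τ, hτ⟩ := if_quad (k := Fc n) (L := Kc n d) (dK n d : Kc n d) (by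
    change dl d ^ 2 ∈ Fc n
    rw [dl_sq]
    exact neg_mem (_root_.natCast_mem _ d)) (im_not_real (dl_re d) (dl_ne hd) n)
    (fun M h1 h2 => Kc_le.2 ⟨Fc_le.1 h1, h2⟩)
  refine ⟨τ, fd_all n, hτ, O_ext ?_⟩
  rw [ic_pow, ic_neg, ic_nat]
  exact dl_sq d

theorem dX_re (d : ℕ) : (cc 1 * dl d).re = 0 := by
  rw [Complex.mul_re, cc_im, dl_re]; ring

theorem layerX {d : ℕ} (hd : d ≠ 0) : ∃ τ, Layer (Fc 0) τ 0 (dX d) (2 * d) := by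
  have hsq : (cc 1 * dl d) ^ 2 = -((2 * d : ℕ) : ℂ) := by
    rw [mul_pow, dl_sq, cc_sq, cc_zero]; push_cast; ring
  obtain ⟨τ, hτ⟩ := if_quad (k := Fc 0) (L := Xc d) (dX d : Xc d) (by
    change (cc 1 * dl d) ^ 2 ∈ Fc 0
    rw [hsq]
    exact neg_mem (_root_.natCast_mem _ _)) (im_not_real (dX_re d) (mul_ne_zero cc_one_ne (dl_ne hd)) 0)
    (fun M h1 h2 => Xc_le.2 h2)
  refine ⟨τ, ratF.fd, hτ, O_ext ?_⟩
  rw [ic_pow, ic_neg, ic_nat]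
  exact hsq

/-- the sine elements -/
theorem exists_s (n : ℕ) : ∃ e : 𝓞 (Fc (n + 1)), e ^ 2 = 4 - cO (n + 1) ^ 2 := by
  have key : ∃ z ∈ Fc (n + 1), z ^ 2 = 4 - cc (n + 1) ^ 2 := by
    induction n with
    | zero =>
      refine ⟨cc 1, cc_mem 1, ?_⟩
      rw [cc_sq, cc_zero]; norm_num
    | succ n ih =>
      obtain ⟨z, hz, h⟩ := ih
      have hle : Fc (n + 1) ≤ Fc (n + 1 + 1) := (leF (n + 1)).out
      refine ⟨z / cc (n + 1 + 1), div_mem (hle hz) (cc_mem _), ?_⟩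
      have h0 : 2 + cc (n + 1) ≠ 0 := by
        intro h0
        apply (fd_all (n + 1)).ne2
        apply O_ext
        rw [ic_add, ic_two]
        exact h0
      rw [div_pow, h, cc_sq (n + 1)]
      field_simp
      ring
  obtain ⟨z, hz, h⟩ := key
  have h4 : IsIntegral ℤ (4 : ℂ) := by
    have := isIntegral_algebraMap (R := ℤ) (A := ℂ) (x := 4)
    simpa using this
  refine ⟨iO _ z hz (IsIntegral.of_pow two_pos (by rw [h]; exact h4.sub ((cc_int _).pow 2))), O_ext ?_⟩
  rw [ic_pow, ic_sub, ic_pow, ic_ofNat]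
  exact h

end concrete

open NumberField
open scoped nonZeroDivisors

section final

theorem it_cO (n : ℕ) : It n (cO n) := by
  induction n with
  | zero => exact cO_zero
  | succ n ih =>
    apply It.succ
    have h : cO (n + 1) ^ 2 - 2 = algebraMap (𝓞 (Fc n)) (𝓞 (Fc (n + 1))) (cO n) := by
      rw [cO_sq, map_add, map_ofNat]; ring
    rw [h]
    exact ih.map _

theorem ep_F {d ℓ N : ℕ} (h : Ell d ℓ (N + 3)) (n : ℕ) (hn : n ≤ N) : EP (Fc n) ℓ := by
  induction n with
  | zero => exact ratF.ep ℓ h.prime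
  | succ n ih =>
    obtain ⟨σ, hs⟩ := fstep n
    exact hs.ep h.prime (h.prime.odd_of_ne_two h.odd) (it_cO (n + 1))
      ((pow_dvd_pow 2 (by omega)).trans h.dvd) (ih (by omega))

theorem ep_K {d ℓ N : ℕ} (hd : d ≠ 0) (h : Ell d ℓ (N + 3)) (n : ℕ) (hn : n ≤ N) : EP (Kc n d) ℓ := by
  obtain ⟨τ, hs⟩ := layer n hd
  exact hs.ep h.prime (h.prime.odd_of_ne_two h.odd) (fun hl => h.nd (hl.mul_left _)) h.s1 (ep_F h n hn)

theorem base_all {d : ℕ} (hB : Base (cO 1) d) (n : ℕ) : Base (cO (n + 1)) d := by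
  induction n with
  | zero => exact hB
  | succ n ih =>
    obtain ⟨σ, hs⟩ := fstep (n + 1)
    exact hs.base ih

theorem qs_K (n : ℕ) {d : ℕ} (hd : d ≠ 0) :
    ∃ σ, IsQuad (Kc n d) σ (algebraMap (Fc (n + 1)) (Kc (n + 1) d) (cO (n + 1) : Fc (n + 1))) := by
  obtain ⟨τ, hl⟩ := layer n hd
  apply if_quad (k := Kc n d) (L := Kc (n + 1) d)
  · change cc (n + 1) ^ 2 ∈ Kc n d
    rw [cc_sq]
    exact add_mem (ofNat_mem _ 2) (cc_mem_K n d)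
  · exact if_not_mem hl.q (Fc_real n) (dl_re d) _ (cc_im (n + 1)) (cc_not_mem n (fd_all n))
  · exact fun M h1 h2 => Kc_le.2 ⟨h2, (Kc_le.1 h1).2⟩

theorem qs_X {d : ℕ} (hd : d ≠ 0) :
    ∃ σ, IsQuad (Xc d) σ (algebraMap (Fc 1) (Kc 1 d) (cO 1 : Fc 1)) := by
  obtain ⟨τ, hl⟩ := layerX hd
  apply if_quad (k := Xc d) (L := Kc 1 d)
  · change cc 1 ^ 2 ∈ Xc d
    rw [cc_sq, cc_zero, add_zero]
    exact ofNat_mem _ 2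
  · exact if_not_mem hl.q (Fc_real 0) (dX_re d) _ (cc_im 1) (cc_not_mem 0 (fd_all 0))
  · intro M h1 h2
    refine Kc_le.2 ⟨h2, ?_⟩
    have h3 := div_mem (Xc_le.1 h1) (show cc 1 ∈ M from h2)
    rwa [mul_div_cancel_left₀ _ cc_one_ne] at h3

theorem hg_K {X : Type*} [Field X] [NumberField X] {n d : ℕ} [Algebra X (Kc n d)] {σ : Kc n d →+* Kc n d}
    {η : Kc n d} (q : IsQuad X σ η) (hd : d ≠ 0) (hell : ∀ N, ∃ ℓ, Ell d ℓ (N + 3))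
    {τ : Kc n d →+* Kc n d} (hs : Layer (Fc n) τ (cO n) (dK n d) d) {l : Ideal (𝓞 (Kc n d))}
    (hl : Two (Fc n) τ (cO n) l) :
    ∃ g : ClassGroup (𝓞 (Kc n d)), ∀ (x : ClassGroup (𝓞 (Kc n d))) (e : ℤ)
      (y : ClassGroup (𝓞 X)), g ≠ x ^ 2 * cl l ^ e *
        clMap (algebraMap (𝓞 X) (𝓞 (Kc n d))) (algInj X (Kc n d)) y := by
  obtain ⟨ℓ, hE⟩ := hell n
  exact exists_g q hd hs.hθK hE.prime (ep_K hd hE n le_rfl) (hl.absNorm hs) (hs.l_sq hl) hE.r1 hE.r2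

/-- the inductive statement -/
theorem card_K {d : ℕ} (hd : d % 8 = 1) (hB : Base (cO 1) d) (hell : ∀ N, ∃ ℓ, Ell d ℓ (N + 3))
    (hX : ∀ (τ : Xc d →+* Xc d) (l : Ideal (𝓞 (Xc d))), Layer (Fc 0) τ 0 (dX d) (2 * d) → Two (Fc 0) τ 0 l →
      cl l ≠ 1 ∧ (∀ y ∈ CommGroup.primaryComponent (ClassGroup (𝓞 (Xc d))) 2, cl l = y ^ 2 → ∃ z, y = z ^ 2) ∧
     8 ≤ Nat.card (CommGroup.primaryComponent (ClassGroup (𝓞 (Xc d))) 2)) (n : ℕ) :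
    Nat.card (CommGroup.primaryComponent (ClassGroup (𝓞 (Kc (n + 1) d))) 2) =
      2 ^ (n + 1) * Nat.card (CommGroup.primaryComponent (ClassGroup (𝓞 (Xc d))) 2) := by
  have hd0 : d ≠ 0 := by omega
  obtain ⟨k, hk⟩ : ∃ k, d = 8 * k + 1 := ⟨d / 8, by omega⟩
  have h8 : 8 ≤ Nat.card (CommGroup.primaryComponent (ClassGroup (𝓞 (Xc d))) 2) := by
    obtain ⟨τ, hs⟩ := layerX hd0
    obtain ⟨l, hl⟩ := x0_two ratF hs ⟨4 * k, by omega⟩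
    exact (hX τ l hs hl).2.2
  induction n with
  | zero =>
    obtain ⟨σ₀, st⟩ := fstep 0
    obtain ⟨τX, lX⟩ := layerX hd0
    obtain ⟨τ, lL⟩ := layer 1 hd0
    obtain ⟨σ, qs⟩ := qs_X hd0
    obtain ⟨lx, hlx⟩ := x0_two ratF lX ⟨4 * k, by omega⟩
    obtain ⟨e, he⟩ := exists_s 0
    obtain ⟨l, hl⟩ := lL.two_of k hk e he
    obtain ⟨p₁, p₂, h1, h2, hne, hD⟩ := hB
    obtain ⟨Q₁, Q₂, ho⟩ := lL.exists_odds hl p₁ p₂ h1 h2 hne hD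
    rw [cO_zero] at st
    obtain ⟨a1, a2, a3⟩ := hX τX lx lX hlx
    have A := AStep.mk' st lX lL qs (fun u => rfl)
    have := A.main hlx hl ho (Base.nn ⟨p₁, p₂, h1, h2, hne, hD⟩) (hg_K qs hd0 hell lL hl) a1 a2 a3
    rw [this]; ring
  | succ n ih =>
    obtain ⟨σ₀, st⟩ := fstep (n + 1)
    obtain ⟨τX, lX⟩ := layer (n + 1) hd0
    obtain ⟨τ, lL⟩ := layer (n + 1 + 1) hd0
    obtain ⟨σ, qs⟩ := qs_K (n + 1) hd0
    obtain ⟨ex, hex⟩ := exists_s n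
    obtain ⟨lx, hlx⟩ := lX.two_of k hk ex hex
    obtain ⟨e, he⟩ := exists_s (n + 1)
    obtain ⟨l, hl⟩ := lL.two_of k hk e he
    have hB' := base_all hB (n + 1)
    have hnn := hB'.nn
    obtain ⟨p₁, p₂, h1, h2, hne, hD⟩ := hB'
    obtain ⟨Q₁, Q₂, ho⟩ := lL.exists_odds hl p₁ p₂ h1 h2 hne hD
    have hns := lX.l_nsq hlx (base_all hB n).nn
    have A := AStep.mk' st lX lL qs (fun u => rfl)
    have := A.main hlx hl ho hnn (hg_K qs hd0 hell lL hl) (fun h => hns 1 (by rw [h, one_pow]))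
      (fun y _ h => absurd h (hns y)) (by
        rw [ih]
        exact h8.trans (Nat.le_mul_of_pos_left _ (by positivity)))
    rw [this, ih]; ring

theorem iso_K {d : ℕ} (hd : d % 8 = 1) (hB : Base (cO 1) d) (hell : ∀ N, ∃ ℓ, Ell d ℓ (N + 3))
    (hX : ∀ (τ : Xc d →+* Xc d) (l : Ideal (𝓞 (Xc d))), Layer (Fc 0) τ 0 (dX d) (2 * d) → Two (Fc 0) τ 0 l →
      cl l ≠ 1 ∧ (∀ y ∈ CommGroup.primaryComponent (ClassGroup (𝓞 (Xc d))) 2, cl l = y ^ 2 → ∃ z, y = z ^ 2) ∧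
     8 ≤ Nat.card (CommGroup.primaryComponent (ClassGroup (𝓞 (Xc d))) 2)) (r : ℕ)
    (hr : 2 ^ r = Nat.card (CommGroup.primaryComponent (ClassGroup (𝓞 (Xc d))) 2)) (n : ℕ) :
    Nonempty (CommGroup.primaryComponent (ClassGroup (𝓞 (Kc (n + 1) d))) 2 ≃*
      Multiplicative (ZMod 2 × ZMod (2 ^ (n + r)))) := by
  have hd0 : d ≠ 0 := by omega
  obtain ⟨k, hk⟩ : ∃ k, d = 8 * k + 1 := ⟨d / 8, by omega⟩
  obtain ⟨τ, lL⟩ := layer (n + 1) hd0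
  obtain ⟨σ, qs⟩ := qs_K n hd0
  obtain ⟨e, he⟩ := exists_s n
  obtain ⟨l, hl⟩ := lL.two_of k hk e he
  have hB' := base_all hB n
  have hnn := hB'.nn
  obtain ⟨p₁, p₂, h1, h2, hne, hD⟩ := hB'
  obtain ⟨Q₁, Q₂, ho⟩ := lL.exists_odds hl p₁ p₂ h1 h2 hne hD
  obtain ⟨g, hg⟩ := hg_K qs hd0 hell lL hl
  refine grp_iso' (cl l) (lL.l_sq hl) (lL.l_nsq hl hnn) (lL.tors_card hl ho) ⟨g, ?_⟩ (n + r) ?_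
  · intro x e h
    apply hg x e 1
    rw [map_one, mul_one]
    exact h
  · rw [card_K hd hB hell hX n, ← hr]; ring

end final

/-- for `d = pq` with primes `p ≡ q ≡ 3 (mod 8)`, or `d = p` a prime
`≡ 9 (mod 16)` with `2` a fourth power residue mod `p`, and `2^r = h₂(-2d)`:
the 2-class group of `K_{n,d}` (the `n`-th layer of the cyclotomic `ℤ₂`-extension
of `ℚ(√-d)`) is `ℤ/2ℤ × ℤ/2^{n+r-1}ℤ` for all `n ≥ 1`. -/
theorem twoClassGroup_Kfield
    (d : ℕ)
    (hd : (∃ p q : ℕ, p.Prime ∧ q.Prime ∧ p % 8 = 3 ∧ q % 8 = 3 ∧ p ≠ q ∧ d = p * q) ∨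
          (d.Prime ∧ d % 16 = 9 ∧ ∃ x : ZMod d, x ^ 4 = 2))
    (r : ℕ) (hr : 2 ^ r = h2 (-2 * (d : ℤ))) :
    ∀ n : ℕ, 1 ≤ n →
      Nonempty ((twoClassGroup (LplusField n (-(d : ℤ)))) ≃*
        Multiplicative (ZMod 2 × ZMod (2 ^ (n + r - 1)))) := by
  intro n hn
  obtain ⟨m, rfl⟩ : ∃ m, n = m + 1 := ⟨n - 1, by omega⟩
  have hmr : m + 1 + r - 1 = m + r := by omega
  rw [hmr]
  have hr' : 2 ^ r = Nat.card (CommGroup.primaryComponent (ClassGroup (𝓞 (Xc d))) 2) := hr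
  obtain ⟨σ, st⟩ := fstep 0
  rw [cO_zero] at st
  rcases hd with ⟨p, q, hp, hq, hp8, hq8, hpq, rfl⟩ | ⟨hp, hp16, x, hx⟩
  · exact iso_K (by rw [Nat.mul_mod, hp8, hq8]) (st.base (base_pq ratF p q hp hq hp8 hq8 hpq))
      (fun N => let ⟨ℓ, h, _⟩ := pq_ell p q hp hq hp8 hq8 hpq N; ⟨ℓ, h⟩)
      (fun τ l hs hl => by
        obtain ⟨h1, h2⟩ := x0_pq p q hp hq hp8 hq8 hpq ratF hs hl
        exact ⟨fun h => h1 1 (by rw [h, one_pow]), fun y _ h => absurd h (h1 y), h2⟩) r hr' m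
  · exact iso_K (by omega) (base_p ratF st d hp hp16)
      (fun N => let ⟨ℓ, h, _⟩ := p_ell d hp hp16 N; ⟨ℓ, h⟩)
      (fun τ l hs hl => x0_p d hp hp16 x hx ratF hs hl) r hr' m
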